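/- For every η ∈ (0, 1/12) there exist c = c(q, η) > 0 and N₀ = N₀(q, η) such that for every integer N ≥ N₀ there is a function Ψ : 𝔽_q[t] → ℝ with: (1) Ψ(f) ≠ 0 only if f + 1 is irreducible, i.e., the support of Ψ is contained in {P − 1 : P ∈ 𝔽_q[t] irreducible}; (2) Σ_{f ∈ 𝔽_q[t], deg f ≤ N} Ψ(f) · Re(e(fx)) ≥ −q^{N(11/12 + η)}/2 for every x ∈ K_∞; (3) Σ_{f ∈ 𝔽_q[t], deg f ≤ N} Ψ(f) ≥ c · q^N. -/

import Mathlib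

open Polynomial
open scoped Classical

noncomputable section

variable (p : ℕ) [Fact p.Prime] (Fq : Type) [Field Fq] [Fintype Fq] [Algebra (ZMod p) Fq]

/-- `t` as an element of `K∞ = 𝔽_q((1/t))`; the exponent of the Hahn series variable records
the power of `1/t`, so that `res x = x.coeff 1` and `ord x = -x.order`. -/
def Kt : LaurentSeries Fq := HahnSeries.single (-1 : ℤ) 1

/-- The Laurent expansion at infinity of a polynomial. -/
def toK (f : Polynomial Fq) : LaurentSeries Fq := Polynomial.aeval (Kt Fq) f

/-- The additive character `e(x) = exp(2πi · tr(res x)/p)` on `K∞`. -/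
def eC (x : LaurentSeries Fq) : ℂ :=
  Complex.exp (2 * Real.pi * Complex.I *
    ((Algebra.trace (ZMod p) Fq (x.coeff 1)).val : ℂ) / (p : ℂ))

/-- The norm `⟨x⟩ = q^(ord x)` on `K∞` (with `⟨0⟩ = 0`). -/
def Knorm (x : LaurentSeries Fq) : ℝ :=
  if x = 0 then 0 else (Fintype.card Fq : ℝ) ^ (-x.order)

/-- The norm `⟨f⟩ = q^(deg f)` of a polynomial (with `⟨0⟩ = 0`). -/
def pnorm (f : Polynomial Fq) : ℝ :=
  if f = 0 then 0 else (Fintype.card Fq : ℝ) ^ f.natDegree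

set_option linter.unusedSectionVars false

namespace LaurentBound

variable {F : Type*} [Field F]

/-- The coefficients of `z` below `n` vanish. -/
def VanishBelow (n : ℤ) (z : LaurentSeries F) : Prop := ∀ i < n, z.coeff i = 0

theorem vanishBelow_iff {n : ℤ} {z : LaurentSeries F} (hz : z ≠ 0) :
    VanishBelow n z ↔ n ≤ z.order :=
  (HahnSeries.le_order_iff_forall hz).symm

theorem VanishBelow.mono {m n : ℤ} {z : LaurentSeries F} (h : VanishBelow n z) (hmn : m ≤ n) :
    VanishBelow m z := fun i hi => h i (hi.trans_le hmn)

theorem vanishBelow_zero (n : ℤ) : VanishBelow n (0 : LaurentSeries F) := fun _ _ => rfl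

theorem vanishBelow_order (z : LaurentSeries F) : VanishBelow z.order z :=
  fun _ hi => HahnSeries.coeff_eq_zero_of_lt_order hi

theorem VanishBelow.add {n : ℤ} {z w : LaurentSeries F} (hz : VanishBelow n z)
    (hw : VanishBelow n w) : VanishBelow n (z + w) := fun i hi => by
  rw [HahnSeries.coeff_add, hz i hi, hw i hi, add_zero]

theorem VanishBelow.sum {n : ℤ} {ι : Type*} {s : Finset ι} {z : ι → LaurentSeries F}
    (h : ∀ i ∈ s, VanishBelow n (z i)) : VanishBelow n (∑ i ∈ s, z i) := by
  induction s using Finset.induction_on with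
  | empty => simpa using vanishBelow_zero n
  | insert a s ha ih =>
    rw [Finset.sum_insert ha]
    exact (h a (by simp)).add (ih fun i hi => h i (by simp [hi]))

theorem VanishBelow.mul {m n : ℤ} {z w : LaurentSeries F} (hz : VanishBelow m z)
    (hw : VanishBelow n w) : VanishBelow (m + n) (z * w) := by
  by_cases h : z * w = 0
  · rw [h]; exact vanishBelow_zero _
  · have hz0 : z ≠ 0 := left_ne_zero_of_mul h
    have hw0 : w ≠ 0 := right_ne_zero_of_mul h
    rw [vanishBelow_iff h, HahnSeries.order_mul hz0 hw0]
    exact add_le_add ((vanishBelow_iff hz0).1 hz) ((vanishBelow_iff hw0).1 hw)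

theorem VanishBelow.pow {m : ℤ} {z : LaurentSeries F} (hz : VanishBelow m z) (n : ℕ) :
    VanishBelow (n * m) (z ^ n) := by
  induction n with
  | zero =>
    intro i hi
    rw [pow_zero, HahnSeries.coeff_one, if_neg (by simp at hi; omega)]
  | succ n ih =>
    rw [pow_succ]
    have := ih.mul hz
    push_cast
    rwa [add_mul, one_mul]

theorem order_prod {ι : Type*} (s : Finset ι) (z : ι → LaurentSeries F) (h : ∀ i ∈ s, z i ≠ 0) :
    (∏ i ∈ s, z i).order = ∑ i ∈ s, (z i).order := by
  induction s using Finset.induction_on with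
  | empty => simp
  | insert a s ha ih =>
    have h1 : ∀ i ∈ s, z i ≠ 0 := fun i hi => h i (by simp [hi])
    rw [Finset.prod_insert ha, Finset.sum_insert ha,
      HahnSeries.order_mul (h a (by simp)) (Finset.prod_ne_zero_iff.2 h1), ih h1]

/-- A nonempty sum of nonzero series with distinct orders is nonzero. -/
theorem sum_ne_zero_of_order_injOn {ι : Type*} (s : Finset ι) (z : ι → LaurentSeries F)
    (hs : s.Nonempty) (h : ∀ i ∈ s, z i ≠ 0) (hinj : Set.InjOn (fun i => (z i).order) s) :
    ∑ i ∈ s, z i ≠ 0 := by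
  obtain ⟨a, ha, hmin⟩ := s.exists_min_image (fun i => (z i).order) hs
  intro h0
  have h1 : (∑ i ∈ s, z i).coeff (z a).order = (z a).coeff (z a).order := by
    rw [HahnSeries.coeff_sum, Finset.sum_eq_single a]
    · intro b hb hba
      refine HahnSeries.coeff_eq_zero_of_lt_order (lt_of_le_of_ne (hmin b hb) ?_)
      exact fun he => hba (hinj hb ha he.symm)
    · exact fun h => absurd ha h
  rw [h0, HahnSeries.coeff_zero, eq_comm, HahnSeries.coeff_order_eq_zero] at h1
  exact h a ha h1

/-- The expansion at infinity `F[X] → F((1/X))`. -/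
def polyInf (F : Type*) [Field F] : F[X] →+* LaurentSeries F :=
  eval₂RingHom HahnSeries.C (HahnSeries.single (-1 : ℤ) (1 : F))

theorem polyInf_C (a : F) : polyInf F (C a) = HahnSeries.C a := by simp [polyInf]

theorem polyInf_X : polyInf F X = HahnSeries.single (-1 : ℤ) (1 : F) := by simp [polyInf]

theorem coeff_polyInf (f : F[X]) (i : ℤ) :
    (polyInf F f).coeff (-i) = if 0 ≤ i then f.coeff i.toNat else 0 := by
  induction f using Polynomial.induction_on' with
  | add f g hf hg =>
    rw [map_add, HahnSeries.coeff_add, hf, hg]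
    split_ifs <;> simp
  | monomial n a =>
    rw [← C_mul_X_pow_eq_monomial, map_mul, map_pow, polyInf_C, polyInf_X, HahnSeries.single_pow,
      one_pow, HahnSeries.C_mul_eq_smul, HahnSeries.coeff_smul, HahnSeries.coeff_single, coeff_C_mul,
      coeff_X_pow]
    simp only [nsmul_eq_mul, mul_neg, mul_one, neg_inj]
    by_cases h : i = n
    · subst h; simp
    · rw [if_neg h, smul_zero]
      split_ifs with h1 h2
      · omega
      · simp
      · rfl

theorem order_polyInf {f : F[X]} (hf : f ≠ 0) :
    (polyInf F f).order = -(f.natDegree : ℤ) := by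
  have h1 : (polyInf F f).coeff (-(f.natDegree : ℤ)) ≠ 0 := by
    rw [coeff_polyInf]; simpa using hf
  refine le_antisymm (HahnSeries.order_le_of_coeff_ne_zero h1) ?_
  refine (HahnSeries.le_order_iff_forall ?_).2 fun j hj => ?_
  · rintro h; rw [h] at h1; simp at h1
  · have := coeff_polyInf f (-j)
    rw [neg_neg] at this
    rw [this, if_pos (by omega)]
    exact coeff_eq_zero_of_natDegree_lt (by omega)

theorem polyInf_injective : Function.Injective (polyInf F) := by
  refine (injective_iff_map_eq_zero _).2 fun f hf => ?_
  by_contra h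
  have h1 := coeff_polyInf f f.natDegree
  rw [hf] at h1
  simp at h1
  exact h (leadingCoeff_eq_zero.1 h1.symm)

theorem vanishBelow_polyInf {f : F[X]} {m : ℕ} (hf : f.natDegree ≤ m) :
    VanishBelow (-(m : ℤ)) (polyInf F f) := by
  by_cases h : f = 0
  · rw [h, map_zero]; exact vanishBelow_zero _
  · exact (vanishBelow_order _).mono (by rw [order_polyInf h]; omega)

end LaurentBound

namespace LaurentBound

section Stepanov

variable {F : Type*} [Field F] [Fintype F] {O : Type*} [CommRing O] [IsDomain O]
  [Algebra F[X] O] [Algebra F O] [IsScalarTower F F[X] O]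
  {G : Type*} [Group G] [MulSemiringAction G O] [SMulCommClass G F[X] O]
  (φ : O →+* LaurentSeries F)

theorem smul_algebraMap_poly (σ : G) (f : F[X]) :
    σ • (algebraMap F[X] O f) = algebraMap F[X] O f := by
  rw [Algebra.algebraMap_eq_smul_one, smul_comm, smul_one]

theorem smul_smul_const (σ : G) (a : F) (f : O) : σ • (a • f) = a • σ • f := by
  rw [← IsScalarTower.algebraMap_smul F[X] a f, smul_comm, IsScalarTower.algebraMap_smul]

theorem map_const_smul (hφ : ∀ f, φ (algebraMap F[X] O f) = polyInf F f) (a : F) (f : O) :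
    φ (a • f) = a • φ f := by
  rw [← IsScalarTower.algebraMap_smul F[X] a f, Algebra.smul_def, map_mul, hφ,
    Polynomial.algebraMap_eq, polyInf_C, HahnSeries.C_mul_eq_smul]

theorem exists_norm [Fintype G] [Algebra.IsInvariant F[X] O G] (f : O) :
    ∃ p : F[X], algebraMap F[X] O p = ∏ σ : G, σ • f := by
  refine Algebra.IsInvariant.isInvariant (G := G) _ fun τ => ?_
  rw [Finset.smul_prod']
  simp_rw [smul_smul]
  exact Fintype.prod_equiv (Equiv.mulLeft τ) _ _ fun _ => rfl

theorem exists_norm_of_ne_zero [Fintype G] [Algebra.IsInvariant F[X] O G]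
    (hφ : ∀ f, φ (algebraMap F[X] O f) = polyInf F f)
    (hinj : Function.Injective φ) {f : O} (hf : f ≠ 0) :
    ∃ p : F[X], p ≠ 0 ∧ algebraMap F[X] O p = ∏ σ : G, σ • f ∧
      ∑ σ : G, (φ (σ • f)).order = -(p.natDegree : ℤ) := by
  obtain ⟨p, hp⟩ := exists_norm (F := F) (G := G) f
  have h1 : ∀ σ : G, σ • f ≠ 0 := fun σ h => hf ((smul_eq_zero_iff_eq σ).1 h)
  have h2 : ∏ σ : G, σ • f ≠ 0 := Finset.prod_ne_zero_iff.2 fun σ _ => h1 σ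
  have hp0 : p ≠ 0 := by rintro rfl; rw [map_zero] at hp; exact h2 hp.symm
  refine ⟨p, hp0, hp, ?_⟩
  rw [← order_polyInf hp0, ← hφ, hp, map_prod, order_prod]
  exact fun σ _ => (map_ne_zero_iff φ hinj).2 (h1 σ)

/-- Functions with a pole of order at most `j` at the chosen place at infinity and no pole at
its other conjugates. -/
def poleSpace (G : Type*) [Group G] [MulSemiringAction G O] [SMulCommClass G F[X] O]
    (hφ : ∀ f, φ (algebraMap F[X] O f) = polyInf F f) (j : ℕ) :
    Submodule F O where
  carrier := {f | VanishBelow (-(j : ℤ)) (φ f) ∧ ∀ σ : G, σ ≠ 1 → VanishBelow 0 (φ (σ • f))}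
  zero_mem' := by
    simp only [Set.mem_ofPred_eq, smul_zero, map_zero]
    exact ⟨vanishBelow_zero _, fun _ _ => vanishBelow_zero _⟩
  add_mem' := by
    intro f g hf hg
    simp only [Set.mem_ofPred_eq, smul_add, map_add] at hf hg ⊢
    exact ⟨hf.1.add hg.1, fun σ hσ => (hf.2 σ hσ).add (hg.2 σ hσ)⟩
  smul_mem' := by
    intro a f hf
    simp only [Set.mem_ofPred_eq, smul_smul_const, map_const_smul φ hφ] at hf ⊢
    refine ⟨fun i hi => ?_, fun σ hσ i hi => ?_⟩
    · rw [HahnSeries.coeff_smul, hf.1 i hi, smul_zero]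
    · rw [HahnSeries.coeff_smul, hf.2 σ hσ i hi, smul_zero]

variable [Fintype G] {φ} (hφ : ∀ f, φ (algebraMap F[X] O f) = polyInf F f) (hinj : Function.Injective φ)

include hφ hinj in
theorem order_le_zero_of_mem [Algebra.IsInvariant F[X] O G] {j : ℕ} {f : O}
    (hf : f ∈ poleSpace φ G hφ j) (hf0 : f ≠ 0) : (φ f).order ≤ 0 := by
  obtain ⟨p, hp0, -, hp⟩ := exists_norm_of_ne_zero (G := G) φ hφ hinj hf0
  rw [← Finset.add_sum_erase _ _ (Finset.mem_univ (1 : G)), one_smul] at hp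
  have : 0 ≤ ∑ σ ∈ Finset.univ.erase (1 : G), (φ (σ • f)).order := by
    refine Finset.sum_nonneg fun σ hσ => ?_
    refine (vanishBelow_iff ?_).1 (hf.2 σ (Finset.ne_of_mem_erase hσ))
    exact (map_ne_zero_iff φ hinj).2 fun h => hf0 ((smul_eq_zero_iff_eq σ).1 h)
  omega

include hinj in
theorem order_smul_bounds [Algebra.IsInvariant F[X] O G] {j : ℕ} {f : O}
    (hf : f ∈ poleSpace φ G hφ j) (hf0 : f ≠ 0) (τ : G) :
    -(j : ℤ) ≤ (φ (τ • f)).order ∧ (φ (τ • f)).order ≤ j := by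
  have hne : ∀ σ : G, φ (σ • f) ≠ 0 := fun σ =>
    (map_ne_zero_iff φ hinj).2 fun h => hf0 ((smul_eq_zero_iff_eq σ).1 h)
  have hne1 : φ f ≠ 0 := by simpa using hne 1
  have h1 : -(j : ℤ) ≤ (φ f).order := (vanishBelow_iff hne1).1 hf.1
  by_cases hτ : τ = 1
  · subst hτ
    rw [one_smul]
    have := order_le_zero_of_mem hφ hinj hf hf0
    omega
  · have h2 : 0 ≤ (φ (τ • f)).order := (vanishBelow_iff (hne τ)).1 (hf.2 τ hτ)
    refine ⟨by omega, ?_⟩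
    obtain ⟨p, hp0, -, hp⟩ := exists_norm_of_ne_zero (G := G) φ hφ hinj hf0
    have hm : τ ∈ Finset.univ.erase (1 : G) := by simp [hτ]
    rw [← Finset.add_sum_erase _ _ (Finset.mem_univ (1 : G)), one_smul,
      ← Finset.add_sum_erase _ _ hm] at hp
    have : 0 ≤ ∑ σ ∈ (Finset.univ.erase (1 : G)).erase τ, (φ (σ • f)).order := by
      refine Finset.sum_nonneg fun σ hσ => ?_
      exact (vanishBelow_iff (hne σ)).1
        (hf.2 σ (Finset.ne_of_mem_erase (Finset.mem_of_mem_erase hσ)))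
    omega

/-- Restriction of a series to finitely many coefficients, as a linear map on `O`. -/
def coeffMap (hφ : ∀ f, φ (algebraMap F[X] O f) = polyInf F f) (s : Finset ℤ) :
    O →ₗ[F] (s → F) where
  toFun f i := (φ f).coeff i
  map_add' f g := by ext; simp
  map_smul' a f := by ext; simp [map_const_smul φ hφ]

include hinj in
theorem coeffMap_injective [Algebra.IsInvariant F[X] O G] (j : ℕ) :
    Function.Injective ((coeffMap hφ (Finset.Icc (-(j : ℤ)) 0)).domRestrict
      (poleSpace φ G hφ j)) := by
  refine (injective_iff_map_eq_zero _).2 fun f hf => ?_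
  by_contra h
  have hf0 : (f : O) ≠ 0 := fun h' => h (Subtype.ext h')
  have hne : φ f ≠ 0 := (map_ne_zero_iff φ hinj).2 hf0
  have h1 := order_smul_bounds hφ hinj f.2 hf0 (1 : G)
  have h2 := order_le_zero_of_mem hφ hinj f.2 hf0
  rw [one_smul] at h1
  have h3 := congrFun hf ⟨(φ f).order, Finset.mem_Icc.2 ⟨h1.1, h2⟩⟩
  exact hne (HahnSeries.coeff_order_eq_zero.1 h3)

include hinj in
theorem finite_poleSpace [Algebra.IsInvariant F[X] O G] (j : ℕ) :
    Module.Finite F (poleSpace φ G hφ j) :=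
  Module.Finite.of_injective _ (coeffMap_injective hφ hinj j)

include hinj in
theorem finrank_poleSpace_le [Algebra.IsInvariant F[X] O G] (j : ℕ) :
    Module.finrank F (poleSpace φ G hφ j) ≤ j + 1 := by
  refine (LinearMap.finrank_le_finrank_of_injective (coeffMap_injective hφ hinj j)).trans ?_
  rw [Module.finrank_fintype_fun_eq_card]
  simp
  omega

include hinj in
/-- Elements realizing at least `finrank` many distinct pole orders. -/
theorem exists_orders [Algebra.IsInvariant F[X] O G] (j : ℕ) :
    ∃ (S : Finset ℤ) (f : ℤ → O), Module.finrank F (poleSpace φ G hφ j) ≤ S.card ∧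
      ∀ s ∈ S, f s ∈ poleSpace φ G hφ j ∧ f s ≠ 0 ∧ (φ (f s)).order = s := by
  set S : Finset ℤ := (Finset.Icc (-(j : ℤ)) 0).filter
    fun s => ∃ f ∈ poleSpace φ G hφ j, f ≠ 0 ∧ (φ f).order = s with hS
  have h : ∀ s : ℤ, ∃ f : O, s ∈ S → f ∈ poleSpace φ G hφ j ∧ f ≠ 0 ∧ (φ f).order = s := by
    intro s
    by_cases hs : s ∈ S
    · obtain ⟨f, hf⟩ := (Finset.mem_filter.1 hs).2
      exact ⟨f, fun _ => hf⟩
    · exact ⟨0, fun h => absurd h hs⟩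
  choose f hf using h
  refine ⟨S, f, ?_, hf⟩
  have hi : Function.Injective ((coeffMap hφ S).domRestrict (poleSpace φ G hφ j)) := by
    refine (injective_iff_map_eq_zero _).2 fun f hf => ?_
    by_contra h
    have hf0 : (f : O) ≠ 0 := fun h' => h (Subtype.ext h')
    have hne : φ f ≠ 0 := (map_ne_zero_iff φ hinj).2 hf0
    have h1 := order_smul_bounds hφ hinj f.2 hf0 (1 : G)
    have h2 := order_le_zero_of_mem hφ hinj f.2 hf0
    rw [one_smul] at h1
    have h3 := congrFun hf ⟨(φ f).order, Finset.mem_filter.2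
      ⟨Finset.mem_Icc.2 ⟨h1.1, h2⟩, f, f.2, hf0, rfl⟩⟩
    exact hne (HahnSeries.coeff_order_eq_zero.1 h3)
  refine (LinearMap.finrank_le_finrank_of_injective hi).trans ?_
  rw [Module.finrank_fintype_fun_eq_card]
  simp

end Stepanov

end LaurentBound

namespace LaurentBound

section Stepanov

variable {F : Type*} [Field F] [Fintype F] {O : Type*} [CommRing O] [IsDomain O]
  [Algebra F[X] O] [Algebra F O] [IsScalarTower F F[X] O]
  {G : Type*} [Group G] [MulSemiringAction G O] [SMulCommClass G F[X] O]
  [Fintype G] {φ : O →+* LaurentSeries F}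
  (hφ : ∀ f, φ (algebraMap F[X] O f) = polyInf F f) (hinj : Function.Injective φ)

/-- Combinations of a basis with polynomial coefficients of bounded degree. -/
def boundedCombination (w : Module.Basis G F[X] O) (m : ℕ) : (G → degreeLT F m) →ₗ[F] O where
  toFun p := ∑ e, (p e : F[X]) • w e
  map_add' p r := by simp [add_smul, Finset.sum_add_distrib]
  map_smul' a p := by simp [Finset.smul_sum]

theorem boundedCombination_injective (w : Module.Basis G F[X] O) (m : ℕ) :
    Function.Injective (boundedCombination w m) := by
  refine (injective_iff_map_eq_zero _).2 fun p hp => ?_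
  have := Fintype.linearIndependent_iff.1 w.linearIndependent (fun e => (p e : F[X])) hp
  ext1 e
  exact Subtype.ext (this e)

/-- The action of a group element as an `F`-linear map. -/
def smulLinear (F : Type*) [Field F] [Fintype F] {O : Type*} [CommRing O] [IsDomain O]
    [Algebra F[X] O] [Algebra F O] [IsScalarTower F F[X] O]
    {G : Type*} [Group G] [MulSemiringAction G O] [SMulCommClass G F[X] O] (σ : G) :
    O →ₗ[F] O where
  toFun f := σ • f
  map_add' _ _ := smul_add _ _ _
  map_smul' a f := smul_smul_const σ a f

include hφ in
theorem exists_vanishBelow_basis (w : Module.Basis G F[X] O) :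
    ∃ c : ℕ, ∀ σ e : G, VanishBelow (-(c : ℤ)) (φ (σ • w e)) := by
  refine ⟨∑ σ : G, ∑ e : G, (φ (σ • w e)).order.natAbs, fun σ e => ?_⟩
  refine (vanishBelow_order _).mono ?_
  have h1 : (φ (σ • w e)).order.natAbs ≤ ∑ e : G, (φ (σ • w e)).order.natAbs :=
    Finset.single_le_sum (f := fun e : G => (φ (σ • w e)).order.natAbs)
      (fun _ _ => Nat.zero_le _) (Finset.mem_univ e)
  have h2 := Finset.single_le_sum (f := fun σ : G => ∑ e : G, (φ (σ • w e)).order.natAbs)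
      (fun _ _ => Nat.zero_le _) (Finset.mem_univ σ)
  omega

include hφ in
theorem vanishBelow_boundedCombination (w : Module.Basis G F[X] O) {c m : ℕ}
    (hc : ∀ σ e : G, VanishBelow (-(c : ℤ)) (φ (σ • w e))) (p : G → degreeLT F m) (σ : G) :
    VanishBelow (-((m + c : ℕ) : ℤ)) (φ (σ • boundedCombination w m p)) := by
  have h : φ (σ • boundedCombination w m p)
      = ∑ e, polyInf F (p e : F[X]) * φ (σ • w e) := by
    simp only [boundedCombination, LinearMap.coe_mk, AddHom.coe_mk, Finset.smul_sum, map_sum]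
    refine Finset.sum_congr rfl fun e _ => ?_
    rw [smul_comm, Algebra.smul_def, map_mul, hφ]
  rw [h]
  refine VanishBelow.sum fun e _ => ?_
  have h1 : ((p e : F[X])).natDegree ≤ m := by
    have := mem_degreeLT.1 (p e).2
    exact natDegree_le_iff_degree_le.2 this.le
  have := (vanishBelow_polyInf h1).mul (hc σ e)
  refine this.mono ?_
  push_cast
  omega

include hinj in
theorem exists_le_finrank_poleSpace [Algebra.IsInvariant F[X] O G] (w : Module.Basis G F[X] O) :
    ∃ c : ℕ, ∀ j, j ≤ Module.finrank F (poleSpace φ G hφ j) + c := by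
  obtain ⟨c, hc⟩ := exists_vanishBelow_basis hφ w
  refine ⟨Fintype.card G * c, fun j => ?_⟩
  have hg : 1 ≤ Fintype.card G := Fintype.card_pos
  by_cases hj : j < c
  · nlinarith
  obtain ⟨m, rfl⟩ := Nat.exists_eq_add_of_le (not_lt.1 hj)
  set Λ : (G → degreeLT F m) →ₗ[F] ({σ : G // σ ≠ 1} →
      (Finset.Icc (-((c + m : ℕ) : ℤ)) (-1)) → F) :=
    LinearMap.pi fun σ => (coeffMap hφ _) ∘ₗ (smulLinear F σ.1) ∘ₗ boundedCombination w m with hΛ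
  have hmem : ∀ p : LinearMap.ker Λ, boundedCombination w m p ∈ poleSpace φ G hφ (c + m) := by
    intro p
    refine ⟨?_, fun σ hσ i hi => ?_⟩
    · have := vanishBelow_boundedCombination hφ w hc p.1 1
      rwa [one_smul, add_comm m c] at this
    · by_cases h : i < -((c + m : ℕ) : ℤ)
      · have := vanishBelow_boundedCombination hφ w hc p.1 σ
        rw [add_comm m c] at this
        exact this i h
      · have h1 := congrFun (congrFun p.2 ⟨σ, hσ⟩) ⟨i, Finset.mem_Icc.2 ⟨by omega, by omega⟩⟩
        exact h1
  have := finite_poleSpace (G := G) hφ hinj (c + m)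
  set Θ : LinearMap.ker Λ →ₗ[F] poleSpace φ G hφ (c + m) :=
    LinearMap.codRestrict _ ((boundedCombination w m).domRestrict (LinearMap.ker Λ)) hmem with hΘ
  have hΘi : Function.Injective Θ := by
    intro p r h
    refine Subtype.ext (boundedCombination_injective w m ?_)
    exact congrArg Subtype.val h
  have h1 := LinearMap.finrank_le_finrank_of_injective hΘi
  have : Module.Finite F (degreeLT F m) :=
    Module.Finite.equiv (degreeLTEquiv F m).symm
  have h2 := LinearMap.finrank_range_add_finrank_ker Λ
  have h3 := Submodule.finrank_le (LinearMap.range Λ)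
  have h4 : Module.finrank F (degreeLT F m) = m := by
    rw [LinearEquiv.finrank_eq (degreeLTEquiv F m)]; simp
  have h5 : Fintype.card {σ : G // σ ≠ 1} = Fintype.card G - 1 := by
    rw [Fintype.card_subtype_compl]; simp
  rw [Module.finrank_pi_fintype] at h2 h3
  simp only [h4, Finset.sum_const, Finset.card_univ, smul_eq_mul, Module.finrank_fintype_fun_eq_card,
    h5, Fintype.card_coe, Int.card_Icc] at h2 h3
  have h6 : (-1 + 1 - -((c + m : ℕ) : ℤ)).toNat = c + m := by omega
  rw [h6] at h3
  obtain ⟨g, hg'⟩ := Nat.exists_eq_add_of_le hg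
  rw [hg'] at h2 h3 ⊢
  simp only [Nat.add_sub_cancel_left] at h3
  nlinarith

end Stepanov

end LaurentBound

namespace LaurentBound

section Stepanov

variable {F : Type*} [Field F] [Fintype F] {O : Type*} [CommRing O] [IsDomain O]
  [Algebra F[X] O] [Algebra F O] [IsScalarTower F F[X] O]
  {G : Type*} [Group G] [MulSemiringAction G O] [SMulCommClass G F[X] O]
  [Fintype G] {φ : O →+* LaurentSeries F}
  (hφ : ∀ f, φ (algebraMap F[X] O f) = polyInf F f) (hinj : Function.Injective φ)

theorem frobenius_pow_apply (F : Type*) [Field F] [Fintype F] {R : Type*} [CommRing R] [Algebra F R]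
    (n : ℕ) (x : R) :
    ((FiniteField.frobeniusAlgHom F R) ^ n) x = x ^ (Fintype.card F ^ n) := by
  induction n with
  | zero => simp
  | succ n ih =>
    rw [pow_succ', AlgHom.mul_apply, ih, FiniteField.frobeniusAlgHom_apply, ← pow_mul, pow_succ]

/-- The map `(s_p) ↦ ∑ s_p ^ Q f_p` whose kernel provides auxiliary functions. -/
def auxMap (n : ℕ) (S : Finset ℤ) (f : ℤ → O) (W : Submodule F O) : (S → W) →ₗ[F] O where
  toFun s := ∑ p : S, ((FiniteField.frobeniusAlgHom F O) ^ n) (s p : O) * f p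
  map_add' s t := by simp only [Pi.add_apply, Submodule.coe_add, map_add, add_mul,
    Finset.sum_add_distrib]
  map_smul' a s := by
    simp only [Pi.smul_apply, Submodule.coe_smul, map_smul, smul_mul_assoc, Finset.smul_sum,
      RingHom.id_apply]

include hφ hinj in
theorem exists_auxiliary [Algebra.IsInvariant F[X] O G] (w : Module.Basis G F[X] O)
    (Ω : Type*) [Field Ω] [Algebra F Ω] :
    ∃ c n₀ : ℕ, ∀ n ≥ n₀, ∀ τ : G, ∃ h : O, h ≠ 0 ∧
      (∀ x : O →+* Ω, (∀ f, x f ^ (Fintype.card F ^ (2 * n)) = x (τ • f)) → x h = 0) ∧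
      -((Fintype.card F ^ (2 * n) + c * Fintype.card F ^ n : ℕ) : ℤ)
        ≤ ∑ σ : G, (φ (σ • h)).order := by
  obtain ⟨c, hc⟩ := exists_le_finrank_poleSpace (G := G) hφ hinj w
  set g := Fintype.card G with hg
  refine ⟨c + 4 * (c + 1) + g, 4 * (c + 1) + 6, fun n hn τ => ?_⟩
  set q := Fintype.card F with hq
  have hq2 : 2 ≤ q := Fintype.one_lt_card
  set Q := q ^ n with hQ
  have hQn : n < Q := (Nat.lt_two_pow_self).trans_le (Nat.pow_le_pow_left hq2 n)
  set m := (Q - 1) / 2 with hm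
  set l := Q + c + 4 * (c + 1) with hl
  obtain ⟨S, f, hS, hf⟩ := exists_orders (G := G) hφ hinj l
  have hSl := hc l
  have hmm := hc m
  have hmem : ∀ s, auxMap n S f (poleSpace φ G hφ m) s ∈ poleSpace φ G hφ (m * Q + l) := by
    intro s
    refine ⟨?_, fun σ hσ => ?_⟩
    · simp only [auxMap, LinearMap.coe_mk, AddHom.coe_mk, map_sum, map_mul, frobenius_pow_apply,
        map_pow]
      refine VanishBelow.sum fun p _ => ?_
      refine (((s p).2.1.pow _).mul (hf p p.2).1.1).mono ?_
      push_cast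
      rw [← hq]
      have : (Q : ℤ) = (q : ℤ) ^ n := by rw [hQ]; push_cast; rfl
      rw [← this]
      linarith [mul_comm (m : ℤ) Q]
    · simp only [auxMap, LinearMap.coe_mk, AddHom.coe_mk, map_sum, map_mul, frobenius_pow_apply,
        map_pow, Finset.smul_sum, smul_mul', smul_pow']
      refine VanishBelow.sum fun p _ => ?_
      refine ((((s p).2.2 σ hσ).pow _).mul ((hf p p.2).1.2 σ hσ)).mono ?_
      simp
  have := finite_poleSpace (G := G) hφ hinj (m * Q + l)
  have := finite_poleSpace (G := G) hφ hinj m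
  have hker := LinearMap.ker_ne_bot_of_finrank_lt
    (f := LinearMap.codRestrict _ (auxMap n S f (poleSpace φ G hφ m)) hmem) (by
      refine lt_of_le_of_lt (finrank_poleSpace_le hφ hinj _) ?_
      rw [Module.finrank_pi_fintype]
      simp only [Finset.sum_const, Finset.card_univ, Fintype.card_coe, smul_eq_mul]
      have h1 : Q + 4 * (c + 1) ≤ S.card := by omega
      refine lt_of_lt_of_le ?_ (Nat.mul_le_mul_right _ h1)
      have h2 : Q ≤ 2 * m + 2 := by omega
      zify at *
      have h3 : (0 : ℤ) ≤ c := by positivity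
      nlinarith)
  obtain ⟨s, hsker, hs0⟩ := Submodule.exists_mem_ne_zero_of_ne_bot hker
  have hs : ∑ p : S, (s p : O) ^ Q * f p = 0 := by
    have h1 := congrArg Subtype.val (LinearMap.mem_ker.1 hsker)
    simp only [LinearMap.codRestrict_apply, auxMap, LinearMap.coe_mk, AddHom.coe_mk,
      frobenius_pow_apply] at h1
    exact h1
  have hb : ∀ p : S, (s p : O) ≠ 0 → ∀ σ : G, -(m : ℤ) ≤ (φ (σ • (s p : O))).order ∧
    (φ (σ • (s p : O))).order ≤ m := fun p hp σ => order_smul_bounds hφ hinj (s p).2 hp σ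
  have hb' : ∀ p : S, ∀ σ : G, VanishBelow (-(m : ℤ)) (φ (σ • (s p : O))) := by
    intro p σ
    by_cases hp : (s p : O) = 0
    · rw [hp, smul_zero, map_zero]; exact vanishBelow_zero _
    · exact (vanishBelow_order _).mono (hb p hp σ).1
  set h : O := ∑ p : S, (τ • (s p : O)) * f p ^ Q with hh
  have hφh : φ h = ∑ p : S, φ (τ • (s p : O)) * φ (f p) ^ Q := by simp [hh]
  have hh0 : h ≠ 0 := by
    intro h0
    rw [h0, map_zero] at hφh
    have hsub : ∑ p : S, φ (τ • (s p : O)) * φ (f p) ^ Q =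
        ∑ p ∈ Finset.univ.filter (fun p : S => (s p : O) ≠ 0), φ (τ • (s p : O)) * φ (f p) ^ Q := by
      rw [Finset.sum_filter]
      refine Finset.sum_congr rfl fun p _ => ?_
      split_ifs with h1
      · rfl
      · rw [not_not.1 h1]; simp
    rw [hsub] at hφh
    have hz1 : ∀ p : S, (s p : O) ≠ 0 → φ (τ • (s p : O)) ≠ 0 := fun p hp =>
      (map_ne_zero_iff φ hinj).2 fun h => hp ((smul_eq_zero_iff_eq τ).1 h)
    have hz2 : ∀ p : S, φ (f p) ^ Q ≠ 0 := fun p =>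
      pow_ne_zero _ ((map_ne_zero_iff φ hinj).2 (hf p p.2).2.1)
    refine sum_ne_zero_of_order_injOn _ _ ?_ ?_ ?_ hφh.symm
    · by_contra hne
      refine hs0 (funext fun p => Subtype.ext ?_)
      by_contra h1
      exact hne ⟨p, by simpa using h1⟩
    · intro p hp
      exact mul_ne_zero (hz1 p (Finset.mem_filter.1 hp).2) (hz2 p)
    · intro p hp r hr hpr
      have hp0 := (Finset.mem_filter.1 hp).2
      have hr0 := (Finset.mem_filter.1 hr).2
      simp only at hpr
      rw [HahnSeries.order_mul (hz1 p hp0) (hz2 p), HahnSeries.order_mul (hz1 r hr0) (hz2 r),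
        HahnSeries.order_pow, HahnSeries.order_pow, (hf p p.2).2.2, (hf r r.2).2.2] at hpr
      have b1 := hb p hp0 τ
      have b2 := hb r hr0 τ
      simp only [nsmul_eq_mul] at hpr
      have b3 : 2 * (m : ℤ) < Q := by omega
      refine Subtype.ext ?_
      by_contra hne
      rcases lt_or_gt_of_ne hne with h1 | h1
      · have : (p : ℤ) + 1 ≤ r := h1
        nlinarith
      · have : (r : ℤ) + 1 ≤ p := h1
        nlinarith
  refine ⟨h, hh0, fun x hx => ?_, ?_⟩
  · have h1 := congrArg (fun z => x (((FiniteField.frobeniusAlgHom F O) ^ n) z)) hs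
    simp only [map_sum, map_mul, map_zero, frobenius_pow_apply, map_pow] at h1
    rw [hh, map_sum, ← h1]
    refine Finset.sum_congr rfl fun p _ => ?_
    rw [map_mul, map_pow, ← hx, ← pow_mul, ← hq, hQ, ← pow_add, two_mul]
  · have hne : ∀ σ : G, φ (σ • h) ≠ 0 := fun σ =>
      (map_ne_zero_iff φ hinj).2 fun h => hh0 ((smul_eq_zero_iff_eq σ).1 h)
    have e : ∀ σ : G, φ (σ • h) = ∑ p : S, φ ((σ * τ) • (s p : O)) * φ (σ • f p) ^ Q := by
      intro σ
      simp only [hh, Finset.smul_sum, smul_mul', smul_pow', map_sum, map_mul, map_pow, mul_smul]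
    have hmQ : m ≤ Q := by omega
    have l1 : -((Q * l + m : ℕ) : ℤ) ≤ (φ ((1 : G) • h)).order := by
      refine (vanishBelow_iff (hne 1)).1 ?_
      rw [e]
      refine VanishBelow.sum fun p _ => ?_
      rw [one_smul]
      refine ((hb' p _).mul ((hf p p.2).1.1.pow Q)).mono ?_
      push_cast
      linarith
    have l2 : ∀ σ ∈ Finset.univ.erase (1 : G), -(Q : ℤ) ≤ (φ (σ • h)).order := by
      intro σ hσ
      refine (vanishBelow_iff (hne σ)).1 ?_
      rw [e]
      refine VanishBelow.sum fun p _ => ?_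
      refine ((hb' p _).mul (((hf p p.2).1.2 σ (Finset.ne_of_mem_erase hσ)).pow Q)).mono ?_
      simpa using hmQ
    rw [← Finset.add_sum_erase _ _ (Finset.mem_univ (1 : G))]
    have l3 := Finset.sum_le_sum l2
    rw [Finset.sum_const, Finset.card_erase_of_mem (Finset.mem_univ _), Finset.card_univ, ← hg] at l3
    refine le_trans ?_ (add_le_add l1 l3)
    have hg1 : 1 ≤ g := Fintype.card_pos
    have hQ2 : q ^ (2 * n) = Q * Q := by rw [hQ, ← pow_add, two_mul]
    rw [hQ2]
    obtain ⟨g', hg'⟩ := Nat.exists_eq_add_of_le hg1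
    rw [hg', hl, Nat.add_sub_cancel_left]
    push_cast
    simp only [nsmul_eq_mul]
    zify at hmQ
    nlinarith

end Stepanov

end LaurentBound

namespace LaurentBound

section Stepanov

variable {F : Type*} [Field F] [Fintype F] {O : Type*} [CommRing O] [IsDomain O]
  [Algebra F[X] O] [Algebra F O] [IsScalarTower F F[X] O]
  {G : Type*} [Group G] [MulSemiringAction G O] [SMulCommClass G F[X] O]
  [Fintype G] {φ : O →+* LaurentSeries F}
  (hφ : ∀ f, φ (algebraMap F[X] O f) = polyInf F f) (hinj : Function.Injective φ)

/-- If an element of `O` vanishes at all conjugates of the points above each `y ∈ B`, its norm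
is divisible by a power of a polynomial vanishing on `B`. -/
theorem card_mul_card_le_natDegree [Algebra.IsInvariant F[X] O G] (w : Module.Basis G F[X] O)
    {Ω : Type*} [Field Ω] [Algebra F Ω] {h : O} {p : F[X]} (hp0 : p ≠ 0)
    (hp : algebraMap F[X] O p = ∏ σ : G, σ • h)
    (hOinj : Function.Injective (algebraMap F[X] O))
    (B : Finset Ω) (hB : ∀ y ∈ B, ∃ x : O →+* Ω, (∀ f, x (algebraMap F[X] O f) = aeval y f) ∧
      x (Matrix.of fun σ e : G => σ • w e).det ≠ 0 ∧ ∀ σ : G, x (σ • h) = 0) :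
    Fintype.card G * B.card ≤ p.natDegree := by
  set I : Ideal F[X] := Ideal.span (Set.range fun e => w.repr h e) with hI
  set P := Submodule.IsPrincipal.generator I with hP
  have hdvd : ∀ e, P ∣ w.repr h e := fun e =>
    (Submodule.IsPrincipal.mem_iff_generator_dvd I).1 (Ideal.subset_span ⟨e, rfl⟩)
  choose d hd using hdvd
  have hh : h = algebraMap F[X] O P * ∑ e, d e • w e := by
    rw [← Algebra.smul_def, Finset.smul_sum]
    conv_lhs => rw [← w.sum_repr h]
    exact Finset.sum_congr rfl fun e _ => by rw [hd, mul_smul]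
  have hpP : P ^ Fintype.card G ∣ p := by
    obtain ⟨r, hr⟩ := exists_norm (F := F) (G := G) (∑ e, d e • w e)
    refine ⟨r, hOinj ?_⟩
    rw [hp, map_mul, hr, hh]
    simp only [smul_mul', smul_algebraMap_poly, Finset.prod_mul_distrib, Finset.prod_const,
      Finset.card_univ, map_pow]
  have hP0 : P ≠ 0 := by
    intro h0
    rw [h0, zero_pow Fintype.card_ne_zero] at hpP
    exact hp0 (zero_dvd_iff.1 hpP)
  have hroot : ∀ y ∈ B, aeval y P = 0 := by
    intro y hy
    obtain ⟨x, hx, hdet, hvan⟩ := hB y hy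
    have hc : ∀ e, aeval y (w.repr h e) = 0 := by
      have h1 : ((Matrix.of fun σ e : G => x (σ • w e)).mulVec
          fun e => aeval y (w.repr h e)) = 0 := by
        ext σ
        rw [Matrix.mulVec, dotProduct]
        have h2 := hvan σ
        conv at h2 => rw [← w.sum_repr h]
        rw [Finset.smul_sum, map_sum] at h2
        rw [Pi.zero_apply, ← h2]
        refine Finset.sum_congr rfl fun e _ => ?_
        rw [smul_comm, Algebra.smul_def, map_mul, hx, mul_comm]
        rfl
      have h3 : (Matrix.of fun σ e : G => x (σ • w e)).det ≠ 0 := by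
        rw [RingHom.map_det] at hdet
        exact hdet
      exact fun e => congrFun (Matrix.eq_zero_of_mulVec_eq_zero h3 h1) e
    have hle : I ≤ RingHom.ker (aeval y : F[X] →ₐ[F] Ω) := by
      rw [hI, Ideal.span_le]
      rintro _ ⟨e, rfl⟩
      exact hc e
    exact hle (Submodule.IsPrincipal.generator_mem I)
  have hcard : B.card ≤ P.natDegree := by
    have hm : P.map (algebraMap F Ω) ≠ 0 := (Polynomial.map_ne_zero_iff
      (algebraMap F Ω).injective).2 hP0
    have h1 : B.val ≤ (P.map (algebraMap F Ω)).roots := by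
      refine (Multiset.le_iff_subset B.nodup).2 fun y hy => ?_
      rw [mem_roots hm, IsRoot, eval_map_algebraMap]
      exact hroot y hy
    have h2 := (Multiset.card_le_card h1).trans (card_roots' _)
    rwa [natDegree_map] at h2
  calc Fintype.card G * B.card ≤ Fintype.card G * P.natDegree := Nat.mul_le_mul_left _ hcard
    _ = (P ^ Fintype.card G).natDegree := (natDegree_pow _ _).symm
    _ ≤ p.natDegree := natDegree_le_of_dvd hpP hp0

include hφ hinj in
/-- The Bombieri–Stepanov bound for the points with a prescribed Frobenius element. -/
theorem stepanov_bound [Algebra.IsInvariant F[X] O G] (w : Module.Basis G F[X] O)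
    (hdet : (Matrix.of fun σ e : G => σ • w e).det ≠ 0) (hcomm : ∀ a b : G, a * b = b * a)
    (Ω : Type*) [Field Ω] [Algebra F Ω] :
    ∃ c n₀ : ℕ, ∃ Δ : F[X], Δ ≠ 0 ∧
      (∀ (y : Ω) (x : O →+* Ω), (∀ f, x (algebraMap F[X] O f) = aeval y f) → aeval y Δ ≠ 0 →
        x (Matrix.of fun σ e : G => σ • w e).det ≠ 0) ∧
      ∀ n ≥ n₀, ∀ τ : G, ∀ B : Finset Ω,
      (∀ y ∈ B, aeval y Δ ≠ 0 ∧ ∃ x : O →+* Ω, (∀ f, x (algebraMap F[X] O f) = aeval y f) ∧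
        ∀ f, x f ^ (Fintype.card F ^ (2 * n)) = x (τ • f)) →
      Fintype.card G * B.card ≤ Fintype.card F ^ (2 * n) + c * Fintype.card F ^ n := by
  have hOinj : Function.Injective (algebraMap F[X] O) := by
    intro a b hab
    apply polyInf_injective
    rw [← hφ, ← hφ, hab]
  obtain ⟨c, n₀, H⟩ := exists_auxiliary (G := G) hφ hinj w Ω
  obtain ⟨Δ, hΔ0, hΔ, -⟩ := exists_norm_of_ne_zero (G := G) φ hφ hinj hdet
  have hΔx : ∀ (y : Ω) (x : O →+* Ω), (∀ f, x (algebraMap F[X] O f) = aeval y f) →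
      aeval y Δ ≠ 0 → x (Matrix.of fun σ e : G => σ • w e).det ≠ 0 := by
    intro y x hx hy h0
    rw [← hx, hΔ, map_prod] at hy
    refine hy (Finset.prod_eq_zero (Finset.mem_univ (1 : G)) ?_)
    rw [one_smul, h0]
  refine ⟨c, n₀, Δ, hΔ0, hΔx, fun n hn τ B hB => ?_⟩
  obtain ⟨h, hh0, hvan, hord⟩ := H n hn τ
  obtain ⟨p, hp0, hp, hdeg⟩ := exists_norm_of_ne_zero (G := G) φ hφ hinj hh0
  have key := card_mul_card_le_natDegree w hp0 hp hOinj B fun y hy => by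
    obtain ⟨hy1, x, hx, hxτ⟩ := hB y hy
    refine ⟨x, hx, hΔx y x hx hy1, fun σ => ?_⟩
    refine hvan (x.comp (MulSemiringAction.toRingHom G O σ)) fun f => ?_
    change x (σ • f) ^ _ = x (σ • τ • f)
    rw [hxτ, smul_smul, smul_smul, hcomm]
  rw [hdeg] at hord
  omega

end Stepanov

end LaurentBound

namespace LaurentBound

/-- A ring homomorphism to an algebraically closed field extends along an integral extension. -/
theorem exists_extension {R O Ω : Type*} [CommRing R] [CommRing O] [Algebra R O]
    [Algebra.IsIntegral R O] (hinj : Function.Injective (algebraMap R O)) [Field Ω] [IsAlgClosed Ω]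
    (ev : R →+* Ω) : ∃ x : O →+* Ω, ∀ f, x (algebraMap R O f) = ev f := by
  have hP : (RingHom.ker ev).IsPrime := RingHom.ker_isPrime ev
  obtain ⟨Q, -, hQ, hQP⟩ := Ideal.exists_ideal_over_prime_of_isIntegral (RingHom.ker ev)
    (⊥ : Ideal O) (by
      change RingHom.ker (algebraMap R O) ≤ _
      rw [(RingHom.injective_iff_ker_eq_bot _).1 hinj]; exact bot_le)
  have : Q.LiesOver (RingHom.ker ev) := ⟨hQP.symm⟩
  let _ : Algebra (R ⧸ RingHom.ker ev) Ω := (RingHom.kerLift ev).toAlgebra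
  have : FaithfulSMul (R ⧸ RingHom.ker ev) Ω :=
    (faithfulSMul_iff_algebraMap_injective _ _).2 (RingHom.kerLift_injective ev)
  have : FaithfulSMul (R ⧸ RingHom.ker ev) (O ⧸ Q) := inferInstance
  have : Module.IsTorsionFree (R ⧸ RingHom.ker ev) (O ⧸ Q) :=
     (Module.IsTorsionFree.trans_faithfulSMul (R ⧸ RingHom.ker ev) (O ⧸ Q) (O ⧸ Q))
  have : Algebra.IsAlgebraic (R ⧸ RingHom.ker ev) (O ⧸ Q) := inferInstance
  let y : (O ⧸ Q) →ₐ[R ⧸ RingHom.ker ev] Ω := IsAlgClosed.lift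
  refine ⟨(y : (O ⧸ Q) →+* Ω).comp (Ideal.Quotient.mk Q), fun f => ?_⟩
  exact y.commutes (Ideal.Quotient.mk _ f)

section Stepanov

variable {F : Type*} [Field F] [Fintype F] {O : Type*} [CommRing O] [IsDomain O]
  [Algebra F[X] O]
  {G : Type*} [Group G] [MulSemiringAction G O] [SMulCommClass G F[X] O]
  [Fintype G]

/-- Every point above a rational value has a Frobenius element. -/
theorem exists_frobenius (w : Module.Basis G F[X] O) {Ω : Type*} [Field Ω] [Algebra F Ω]
    (n : ℕ) {y : Ω} (hy : y ^ (Fintype.card F ^ n) = y) (x : O →+* Ω)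
    (hx : ∀ f, x (algebraMap F[X] O f) = aeval y f)
    (hdet : x (Matrix.of fun σ e : G => σ • w e).det ≠ 0) :
    ∃ τ : G, ∀ f, x f ^ (Fintype.card F ^ n) = x (τ • f) := by
  set Q := Fintype.card F ^ n
  let fr : Ω →+* Ω := ((FiniteField.frobeniusAlgHom F Ω) ^ n : Ω →ₐ[F] Ω)
  have hfr : ∀ z, fr z = z ^ Q := fun z => frobenius_pow_apply F n z
  let x' : O →+* Ω := fr.comp x
  have hx' : ∀ f, x' (algebraMap F[X] O f) = aeval y f := by
    intro f
    change fr (x _) = _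
    rw [hx]
    change ((FiniteField.frobeniusAlgHom F Ω) ^ n) (aeval y f) = _
    rw [← aeval_algHom_apply, frobenius_pow_apply, hy]
  by_contra hcon
  push Not at hcon
  rw [RingHom.map_det] at hdet
  set M : Matrix G G Ω := x.mapMatrix (Matrix.of fun σ e : G => σ • w e) with hM
  have hMu : IsUnit M.det := IsUnit.mk0 _ hdet
  obtain ⟨a, ha⟩ : ∃ a : G → Ω, Matrix.vecMul a M = fun e => x' (w e) :=
    ⟨Matrix.vecMul (fun e => x' (w e)) M⁻¹, by
      rw [Matrix.vecMul_vecMul, Matrix.nonsing_inv_mul _ hMu, Matrix.vecMul_one]⟩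
  have hx'a : ∀ f, x' f = ∑ σ : G, a σ * x (σ • f) := by
    intro f
    have hsm : ∀ (σ : G) (p : F[X]), σ • algebraMap F[X] O p = algebraMap F[X] O p :=
      fun σ p => by rw [Algebra.algebraMap_eq_smul_one, smul_comm, smul_one]
    have hrep := w.sum_repr f
    rw [← hrep]
    simp only [map_sum, Finset.smul_sum, Algebra.smul_def, smul_mul', hsm, map_mul, hx, hx']
    simp only [Finset.mul_sum]
    rw [Finset.sum_comm]
    refine Finset.sum_congr rfl fun e _ => ?_
    have h1 := congrFun ha e
    simp only [← h1, Matrix.vecMul, dotProduct, Finset.mul_sum]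
    refine Finset.sum_congr rfl fun σ _ => ?_
    change aeval y (w.repr f e) * (a σ * x (σ • w e)) = _
    ring
  have hli := linearIndependent_monoidHom O Ω
  let ψ : G → (O →* Ω) := fun σ => (x.comp (MulSemiringAction.toRingHom G O σ) : O →+* Ω)
  have hnot : (x' : O →* Ω) ∉ Set.range ψ := by
    rintro ⟨σ, hσ⟩
    obtain ⟨f, hf⟩ := hcon σ
    apply hf
    have := DFunLike.congr_fun hσ f
    change x (σ • f) = fr (x f) at this
    rw [this, hfr]
  refine hli.notMem_span_image hnot ?_
  have : ((x' : O →* Ω) : O → Ω) = ∑ σ : G, a σ • (ψ σ : O → Ω) := by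
    ext f
    rw [Finset.sum_apply]
    exact hx'a f
  rw [this]
  refine Submodule.sum_mem _ fun σ _ => Submodule.smul_mem _ _ (Submodule.subset_span ?_)
  exact ⟨ψ σ, ⟨σ, rfl⟩, rfl⟩

end Stepanov

end LaurentBound

namespace LaurentBound

/-- The number of rational points of `Ω` at which a given polynomial does not vanish. -/
theorem exists_goodPoints {F : Type*} [Field F] [Fintype F] (Ω : Type*) [Field Ω] [IsAlgClosed Ω]
    [Algebra F Ω] {Δ : F[X]} (hΔ : Δ ≠ 0) {n : ℕ} (hn : n ≠ 0) :
    ∃ B : Finset Ω, (∀ y, y ∈ B ↔ y ^ (Fintype.card F ^ n) = y ∧ aeval y Δ ≠ 0) ∧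
      B.card ≤ Fintype.card F ^ n ∧ Fintype.card F ^ n ≤ B.card + Δ.natDegree := by
  obtain ⟨p, hp⟩ := CharP.exists F
  have hpp : p.Prime := CharP.char_is_prime F p
  have : Fact p.Prime := ⟨hpp⟩
  have : CharP Ω p := charP_of_injective_algebraMap (algebraMap F Ω).injective p
  obtain ⟨k, -, hk⟩ := FiniteField.card F p
  set Q := Fintype.card F ^ n with hQ
  have hq1 : 1 < Fintype.card F := Fintype.one_lt_card
  have hQ1 : 1 < Q := Nat.one_lt_pow hn hq1
  have hpQ : p ∣ Q := by
    rw [hQ, hk]; exact dvd_pow (dvd_pow_self p k.ne_zero) hn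
  have hne : (X ^ Q - X : Polynomial Ω) ≠ 0 := FiniteField.X_pow_card_sub_X_ne_zero Ω hQ1
  have hcard : Fintype.card ((X ^ Q - X : Polynomial Ω).rootSet Ω) = Q := by
    rw [card_rootSet_eq_natDegree (galois_poly_separable p Q hpQ) (IsAlgClosed.splits _),
      FiniteField.X_pow_card_sub_X_natDegree_eq Ω hQ1]
  set R : Finset Ω := ((X ^ Q - X : Polynomial Ω).rootSet Ω).toFinset with hR
  have hRc : R.card = Q := by rw [hR, Set.toFinset_card, hcard]
  have hRm : ∀ y, y ∈ R ↔ y ^ Q = y := by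
    intro y
    rw [hR, Set.mem_toFinset, mem_rootSet]
    simp [hne, sub_eq_zero]
  refine ⟨R.filter fun y => aeval y Δ ≠ 0, fun y => by rw [Finset.mem_filter, hRm],
    (Finset.card_filter_le _ _).trans_eq hRc, ?_⟩
  rw [← hRc, ← Finset.card_filter_add_card_filter_not (s := R) (fun y => aeval y Δ ≠ 0)]
  gcongr
  refine (Finset.card_le_card (t := (Δ.aroots Ω).toFinset) fun y hy => ?_).trans ?_
  · rw [Finset.mem_filter, not_not] at hy
    rw [Multiset.mem_toFinset, mem_aroots]
    exact ⟨hΔ, hy.2⟩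
  · exact (Multiset.toFinset_card_le _).trans ((card_roots' _).trans natDegree_map_le)

section Stepanov

variable {F : Type*} [Field F] [Fintype F] {O : Type*} [CommRing O] [IsDomain O]
  [Algebra F[X] O] [Algebra F O] [IsScalarTower F F[X] O]
  {G : Type*} [Group G] [MulSemiringAction G O] [SMulCommClass G F[X] O]
  [Fintype G] {φ : O →+* LaurentSeries F}
  (hφ : ∀ f, φ (algebraMap F[X] O f) = polyInf F f) (hinj : Function.Injective φ)

include hφ hinj in
/-- Equidistribution of Frobenius elements with a square root error term. -/
theorem frobenius_equidistribution [Algebra.IsInvariant F[X] O G] [Algebra.IsIntegral F[X] O]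
    (w : Module.Basis G F[X] O)
    (hdet : (Matrix.of fun σ e : G => σ • w e).det ≠ 0) (hcomm : ∀ a b : G, a * b = b * a)
    (Ω : Type*) [Field Ω] [IsAlgClosed Ω] [Algebra F Ω] {E : F[X]} (hE : E ≠ 0) :
    ∃ C n₀ : ℕ, ∃ Δ : F[X], Δ ≠ 0 ∧ E ∣ Δ ∧ ∀ n ≥ n₀, ∃ B : Finset Ω, ∃ Fr : Ω → G,
      (∀ y, y ∈ B ↔ y ^ (Fintype.card F ^ (2 * n)) = y ∧ aeval y Δ ≠ 0) ∧
      (∀ y ∈ B, ∃ x : O →+* Ω, (∀ f, x (algebraMap F[X] O f) = aeval y f) ∧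
        ∀ f, x f ^ (Fintype.card F ^ (2 * n)) = x (Fr y • f)) ∧
      Fintype.card F ^ (2 * n) ≤ B.card + Δ.natDegree ∧
      ∀ τ, |(Fintype.card G * (B.filter fun y => Fr y = τ).card : ℝ)
        - (Fintype.card F : ℝ) ^ (2 * n)| ≤ C * (Fintype.card F : ℝ) ^ n := by
  have hOinj : Function.Injective (algebraMap F[X] O) := by
    intro a b hab
    apply polyInf_injective
    rw [← hφ, ← hφ, hab]
  obtain ⟨c, n₀, Δ, hΔ0, hΔ, H⟩ := stepanov_bound hφ hinj w hdet hcomm Ω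
  refine ⟨Fintype.card G * (c + (Δ * E).natDegree), max n₀ 1, Δ * E, mul_ne_zero hΔ0 hE,
    dvd_mul_left _ _, fun n hn => ?_⟩
  have hn0 : n₀ ≤ n := (le_max_left _ _).trans hn
  have hn1 : 1 ≤ n := (le_max_right _ _).trans hn
  obtain ⟨B, hB, hBle, hBge⟩ := exists_goodPoints Ω (mul_ne_zero hΔ0 hE) (n := 2 * n) (by omega)
  have hFr : ∀ y ∈ B, ∃ τ : G, ∃ x : O →+* Ω, (∀ f, x (algebraMap F[X] O f) = aeval y f) ∧
        ∀ f, x f ^ (Fintype.card F ^ (2 * n)) = x (τ • f) := by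
    intro y hy
    obtain ⟨x, hx⟩ := exists_extension (Ω := Ω) hOinj (aeval y : F[X] →ₐ[F] Ω).toRingHom
    obtain ⟨hy1, hy2⟩ := (hB y).1 hy
    rw [map_mul] at hy2
    obtain ⟨τ, hτ⟩ := exists_frobenius w (2 * n) hy1 x hx (hΔ y x hx (left_ne_zero_of_mul hy2))
    exact ⟨τ, x, hx, hτ⟩
  choose! Fr hFr using hFr
  refine ⟨B, Fr, hB, hFr, hBge, ?_⟩
  set q := Fintype.card F
  have hq : 0 < q := Fintype.card_pos
  have hup : ∀ τ, Fintype.card G * (B.filter fun y => Fr y = τ).card ≤ q ^ (2 * n) + c * q ^ n := by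
    intro τ
    refine H n hn0 τ _ fun y hy => ?_
    rw [Finset.mem_filter] at hy
    obtain ⟨hy, rfl⟩ := hy
    have := ((hB y).1 hy).2
    rw [map_mul] at this
    exact ⟨left_ne_zero_of_mul this, hFr y hy⟩
  have hsum : ∑ τ, (B.filter fun y => Fr y = τ).card = B.card :=
    (Finset.card_eq_sum_card_fiberwise (fun y _ => Finset.mem_univ (Fr y))).symm
  intro τ
  have hupR : ∀ τ, (Fintype.card G * (B.filter fun y => Fr y = τ).card : ℝ) ≤
      (q : ℝ) ^ (2 * n) + c * (q : ℝ) ^ n := fun τ => by exact_mod_cast hup τ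
  have hsumR : ∑ τ, ((Fintype.card G * (B.filter fun y => Fr y = τ).card : ℝ)
      - (q : ℝ) ^ (2 * n)) = Fintype.card G * B.card - Fintype.card G * (q : ℝ) ^ (2 * n) := by
    rw [Finset.sum_sub_distrib, ← Finset.mul_sum, ← hsum, Finset.sum_const, Finset.card_univ,
      nsmul_eq_mul]
    push_cast
    rfl
  have hge : (q : ℝ) ^ (2 * n) ≤ B.card + (Δ * E).natDegree := by exact_mod_cast hBge
  have hqn : (1 : ℝ) ≤ (q : ℝ) ^ n := one_le_pow₀ (by exact_mod_cast hq)
  have hGpos : (1 : ℝ) ≤ Fintype.card G := by exact_mod_cast (Fintype.card_pos : 0 < Fintype.card G)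
  have hd0 : (0 : ℝ) ≤ (Δ * E).natDegree := Nat.cast_nonneg _
  have hc0 : (0 : ℝ) ≤ c := Nat.cast_nonneg _
  push_cast
  rw [abs_le]
  constructor
  · rw [← Finset.add_sum_erase _ _ (Finset.mem_univ τ)] at hsumR
    have h1 : ∑ τ ∈ Finset.univ.erase τ, ((Fintype.card G *
        (B.filter fun y => Fr y = τ).card : ℝ) - (q : ℝ) ^ (2 * n)) ≤
        (Finset.univ.erase τ).card • (c * (q : ℝ) ^ n) :=
      Finset.sum_le_card_nsmul _ _ _ fun σ _ => by linarith [hupR σ]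
    have h2 : ((Finset.univ.erase τ).card : ℝ) ≤ Fintype.card G := by
      exact_mod_cast Finset.card_le_univ _
    rw [nsmul_eq_mul] at h1
    have h3 : ((Finset.univ.erase τ).card : ℝ) * (c * (q : ℝ) ^ n) ≤
      Fintype.card G * (c * (q : ℝ) ^ n) := by gcongr
    have h4 : (Fintype.card G : ℝ) * (q : ℝ) ^ (2 * n) ≤
      Fintype.card G * (B.card + (Δ * E).natDegree) := by gcongr
    have h5 : (Fintype.card G : ℝ) * (Δ * E).natDegree ≤
      Fintype.card G * (Δ * E).natDegree * (q : ℝ) ^ n :=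
      le_mul_of_one_le_right (by positivity) hqn
    nlinarith
  · have h1 := hupR τ
    have h2 : c * (q : ℝ) ^ n ≤ Fintype.card G * (c * (q : ℝ) ^ n) :=
      le_mul_of_one_le_left (by positivity) hGpos
    have h3 : 0 ≤ (Fintype.card G : ℝ) * ((Δ * E).natDegree * (q : ℝ) ^ n) := by positivity
    nlinarith

end Stepanov

end LaurentBound

namespace LaurentBound

section Galois

variable {F : Type*} [Field F] [Fintype F] {k K : Type*} [Field k] [Field K] [Algebra F[X] k]
  [IsFractionRing F[X] k] [Algebra F[X] K] [Algebra k K] [IsScalarTower F[X] k K]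
  [FiniteDimensional k K] [IsGalois k K]

instance smulCommClass_aut : SMulCommClass (K ≃ₐ[k] K) F[X] K where
  smul_comm σ f x := by
    rw [← algebraMap_smul k f x, ← algebraMap_smul k f (σ • x)]
    exact map_smul σ _ _

instance isInvariant_integralClosure :
    Algebra.IsInvariant F[X] (integralClosure F[X] K) (K ≃ₐ[k] K) where
  isInvariant b hb := by
    have hfix : (b : K) ∈ IntermediateField.fixedField (⊤ : Subgroup (K ≃ₐ[k] K)) := by
      rintro ⟨σ, -⟩
      exact congrArg Subtype.val (hb σ)
    have hG : IsGalois k K := inferInstance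
    have hbot := ((IsGalois.tfae (F := k) (E := K)).out 0 1).mp hG
    rw [hbot, IntermediateField.mem_bot] at hfix
    obtain ⟨c, hc⟩ := hfix
    have hintg : IsIntegral F[X] (b : K) := b.2
    rw [← hc, isIntegral_algebraMap_iff (algebraMap k K).injective] at hintg
    obtain ⟨a, rfl⟩ := IsIntegrallyClosed.algebraMap_eq_of_integral hintg
    refine ⟨a, Subtype.ext ?_⟩
    rw [← hc, ← IsScalarTower.algebraMap_apply]
    rfl

theorem exists_basis_det_ne_zero :
    ∃ w : Module.Basis (K ≃ₐ[k] K) F[X] (integralClosure F[X] K),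
      (Matrix.of fun σ e : K ≃ₐ[k] K => σ • w e).det ≠ 0 := by
  have hKinj : Function.Injective (algebraMap F[X] K) := by
    rw [IsScalarTower.algebraMap_eq F[X] k K]
    exact (algebraMap k K).injective.comp (IsFractionRing.injective F[X] k)
  have : FaithfulSMul F[X] K := (faithfulSMul_iff_algebraMap_injective _ _).2 hKinj
  have : Module.IsTorsionFree F[X] K := Module.IsTorsionFree.trans_faithfulSMul F[X] K K
  have : Module.Free F[X] (integralClosure F[X] K) := IsIntegralClosure.module_free F[X] k K _
  have : Module.Finite F[X] (integralClosure F[X] K) := IsIntegralClosure.finite F[X] k K _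
  have hrank : Module.finrank F[X] (integralClosure F[X] K) = Fintype.card (K ≃ₐ[k] K) := by
    rw [IsIntegralClosure.rank F[X] k K, ← Nat.card_eq_fintype_card, IsGalois.card_aut_eq_finrank]
  let w : Module.Basis (K ≃ₐ[k] K) F[X] (integralClosure F[X] K) :=
    (Module.finBasisOfFinrankEq _ _ hrank).reindex (Fintype.equivFin _).symm
  refine ⟨w, fun hdet => ?_⟩
  obtain ⟨v, hv0, hv⟩ := Matrix.exists_vecMul_eq_zero_iff.2 hdet
  have hlin := linearIndependent_monoidHom K K
  let ψ : (K ≃ₐ[k] K) → (K →* K) := fun σ => ((σ : K →+* K) : K →* K)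
  have hψ : Function.Injective ψ := fun σ τ h => AlgEquiv.ext fun x => DFunLike.congr_fun h x
  have hlin' := Fintype.linearIndependent_iff.1 (hlin.comp ψ hψ) (fun σ => (v σ : K)) ?_
  · exact hv0 (funext fun σ => Subtype.ext (hlin' σ))
  have hO : ∀ f : integralClosure F[X] K, ∑ σ : K ≃ₐ[k] K, (v σ : K) * σ (f : K) = 0 := by
    intro f
    rw [← w.sum_repr f]
    simp only [AddSubmonoidClass.coe_finsetSum, map_sum, Finset.mul_sum]
    rw [Finset.sum_comm]
    refine Finset.sum_eq_zero fun e _ => ?_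
    have h1 := congrArg Subtype.val (congrFun hv e)
    simp only [Matrix.vecMul, dotProduct, Matrix.of_apply, AddSubmonoidClass.coe_finsetSum,
      Pi.zero_apply, ZeroMemClass.coe_zero, MulMemClass.coe_mul] at h1
    calc ∑ σ : K ≃ₐ[k] K, (v σ : K) * σ ((w.repr f e • w e : integralClosure F[X] K) : K)
        = algebraMap F[X] K (w.repr f e) * ∑ σ : K ≃ₐ[k] K, (v σ : K) * σ (w e : K) := by
          rw [Finset.mul_sum]
          refine Finset.sum_congr rfl fun σ _ => ?_
          rw [Algebra.smul_def, MulMemClass.coe_mul, map_mul]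
          change _ * (σ (algebraMap F[X] K _) * _) = _
          rw [IsScalarTower.algebraMap_apply F[X] k K, σ.commutes]
          ring
      _ = 0 := by
          rw [mul_eq_zero]; right
          exact h1
  ext x
  have halg : IsAlgebraic F[X] x :=
    (IsFractionRing.isAlgebraic_iff F[X] k K).2 (Algebra.IsAlgebraic.isAlgebraic (R := k) x)
  obtain ⟨b, hb0, hb⟩ := halg.exists_integral_multiple
  have h2 := hO ⟨b • x, hb⟩
  simp only [Finset.sum_apply, Pi.smul_apply, Function.comp_apply, Pi.zero_apply, smul_eq_mul]
  have hb0' : algebraMap F[X] K b ≠ 0 := by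
    rwa [Ne, map_eq_zero_iff _ hKinj]
  apply mul_left_cancel₀ hb0'
  rw [mul_zero, ← h2, Finset.mul_sum]
  refine Finset.sum_congr rfl fun σ _ => ?_
  change _ * (_ * σ x) = _ * σ (b • x)
  rw [Algebra.smul_def, map_mul, IsScalarTower.algebraMap_apply F[X] k K, σ.commutes]
  ring

/-- Equidistribution of Frobenius elements in an abelian extension of `F(X)` that splits
completely at infinity. -/
theorem galois_equidistribution (φ : K →+* LaurentSeries F)
    (hφ : ∀ f, φ (algebraMap F[X] K f) = polyInf F f)
    (hcomm : ∀ a b : K ≃ₐ[k] K, a * b = b * a)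
    (Ω : Type*) [Field Ω] [IsAlgClosed Ω] [Algebra F Ω] {E : F[X]} (hE : E ≠ 0) :
    ∃ C n₀ : ℕ, ∃ Δ : F[X], Δ ≠ 0 ∧ E ∣ Δ ∧ ∀ n ≥ n₀, ∃ B : Finset Ω, ∃ Fr : Ω → (K ≃ₐ[k] K),
      (∀ y, y ∈ B ↔ y ^ (Fintype.card F ^ (2 * n)) = y ∧ aeval y Δ ≠ 0) ∧
      (∀ y ∈ B, ∃ x : integralClosure F[X] K →+* Ω, (∀ f, x (algebraMap F[X] _ f) = aeval y f) ∧
        ∀ f, x f ^ (Fintype.card F ^ (2 * n)) = x (Fr y • f)) ∧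
      Fintype.card F ^ (2 * n) ≤ B.card + Δ.natDegree ∧
      ∀ τ, |(Fintype.card (K ≃ₐ[k] K) * (B.filter fun y => Fr y = τ).card : ℝ)
        - (Fintype.card F : ℝ) ^ (2 * n)| ≤ C * (Fintype.card F : ℝ) ^ n := by
  obtain ⟨w, hw⟩ := exists_basis_det_ne_zero (F := F) (k := k) (K := K)
  let _ : Algebra F (integralClosure F[X] K) :=
    ((algebraMap F[X] (integralClosure F[X] K)).comp C).toAlgebra
  have : IsScalarTower F F[X] (integralClosure F[X] K) := IsScalarTower.of_algebraMap_eq' rfl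
  have : Algebra.IsIntegral F[X] (integralClosure F[X] K) := inferInstance
  exact frobenius_equidistribution (O := integralClosure F[X] K)
    (φ := φ.comp (algebraMap (integralClosure F[X] K) K)) (fun f => hφ f)
    (φ.injective.comp Subtype.val_injective) w hw hcomm Ω hE

end Galois

end LaurentBound

namespace LaurentBound

open scoped TensorProduct

section Torsor

variable {F : Type*} [Field F] [Fintype F] {A : Type*} [CommRing A] [Algebra F A]
  [Module.Finite F A]

variable (F A) in
/-- A fixed basis of `A`. -/
abbrev cbasis : Module.Basis (Fin (Module.finrank F A)) F A := Module.finBasis F A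

/-- Coordinates of an element of `S ⊗ A` in the fixed basis of `A`. -/
def coord {S : Type*} [CommRing S] [Algebra F S] (z : S ⊗[F] A)
    (i : Fin (Module.finrank F A)) : S :=
  (Algebra.TensorProduct.basis S (cbasis F A)).repr z i

section
variable {S S' : Type*} [CommRing S] [Algebra F S] [CommRing S'] [Algebra F S']

theorem coord_ext {z z' : S ⊗[F] A} (h : ∀ i, coord z i = coord z' i) : z = z' :=
  (Algebra.TensorProduct.basis S (cbasis F A)).ext_elem h

theorem sum_coord (z : S ⊗[F] A) : ∑ i, coord z i ⊗ₜ[F] cbasis F A i = z := by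
  conv_rhs => rw [← (Algebra.TensorProduct.basis S (cbasis F A)).sum_repr z]
  refine Finset.sum_congr rfl fun i _ => ?_
  rw [Algebra.TensorProduct.basis_repr_symm_apply']
  rfl

theorem coord_add (z z' : S ⊗[F] A) (i : Fin (Module.finrank F A)) :
    coord (z + z') i = coord z i + coord z' i := by
  simp [coord]

theorem coord_tmul (s : S) (a : A) (i : Fin (Module.finrank F A)) :
    coord (s ⊗ₜ a) i = s * algebraMap F S ((cbasis F A).repr a i) := by
  simp [coord]

theorem coord_zero (i : Fin (Module.finrank F A)) : coord (0 : S ⊗[F] A) i = 0 := by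
  simp [coord]

/-- Base change along a homomorphism in the first factor. -/
abbrev mapLeft (f : S →ₐ[F] S') : S ⊗[F] A →ₐ[F] S' ⊗[F] A :=
  Algebra.TensorProduct.map f (AlgHom.id F A)

theorem coord_mapLeft (f : S →ₐ[F] S') (z : S ⊗[F] A) (i : Fin (Module.finrank F A)) :
    coord (mapLeft f z) i = f (coord z i) := by
  induction z with
  | zero => rw [map_zero, coord_zero, coord_zero, map_zero]
  | add x y hx hy => rw [map_add, coord_add, coord_add, map_add, hx, hy]
  | tmul s a => rw [Algebra.TensorProduct.map_tmul, coord_tmul, coord_tmul, map_mul, f.commutes,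
      AlgHom.id_apply]

theorem mapLeft_injective (f : S →ₐ[F] S') (hf : Function.Injective f) :
    Function.Injective (mapLeft (A := A) f) := by
  intro z z' h
  refine (Algebra.TensorProduct.basis S (cbasis F A)).ext_elem fun i => hf ?_
  have h1 := coord_mapLeft f z i
  have h2 := coord_mapLeft f z' i
  rw [← h, h1] at h2
  exact h2

theorem mapLeft_mapLeft {S'' : Type*} [CommRing S''] [Algebra F S''] (f : S →ₐ[F] S')
    (g : S' →ₐ[F] S'') (z : S ⊗[F] A) : mapLeft g (mapLeft f z) = mapLeft (g.comp f) z := by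
  induction z with
  | zero => simp
  | add x y hx hy => rw [map_add, map_add, map_add, hx, hy]
  | tmul s a => rfl

variable (S) in
/-- The `q`-Frobenius acting on the coordinates. -/
abbrev frobT : S ⊗[F] A →ₐ[F] S ⊗[F] A := mapLeft (FiniteField.frobeniusAlgHom F S)

theorem mapLeft_frobT (f : S →ₐ[F] S') (z : S ⊗[F] A) :
    mapLeft f (frobT S z) = frobT S' (mapLeft f z) := by
  rw [frobT, frobT, mapLeft_mapLeft, mapLeft_mapLeft]
  congr 2
  ext s
  exact map_pow f s _

end

/-- Frobenius-fixed tensors over a field are constant. -/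
theorem exists_of_frobT_eq {S : Type*} [Field S] [Algebra F S] (z : S ⊗[F] A)
    (hz : frobT S z = z) : ∃ c : A, z = 1 ⊗ₜ c := by
  have hfix : ∀ s : S, s ^ Fintype.card F = s → ∃ a : F, algebraMap F S a = s := by
    intro s hs
    have hq := Fintype.one_lt_card (α := F)
    have hsplit : (X ^ Fintype.card F - X : F[X]).Splits := by
      rw [splits_iff_card_roots, FiniteField.roots_X_pow_card_sub_X,
        FiniteField.X_pow_card_sub_X_natDegree_eq F hq]
      rfl
    have hroot : aeval s (X ^ Fintype.card F - X : F[X]) = 0 := by simp [hs]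
    exact hsplit.mem_range_of_isRoot (FiniteField.X_pow_card_sub_X_ne_zero F hq)
      (by rw [IsRoot, eval_map_algebraMap]; exact hroot)
  have h : ∀ i, ∃ a : F, algebraMap F S a = coord z i := by
    intro i
    apply hfix
    have := coord_mapLeft (FiniteField.frobeniusAlgHom F S) z i
    rw [hz] at this
    exact this.symm
  choose a ha using h
  refine ⟨(cbasis F A).repr.symm (Finsupp.equivFunOnFinite.symm a), coord_ext fun i => ?_⟩
  rw [coord_tmul, one_mul, LinearEquiv.apply_symm_apply, ← ha]
  rfl

end Torsor

end LaurentBound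

namespace LaurentBound

open scoped TensorProduct

section Torsor

variable {F : Type*} [Field F] [Fintype F] {A : Type*} [CommRing A] [Algebra F A]
  [Module.Finite F A]

theorem isUnit_of_isUnit_mapLeft {S S' : Type*} [Field S] [Algebra F S] [Field S'] [Algebra F S']
    (f : S →ₐ[F] S') {z : S ⊗[F] A} (hz : IsUnit (mapLeft f z)) : IsUnit z := by
  have : IsArtinianRing (S ⊗[F] A) := IsArtinianRing.of_finite S (S ⊗[F] A)
  refine IsArtinianRing.isUnit_of_mem_nonZeroDivisors (mem_nonZeroDivisors_iff_right.2
    fun x hx => mapLeft_injective f f.toRingHom.injective ?_)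
  have h := congrArg (mapLeft f) hx
  rw [map_mul, map_zero] at h
  rw [map_zero]
  exact hz.mul_left_eq_zero.1 h

variable {k K : Type*} [Field k] [Field K] [Algebra F k] [Algebra F K] [Algebra k K]
  [IsScalarTower F k K]

variable (F k K) in
/-- The inclusion `k → K` over `F`. -/
abbrev incl : k →ₐ[F] K := IsScalarTower.toAlgHom F k K

theorem coord_mapLeft_mul_mem {V : K ⊗[F] A} (W : Submodule k K) (hW : ∀ i, coord V i ∈ W)
    (z : k ⊗[F] A) (i : Fin (Module.finrank F A)) : coord (mapLeft (incl F k K) z * V) i ∈ W := by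
  induction z with
  | zero => rw [map_zero, zero_mul, coord_zero]; exact W.zero_mem
  | add x y hx hy => rw [map_add, add_mul, coord_add]; exact W.add_mem hx hy
  | tmul s a =>
    rw [← sum_coord V, Finset.mul_sum, Algebra.TensorProduct.map_tmul]
    have : ∀ t : Finset (Fin (Module.finrank F A)), coord (∑ j ∈ t, (incl F k K s ⊗ₜ[F] (a : A)) *
        (coord V j ⊗ₜ[F] cbasis F A j)) i ∈ W := by
      intro t
      induction t using Finset.induction_on with
      | empty => rw [Finset.sum_empty, coord_zero]; exact W.zero_mem
      | insert j t hj ih =>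
        rw [Finset.sum_insert hj, coord_add]
        refine W.add_mem ?_ ih
        rw [Algebra.TensorProduct.tmul_mul_tmul, coord_tmul,
          IsScalarTower.algebraMap_apply F k K, mul_comm, ← mul_assoc]
        change algebraMap k K _ * algebraMap k K s * _ ∈ W
        rw [← map_mul, ← Algebra.smul_def]
        exact W.smul_mem _ (hW j)
    exact this _

variable {V : K ⊗[F] A} {g : k ⊗[F] A} (hV : IsUnit V)
  (hfrob : frobT K V = mapLeft (incl F k K) g * V)

include hV hfrob in
theorem exists_frobT_iterate (r : ℕ) : ∃ G : k ⊗[F] A, IsUnit G ∧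
    ∀ i, coord (mapLeft (incl F k K) G * V) i = coord V i ^ (Fintype.card F ^ r) := by
  have hg : IsUnit g := by
    apply isUnit_of_isUnit_mapLeft (incl F k K)
    have h := hV.map (frobT K)
    rw [hfrob] at h
    exact isUnit_of_mul_isUnit_left h
  induction r with
  | zero => exact ⟨1, isUnit_one, fun i => by simp⟩
  | succ r ih =>
    obtain ⟨G, hG, h⟩ := ih
    refine ⟨frobT k G * g, (hG.map _).mul hg, fun i => ?_⟩
    rw [map_mul, mul_assoc, ← hfrob, mapLeft_frobT, ← map_mul, coord_mapLeft, h, pow_succ, pow_mul]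
    rfl

include hV hfrob in
theorem isAlgebraic_coord (i : Fin (Module.finrank F A)) : IsAlgebraic k (coord V i) := by
  by_contra hcon
  have htr : Transcendental k (coord V i) := hcon
  set v := coord V i
  have hli : LinearIndependent k (fun n : ℕ => v ^ n) := by
    have h1 := (Polynomial.basisMonomials k).linearIndependent.map'
      (aeval v : k[X] →ₐ[k] K).toLinearMap
      (LinearMap.ker_eq_bot.2 (transcendental_iff_injective.1 htr))
    have h2 : (fun n : ℕ => v ^ n) = ⇑(aeval v : k[X] →ₐ[k] K).toLinearMap ∘
        ⇑(Polynomial.basisMonomials k) := by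
      ext n
      simp
    rw [h2]
    exact h1
  set W : Submodule k K := Submodule.span k (Set.range (coord V))
  have hmem : ∀ r : ℕ, v ^ (Fintype.card F ^ r) ∈ W := by
    intro r
    obtain ⟨G, -, h⟩ := exists_frobT_iterate hV hfrob r
    rw [← h i]
    exact coord_mapLeft_mul_mem W (fun j => Submodule.subset_span ⟨j, rfl⟩) G i
  have hli2 : LinearIndependent k (fun r : ℕ => v ^ (Fintype.card F ^ r)) :=
    hli.comp (fun r => Fintype.card F ^ r) (Nat.pow_right_injective Fintype.one_lt_card)
  have hfd : FiniteDimensional k W := FiniteDimensional.span_of_finite k (Set.finite_range _)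
  have hli3 : LinearIndependent k (fun r : ℕ => (⟨_, hmem r⟩ : W)) :=
    LinearIndependent.of_comp W.subtype hli2
  exact not_finite_iff_infinite.2 (inferInstance : Infinite ℕ) hli3.finite

variable (hgen : IntermediateField.adjoin k (Set.range (coord V)) = ⊤)

include hV hfrob hgen in
theorem finiteDimensional_of_frobT : FiniteDimensional k K := by
  have h : FiniteDimensional k (IntermediateField.adjoin k (Set.range (coord V))) :=
    IntermediateField.finiteDimensional_adjoin (by
      rintro _ ⟨i, rfl⟩
      exact (isAlgebraic_coord hV hfrob i).isIntegral)
  rw [hgen] at h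
  exact (IntermediateField.topEquiv (F := k) (E := K)).toLinearEquiv.finiteDimensional

include hV hfrob hgen in
theorem isSeparable_of_frobT : Algebra.IsSeparable k K := by
  have := finiteDimensional_of_frobT hV hfrob hgen
  obtain ⟨p, hp⟩ := CharP.exists F
  have hpp : p.Prime := CharP.char_is_prime F p
  have : Fact p.Prime := ⟨hpp⟩
  obtain ⟨e, -, he⟩ := FiniteField.card F p
  have : CharP k p := charP_of_injective_algebraMap (algebraMap F k).injective p
  set S := separableClosure k K
  have : CharP S p := charP_of_injective_algebraMap (algebraMap k S).injective p
  have : ExpChar S p := ExpChar.prime hpp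
  have : IsPurelyInseparable S K := inferInstance
  have h1 : ∀ i, ∃ n : ℕ, coord V i ^ p ^ n ∈ S := by
    intro i
    obtain ⟨n, s, hs⟩ := IsPurelyInseparable.pow_mem S p (coord V i)
    exact ⟨n, by rw [← hs]; exact s.2⟩
  choose n hn using h1
  set N := ∑ i, n i
  have hN : ∀ i, coord V i ^ (Fintype.card F ^ N) ∈ S := by
    intro i
    have hle : n i ≤ e * N := (Finset.single_le_sum (f := n) (fun _ _ => Nat.zero_le _)
      (Finset.mem_univ i)).trans (Nat.le_mul_of_pos_left _ e.pos)
    rw [he, ← pow_mul, ← Nat.add_sub_cancel' hle, pow_add, pow_mul]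
    exact pow_mem (hn i) _
  obtain ⟨G, ⟨G, rfl⟩, hG⟩ := exists_frobT_iterate hV hfrob N
  have hS : ∀ i, coord V i ∈ S := by
    intro i
    have h2 : V = mapLeft (incl F k K) (↑G⁻¹ : k ⊗[F] A) * (mapLeft (incl F k K) (G : k ⊗[F] A) * V) := by
      rw [← mul_assoc, ← map_mul, Units.inv_mul, map_one, one_mul]
    rw [h2]
    exact coord_mapLeft_mul_mem (Subalgebra.toSubmodule S.toSubalgebra)
      (fun j => by rw [hG]; exact hN j) _ i
  rw [← separableClosure.eq_top_iff, eq_top_iff, ← hgen, IntermediateField.adjoin_le_iff]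
  rintro _ ⟨i, rfl⟩
  exact hS i

include hV hfrob in
theorem exists_mapLeft_eq {S : Type*} [Field S] [Algebra F S] [Algebra k S] [IsScalarTower F k S]
    (τ₁ τ₂ : K →ₐ[k] S) : ∃ c : A, mapLeft (τ₂.restrictScalars F) V =
      mapLeft (τ₁.restrictScalars F) V * (1 ⊗ₜ c) := by
  have hτ : ∀ τ : K →ₐ[k] S, frobT S (mapLeft (τ.restrictScalars F) V) =
      mapLeft (incl F k S) g * mapLeft (τ.restrictScalars F) V := by
    intro τ
    rw [← mapLeft_frobT, hfrob, map_mul, mapLeft_mapLeft]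
    congr 3
    ext x
    exact τ.commutes x
  have hu : ∀ τ : K →ₐ[k] S, IsUnit (mapLeft (τ.restrictScalars F) V) := fun τ => hV.map _
  obtain ⟨u, hu1⟩ := hu τ₁
  have h1 := hτ τ₁
  have h2 := hτ τ₂
  obtain ⟨c, hc⟩ := exists_of_frobT_eq ((↑u⁻¹ : S ⊗[F] A) * mapLeft (τ₂.restrictScalars F) V) (by
    rw [map_mul, h2]
    rw [← hu1] at h1
    have h3 : frobT S (↑u⁻¹ : S ⊗[F] A) * mapLeft (incl F k S) g = ↑u⁻¹ := by
      have h4 : frobT S (↑u⁻¹ : S ⊗[F] A) * (mapLeft (incl F k S) g * u) = 1 := by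
        rw [← h1, ← map_mul, Units.inv_mul, map_one]
      rw [← mul_assoc] at h4
      exact (Units.inv_eq_of_mul_eq_one_left h4).symm
    rw [← mul_assoc, h3])
  refine ⟨c, ?_⟩
  rw [← hc, ← hu1, ← mul_assoc, Units.mul_inv, one_mul]

include hgen in
theorem algHom_eq_of_mapLeft_eq {S : Type*} [Field S] [Algebra F S] [Algebra k S]
    [IsScalarTower F k S] {τ₁ τ₂ : K →ₐ[k] S}
    (h : mapLeft (τ₁.restrictScalars F) V = mapLeft (τ₂.restrictScalars F) V) : τ₁ = τ₂ := by
  have h1 : ∀ i, τ₁ (coord V i) = τ₂ (coord V i) := fun i => by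
    have h2 := coord_mapLeft (τ₁.restrictScalars F) V i
    rw [h, coord_mapLeft] at h2
    exact h2.symm
  ext x
  have hx : x ∈ IntermediateField.adjoin k (Set.range (coord V)) := hgen ▸ IntermediateField.mem_top
  induction hx using IntermediateField.adjoin_induction with
  | mem x hx => obtain ⟨i, rfl⟩ := hx; exact h1 i
  | algebraMap x => rw [τ₁.commutes, τ₂.commutes]
  | add x y _ _ hx hy => rw [map_add, map_add, hx, hy]
  | inv x _ hx => rw [map_inv₀, map_inv₀, hx]
  | mul x y _ _ hx hy => rw [map_mul, map_mul, hx, hy]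

include hV hfrob hgen in
theorem normal_of_frobT : Normal k K := by
  have := finiteDimensional_of_frobT hV hfrob hgen
  have hTk : IsScalarTower k K (AlgebraicClosure K) := inferInstance
  have : IsScalarTower F K (AlgebraicClosure K) := inferInstance
  have : IsScalarTower F k (AlgebraicClosure K) := IsScalarTower.of_algebraMap_eq fun x => by
    rw [IsScalarTower.algebraMap_apply F K (AlgebraicClosure K),
      IsScalarTower.algebraMap_apply F k K, ← IsScalarTower.algebraMap_apply k K]
  have : Algebra.IsAlgebraic k (AlgebraicClosure K) := Algebra.IsAlgebraic.trans k K _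
  have : Normal k (AlgebraicClosure K) := ⟨fun x => IsAlgClosed.splits _⟩
  set j : K →ₐ[k] AlgebraicClosure K := IsScalarTower.toAlgHom k K (AlgebraicClosure K)
  have e : ∃ e : K ≃ₐ[k] j.fieldRange, ∀ y, ∃ x, e x = y :=
    ⟨AlgEquiv.ofInjectiveField j, (AlgEquiv.ofInjectiveField j).surjective⟩
  obtain ⟨e, he⟩ := e
  have hnorm : Normal k j.fieldRange := by
    rw [IntermediateField.normal_iff_forall_fieldRange_le]
    intro σ
    set ρ : K →ₐ[k] AlgebraicClosure K := σ.comp e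
    obtain ⟨c, hc⟩ := exists_mapLeft_eq hV hfrob j ρ
    rintro _ ⟨y, rfl⟩
    obtain ⟨x, rfl⟩ := he y
    change ρ x ∈ j.fieldRange
    have hx : x ∈ IntermediateField.adjoin k (Set.range (coord V)) :=
      hgen ▸ IntermediateField.mem_top
    induction hx using IntermediateField.adjoin_induction with
    | mem x hx =>
      obtain ⟨i, rfl⟩ := hx
      have h2 := coord_mapLeft (ρ.restrictScalars F) V i
      rw [hc] at h2
      refine h2 ▸ ⟨coord (V * (1 ⊗ₜ c)) i, ?_⟩
      have h3 := coord_mapLeft (j.restrictScalars F) (V * (1 ⊗ₜ c)) i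
      rw [map_mul, Algebra.TensorProduct.map_tmul, map_one] at h3
      exact h3.symm
    | algebraMap x =>
      rw [AlgHom.commutes]
      exact j.fieldRange.algebraMap_mem x
    | add x y _ _ hx hy => rw [map_add]; exact add_mem hx hy
    | inv x _ hx => rw [map_inv₀]; exact inv_mem hx
    | mul x y _ _ hx hy => rw [map_mul]; exact mul_mem hx hy
  exact Normal.of_algEquiv e.symm

include hV hfrob hgen in
theorem isGalois_of_frobT : IsGalois k K where
  to_isSeparable := isSeparable_of_frobT hV hfrob hgen
  to_normal := normal_of_frobT hV hfrob hgen

include hV hfrob in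
theorem exists_mapLeft_aut_eq (σ : K ≃ₐ[k] K) : ∃ c : A,
    mapLeft ((σ : K →ₐ[k] K).restrictScalars F) V = V * (1 ⊗ₜ c) := by
  obtain ⟨c, hc⟩ := exists_mapLeft_eq hV hfrob (AlgHom.id k K) (σ : K →ₐ[k] K)
  refine ⟨c, hc.trans ?_⟩
  congr 1
  exact DFunLike.congr_fun (Algebra.TensorProduct.map_id (R := F) (S := F)) V

theorem mapLeft_mul_aut {σ τ : K ≃ₐ[k] K} {c d : A}
    (hσ : mapLeft ((σ : K →ₐ[k] K).restrictScalars F) V = V * (1 ⊗ₜ c))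
    (hτ : mapLeft ((τ : K →ₐ[k] K).restrictScalars F) V = V * (1 ⊗ₜ d)) :
    mapLeft (((σ * τ : K ≃ₐ[k] K) : K →ₐ[k] K).restrictScalars F) V = V * (1 ⊗ₜ (c * d)) := by
  have h := mapLeft_mapLeft ((τ : K →ₐ[k] K).restrictScalars F)
    ((σ : K →ₐ[k] K).restrictScalars F) V
  refine Eq.trans h.symm ?_
  rw [hτ, map_mul, hσ, Algebra.TensorProduct.map_tmul, map_one, mul_assoc,
    Algebra.TensorProduct.tmul_mul_tmul, one_mul]
  rfl

include hV hfrob hgen in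
theorem aut_comm_of_frobT (σ τ : K ≃ₐ[k] K) : σ * τ = τ * σ := by
  obtain ⟨c, hc⟩ := exists_mapLeft_aut_eq hV hfrob σ
  obtain ⟨d, hd⟩ := exists_mapLeft_aut_eq hV hfrob τ
  have h : ((σ * τ : K ≃ₐ[k] K) : K →ₐ[k] K) = ((τ * σ : K ≃ₐ[k] K) : K →ₐ[k] K) := by
    apply algHom_eq_of_mapLeft_eq hgen
    rw [mapLeft_mul_aut hc hd, mapLeft_mul_aut hd hc, mul_comm c]
  exact AlgEquiv.ext fun x => DFunLike.congr_fun h x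

end Torsor

end LaurentBound

namespace LaurentBound

open scoped TensorProduct

section Lang

variable {F : Type*} [Field F] [Fintype F] {A : Type*} [CommRing A] [Algebra F A]
  [Module.Finite F A]

variable (F A) in
/-- The `n`-th coefficient of a tensor, seen as a power series over `A`. -/
def cf (n : ℕ) : PowerSeries F ⊗[F] A →ₗ[F] A :=
  TensorProduct.lift (LinearMap.lsmul F A ∘ₗ PowerSeries.coeff n)

theorem cf_tmul (n : ℕ) (s : PowerSeries F) (a : A) :
    cf F A n (s ⊗ₜ a) = PowerSeries.coeff n s • a := rfl

theorem repr_cf (n : ℕ) (z : PowerSeries F ⊗[F] A) (i : Fin (Module.finrank F A)) :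
    (cbasis F A).repr (cf F A n z) i = PowerSeries.coeff n (coord z i) := by
  induction z with
  | zero => simp [coord_zero]
  | add x y hx hy => simp only [map_add, coord_add, Finsupp.add_apply, hx, hy]
  | tmul s a =>
    rw [cf_tmul, coord_tmul, mul_comm, PowerSeries.algebraMap_apply, Algebra.algebraMap_self,
      RingHom.id_apply, PowerSeries.coeff_C_mul]
    simp [mul_comm]

variable (F A) in
/-- Tensors in `F⟦X⟧ ⊗ A` as power series over `A`. -/
def toPS (z : PowerSeries F ⊗[F] A) : PowerSeries A := PowerSeries.mk fun n => cf F A n z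

theorem coeff_toPS (n : ℕ) (z : PowerSeries F ⊗[F] A) :
    PowerSeries.coeff n (toPS F A z) = cf F A n z := PowerSeries.coeff_mk _ _

theorem toPS_injective : Function.Injective (toPS F A) := by
  intro z w h
  refine coord_ext fun i => PowerSeries.ext fun n => ?_
  rw [← repr_cf, ← repr_cf, ← coeff_toPS, ← coeff_toPS, h]

theorem toPS_surjective : Function.Surjective (toPS F A) := by
  intro u
  refine ⟨∑ i, (PowerSeries.mk fun n => (cbasis F A).repr (PowerSeries.coeff n u) i) ⊗ₜ[F]
    cbasis F A i, PowerSeries.ext fun n => ?_⟩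
  rw [coeff_toPS, map_sum]
  simp only [cf_tmul, PowerSeries.coeff_mk]
  exact (cbasis F A).sum_repr _

theorem toPS_add (z w : PowerSeries F ⊗[F] A) : toPS F A (z + w) = toPS F A z + toPS F A w := by
  ext n
  simp [coeff_toPS]

theorem toPS_tmul (s : PowerSeries F) (a : A) :
    toPS F A (s ⊗ₜ a) = PowerSeries.map (algebraMap F A) s * PowerSeries.C a := by
  ext n
  rw [coeff_toPS, cf_tmul, PowerSeries.coeff_mul_C, PowerSeries.coeff_map, Algebra.smul_def]

theorem toPS_mul (z w : PowerSeries F ⊗[F] A) : toPS F A (z * w) = toPS F A z * toPS F A w := by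
  induction z with
  | zero =>
    rw [zero_mul]
    ext n
    simp [coeff_toPS, PowerSeries.coeff_mul]
  | add x y hx hy => rw [add_mul, toPS_add, toPS_add, hx, hy, add_mul]
  | tmul s a =>
    induction w with
    | zero =>
      rw [mul_zero]
      ext n
      simp [coeff_toPS, PowerSeries.coeff_mul]
    | add x y hx hy => rw [mul_add, toPS_add, toPS_add, hx, hy, mul_add]
    | tmul t b =>
      rw [Algebra.TensorProduct.tmul_mul_tmul, toPS_tmul, toPS_tmul, toPS_tmul, map_mul, map_mul]
      ring

theorem toPS_one : toPS F A 1 = 1 := by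
  rw [Algebra.TensorProduct.one_def, toPS_tmul, map_one, map_one, one_mul]

theorem coeff_pow_card (s : PowerSeries F) (n : ℕ) : PowerSeries.coeff n (s ^ Fintype.card F) =
    if Fintype.card F ∣ n then PowerSeries.coeff (n / Fintype.card F) s else 0 := by
  have hq : Fintype.card F ≠ 0 := Fintype.card_ne_zero
  have h : s ^ Fintype.card F = PowerSeries.expand (Fintype.card F) hq s := by
    obtain ⟨p, hp⟩ := CharP.exists F
    obtain ⟨m, hpp, hm⟩ := FiniteField.card F p
    have := Fact.mk hpp
    have hE : ExpChar F p := ExpChar.prime hpp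
    have h1 := MvPowerSeries.map_iterateFrobenius_expand (R := F) (σ := Unit) p hpp.ne_zero s m
    have h2 : iterateFrobenius F p m = RingHom.id F := RingHom.ext fun x => by
      rw [iterateFrobenius_def, ← hm, FiniteField.pow_card, RingHom.id_apply]
    rw [h2, MvPowerSeries.map_id, RingHom.id_apply] at h1
    simp only [hm]
    exact h1.symm
  rw [h]
  split_ifs with hd
  · obtain ⟨m, rfl⟩ := hd
    rw [PowerSeries.coeff_expand_mul, Nat.mul_div_cancel_left _ (Nat.pos_of_ne_zero hq)]
  · exact PowerSeries.coeff_expand_of_not_dvd _ _ _ hd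

theorem coeff_toPS_frobT (z : PowerSeries F ⊗[F] A) (n : ℕ) :
    PowerSeries.coeff n (toPS F A (frobT _ z)) = if Fintype.card F ∣ n then
      PowerSeries.coeff (n / Fintype.card F) (toPS F A z) else 0 := by
  induction z with
  | zero => simp [coeff_toPS]
  | add x y hx hy =>
    rw [map_add, toPS_add, map_add, hx, hy, toPS_add, map_add]
    split_ifs <;> simp
  | tmul s a =>
    rw [Algebra.TensorProduct.map_tmul, coeff_toPS, coeff_toPS, cf_tmul, cf_tmul]
    change PowerSeries.coeff n (s ^ Fintype.card F) • a = _
    rw [coeff_pow_card]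
    split_ifs <;> simp

/-- Coefficients of the solution of `u(X^q) = h(X) u(X)` with `u(0) = 1`. -/
def langCoeff {A : Type*} [CommRing A] (q : ℕ) (h : ℕ → A) : ℕ → A
  | 0 => 1
  | n + 1 => (if hq : 1 < q ∧ q ∣ n + 1 then langCoeff q h ((n + 1) / q) else 0) -
      ∑ i : Fin (n + 1), h (n + 1 - i) * langCoeff q h i
termination_by n => n
decreasing_by
  · exact Nat.div_lt_self n.succ_pos hq.1
  · exact i.2

theorem exists_lang (h : PowerSeries A) (h0 : PowerSeries.coeff 0 h = 1) :
    ∃ U : PowerSeries F ⊗[F] A, PowerSeries.coeff 0 (toPS F A U) = 1 ∧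
      toPS F A (frobT _ U) = h * toPS F A U := by
  obtain ⟨U, hU⟩ := toPS_surjective (F := F)
    (PowerSeries.mk (langCoeff (Fintype.card F) fun n => PowerSeries.coeff n h))
  refine ⟨U, by rw [hU, PowerSeries.coeff_mk, langCoeff], PowerSeries.ext fun n => ?_⟩
  rw [coeff_toPS_frobT, hU, mul_comm, PowerSeries.coeff_mul,
    Finset.Nat.sum_antidiagonal_eq_sum_range_succ_mk, Finset.sum_range_succ]
  simp only [PowerSeries.coeff_mk, Nat.sub_self, h0, mul_one]
  cases n with
  | zero => simp
  | succ n =>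
    have hq : 1 < Fintype.card F := Fintype.one_lt_card
    rw [langCoeff, Finset.sum_range]
    simp only [hq, true_and, dite_eq_ite]
    simp only [mul_comm, add_sub_cancel]

theorem isUnit_of_coeff_zero (U : PowerSeries F ⊗[F] A)
    (h : PowerSeries.coeff 0 (toPS F A U) = 1) : IsUnit U := by
  obtain ⟨W, hW⟩ := toPS_surjective (F := F) (PowerSeries.invOfUnit (toPS F A U) 1)
  refine IsUnit.of_mul_eq_one W (toPS_injective ?_)
  rw [toPS_mul, hW, toPS_one]
  exact PowerSeries.mul_invOfUnit _ _ (by simpa using h)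

end Lang

end LaurentBound

namespace LaurentBound

open scoped TensorProduct

section Torsor

variable (F : Type*) [Field F]

/-- The completion of `F(Y)` at infinity, as a `F[Y]`-algebra. -/
def Inf : Type _ := LaurentSeries F

instance : Field (Inf F) := inferInstanceAs (Field (LaurentSeries F))

instance : Algebra F (Inf F) := inferInstanceAs (Algebra F (LaurentSeries F))

instance : Algebra F[X] (Inf F) := (polyInf F).toAlgebra

theorem algebraMap_inf (f : F[X]) : algebraMap F[X] (Inf F) f = polyInf F f := rfl

theorem algebraMap_laurent (a : F) : algebraMap F (LaurentSeries F) a = HahnSeries.C a := by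
  change HahnSeries.ofPowerSeries ℤ F (algebraMap F (PowerSeries F) a) = _
  rw [PowerSeries.algebraMap_apply, Algebra.algebraMap_self, RingHom.id_apply]
  exact HahnSeries.ofPowerSeries_C a

instance : IsScalarTower F F[X] (Inf F) := IsScalarTower.of_algebraMap_eq fun a => by
  rw [algebraMap_inf, Polynomial.algebraMap_apply, Algebra.algebraMap_self, RingHom.id_apply,
    polyInf_C]
  exact algebraMap_laurent F a

instance : FaithfulSMul F[X] (Inf F) :=
  (faithfulSMul_iff_algebraMap_injective _ _).2 (polyInf_injective)

instance : Algebra (FractionRing F[X]) (Inf F) := FractionRing.liftAlgebra F[X] (Inf F)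

instance : IsScalarTower F[X] (FractionRing F[X]) (Inf F) :=
  FractionRing.isScalarTower_liftAlgebra F[X] (Inf F)

instance : IsScalarTower F (FractionRing F[X]) (Inf F) := IsScalarTower.of_algebraMap_eq fun a => by
  rw [IsScalarTower.algebraMap_apply F F[X] (Inf F),
    IsScalarTower.algebraMap_apply F F[X] (FractionRing F[X]),
    ← IsScalarTower.algebraMap_apply F[X] (FractionRing F[X]) (Inf F)]

section
variable {F}
variable (K : IntermediateField (FractionRing F[X]) (Inf F))

instance : IsScalarTower F F[X] K := IsScalarTower.of_algebraMap_eq fun a => by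
  rw [IsScalarTower.algebraMap_apply F (FractionRing F[X]) K,
    IsScalarTower.algebraMap_apply F F[X] (FractionRing F[X]),
    ← IsScalarTower.algebraMap_apply F[X] (FractionRing F[X]) K]

end

variable {F} {A : Type*} [CommRing A] [Algebra F A]

/-- Evaluation of a polynomial over `A` at a point of `S`, with values in `S ⊗ A`. -/
def tev {S : Type*} [CommRing S] [Algebra F S] (y : S) : A[X] →+* S ⊗[F] A :=
  eval₂RingHom (Algebra.TensorProduct.includeRight : A →ₐ[F] S ⊗[F] A).toRingHom (y ⊗ₜ 1)

theorem tev_C {S : Type*} [CommRing S] [Algebra F S] (y : S) (a : A) :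
    tev (F := F) y (C a) = 1 ⊗ₜ a := by simp [tev]

theorem tev_X {S : Type*} [CommRing S] [Algebra F S] (y : S) :
    tev (F := F) y (X : A[X]) = y ⊗ₜ 1 := by simp [tev]

theorem mapLeft_tev {S S' : Type*} [CommRing S] [Algebra F S] [CommRing S'] [Algebra F S']
    (f : S →ₐ[F] S') (y : S) (g : A[X]) : mapLeft f (tev y g) = tev (f y) g := by
  induction g using Polynomial.induction_on' with
  | add p q hp hq => rw [map_add, map_add, map_add, hp, hq]
  | monomial n a =>
    rw [← C_mul_X_pow_eq_monomial]
    simp only [map_mul, map_pow, tev_C, tev_X, Algebra.TensorProduct.map_tmul, map_one]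
    rfl

theorem tmul_pow_one {S : Type*} [CommRing S] [Algebra F S] (y : S) (n : ℕ) :
    (y ⊗ₜ[F] (1 : A)) ^ n = (y ^ n) ⊗ₜ 1 := by
  rw [Algebra.TensorProduct.tmul_pow, one_pow]

theorem tev_reverse {S : Type*} [CommRing S] [Algebra F S] {x y : S} (h : x * y = 1) (g : A[X]) :
    tev (F := F) x g.reverse * (y ^ g.natDegree) ⊗ₜ 1 = tev y g := by
  have h1 : (x ⊗ₜ[F] (1 : A)) * (y ⊗ₜ 1) = 1 := by
    rw [Algebra.TensorProduct.tmul_mul_tmul, h, one_mul]; rfl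
  have : Invertible (y ⊗ₜ[F] (1 : A)) := ⟨x ⊗ₜ 1, h1, by rw [mul_comm, h1]⟩
  have h2 := eval₂_reverse_mul_pow
    (Algebra.TensorProduct.includeRight : A →ₐ[F] S ⊗[F] A).toRingHom (y ⊗ₜ[F] (1 : A)) g
  have h3 : ⅟ (y ⊗ₜ[F] (1 : A)) = x ⊗ₜ 1 := invOf_eq_left_inv h1
  rw [h3, tmul_pow_one] at h2
  exact h2

variable [Fintype F] [Module.Finite F A]

theorem toPS_tev (g : A[X]) : toPS F A (tev PowerSeries.X g) = (g : PowerSeries A) := by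
  induction g using Polynomial.induction_on' with
  | add p q hp hq => rw [map_add, toPS_add, hp, hq, Polynomial.coe_add]
  | monomial n a =>
    rw [← C_mul_X_pow_eq_monomial, map_mul, map_pow, tev_C, tev_X, toPS_mul, tmul_pow_one,
      toPS_tmul, toPS_tmul]
    simp

/-- A multiplicative torsor: a unit `V` over the completion with `Frob V = g V`. -/
theorem exists_torsor_inf {g : A[X]} (hg : g.Monic) (hdeg : g.natDegree = Fintype.card F - 1) :
    ∃ V : Inf F ⊗[F] A, IsUnit V ∧ frobT (Inf F) V = tev (algebraMap F[X] (Inf F) X) g * V := by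
  have h0 : PowerSeries.coeff 0 (g.reverse : PowerSeries A) = 1 := by
    rw [Polynomial.coeff_coe, coeff_zero_reverse, hg]
  obtain ⟨U, hU0, hU⟩ := exists_lang (F := F) (g.reverse : PowerSeries A) h0
  rw [← toPS_tev (F := F), ← toPS_mul] at hU
  replace hU := toPS_injective hU
  have hUu := isUnit_of_coeff_zero U hU0
  obtain ⟨ι, hι⟩ : ∃ ι : PowerSeries F →ₐ[F] Inf F, ∀ s, ι s = HahnSeries.ofPowerSeries ℤ F s :=
    ⟨⟨HahnSeries.ofPowerSeries ℤ F, fun _ => rfl⟩, fun _ => rfl⟩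
  set y : Inf F := algebraMap F[X] (Inf F) X with hy
  have hxy : ι PowerSeries.X * y = 1 := by
    rw [hι, HahnSeries.ofPowerSeries_X, hy, algebraMap_inf, polyInf_X]
    change HahnSeries.single (1 : ℤ) (1 : F) * HahnSeries.single (-1 : ℤ) (1 : F) = 1
    rw [HahnSeries.single_mul_single]
    simp
  refine ⟨y ⊗ₜ 1 * mapLeft ι U, IsUnit.mul ?_ (hUu.map _), ?_⟩
  · refine IsUnit.of_mul_eq_one (ι PowerSeries.X ⊗ₜ 1) ?_
    rw [Algebra.TensorProduct.tmul_mul_tmul, mul_comm y, hxy, one_mul]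
    rfl
  · have hq : 1 < Fintype.card F := Fintype.one_lt_card
    rw [map_mul, ← mapLeft_frobT, hU, map_mul, mapLeft_tev, ← tev_reverse hxy g, hdeg,
      Algebra.TensorProduct.map_tmul, map_one]
    change (y ^ Fintype.card F) ⊗ₜ 1 * _ = _
    have h4 : (y ^ Fintype.card F) ⊗ₜ[F] (1 : A) = (y ^ (Fintype.card F - 1)) ⊗ₜ 1 * y ⊗ₜ 1 := by
      rw [Algebra.TensorProduct.tmul_mul_tmul, one_mul, ← pow_succ, Nat.sub_add_cancel hq.le]
    rw [h4]
    ring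

theorem exists_galois_torsor {g : A[X]} (hg : g.Monic) (hdeg : g.natDegree = Fintype.card F - 1) :
    ∃ K : IntermediateField (FractionRing F[X]) (Inf F),
      FiniteDimensional (FractionRing F[X]) K ∧ IsGalois (FractionRing F[X]) K ∧
      (∀ σ τ : K ≃ₐ[FractionRing F[X]] K, σ * τ = τ * σ) ∧
      ∃ V : K ⊗[F] A, IsUnit V ∧ frobT K V = tev (algebraMap F[X] K X) g * V ∧
        IntermediateField.adjoin (FractionRing F[X]) (Set.range (coord V)) = ⊤ := by
  obtain ⟨V, hV, hfrob⟩ := exists_torsor_inf hg hdeg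
  set K := IntermediateField.adjoin (FractionRing F[X]) (Set.range (coord V)) with hK
  have hmem : ∀ i, coord V i ∈ K := fun i =>
    IntermediateField.subset_adjoin _ _ (Set.mem_range_self i)
  set W : K ⊗[F] A := ∑ i, (⟨coord V i, hmem i⟩ : K) ⊗ₜ cbasis F A i with hW
  set j : K →ₐ[F] Inf F := K.val.restrictScalars F with hj
  have hjW : mapLeft j W = V := by
    rw [hW, map_sum]
    conv_rhs => rw [← sum_coord V]
    rfl
  have hcW : ∀ i, ((coord W i : K) : Inf F) = coord V i := fun i => by
    rw [← hjW]
    exact (coord_mapLeft j W i).symm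
  have hWu : IsUnit W := isUnit_of_isUnit_mapLeft j (by rwa [hjW])
  have hWfrob : frobT K W = tev (algebraMap F[X] K X) g * W := by
    apply mapLeft_injective j j.toRingHom.injective
    rw [mapLeft_frobT, map_mul, hjW, hfrob, mapLeft_tev]
    rfl
  have hgen : IntermediateField.adjoin (FractionRing F[X]) (Set.range (coord W)) = ⊤ := by
    apply IntermediateField.map_injective K.val
    rw [IntermediateField.adjoin_map, ← Set.range_comp, ← AlgHom.fieldRange_eq_map,
      IntermediateField.fieldRange_val]
    conv_rhs => rw [hK]
    congr 2
    exact funext hcW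
  have hWfrob' : frobT K W = mapLeft (incl F (FractionRing F[X]) K)
      (tev (algebraMap F[X] (FractionRing F[X]) X) g) * W := by
    rw [hWfrob, mapLeft_tev, IsScalarTower.algebraMap_apply F[X] (FractionRing F[X]) K]
    rfl
  exact ⟨K, finiteDimensional_of_frobT hWu hWfrob' hgen, isGalois_of_frobT hWu hWfrob' hgen,
    aut_comm_of_frobT hWu hWfrob' hgen, W, hWu, hWfrob, hgen⟩

end Torsor

end LaurentBound

namespace LaurentBound

open scoped TensorProduct

section Iterate

variable {F : Type*} [Field F] [Fintype F] {A : Type*} [CommRing A] [Algebra F A]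
  [Module.Finite F A] {S S' : Type*} [CommRing S] [Algebra F S] [CommRing S'] [Algebra F S']

theorem coord_frobT_iterate (m : ℕ) (z : S ⊗[F] A) (i : Fin (Module.finrank F A)) :
    coord ((frobT S)^[m] z) i = coord z i ^ Fintype.card F ^ m := by
  induction m generalizing z with
  | zero => simp
  | succ m ih =>
    rw [Function.iterate_succ_apply, ih, frobT, coord_mapLeft, pow_succ' (Fintype.card F), pow_mul]
    rfl

theorem mapLeft_frobT_iterate (f : S →ₐ[F] S') (m : ℕ) (z : S ⊗[F] A) :
    mapLeft f ((frobT S)^[m] z) = (frobT S')^[m] (mapLeft f z) :=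
  (Function.Semiconj.iterate_right (mapLeft_frobT f) m) z

/-- The norm-type product `g(y) g(y^q) ⋯ g(y^(q^(m-1)))`. -/
def tnorm (g : A[X]) (m : ℕ) (y : S) : S ⊗[F] A :=
  ∏ i ∈ Finset.range m, tev (y ^ Fintype.card F ^ i) g

theorem mapLeft_tnorm (f : S →ₐ[F] S') (g : A[X]) (m : ℕ) (y : S) :
    mapLeft f (tnorm g m y) = tnorm g m (f y) := by
  simp only [tnorm, map_prod, mapLeft_tev, map_pow]

theorem frobT_iterate_eq {g : A[X]} {y : S} {V : S ⊗[F] A} (h : frobT S V = tev y g * V) (m : ℕ) :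
    (frobT S)^[m] V = tnorm g m y * V := by
  induction m with
  | zero => simp [tnorm]
  | succ m ih =>
    rw [Function.iterate_succ_apply', ih, map_mul, h, mapLeft_tnorm, ← mul_assoc]
    congr 1
    rw [tnorm, tnorm, Finset.prod_range_succ']
    simp only [pow_zero, pow_one]
    congr 1
    refine Finset.prod_congr rfl fun i _ => ?_
    rw [pow_succ' (Fintype.card F), pow_mul]
    rfl

end Iterate

section

theorem sum_re_nonneg {G : Type*} [Group G] [Fintype G] (φ : G → ℂ)
    (h : ∀ a b, φ b ≠ 0 → φ (a * b) = φ a * φ b) :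
    0 ≤ (∑ a, φ a).re := by
  by_cases hall : ∀ b, φ b ≠ 0 → φ b = 1
  · rw [Complex.re_sum]
    refine Finset.sum_nonneg fun a _ => ?_
    by_cases ha : φ a = 0
    · simp [ha]
    · simp [hall a ha]
  · push Not at hall
    obtain ⟨b, hb, hb1⟩ := hall
    have h1 : ∑ a, φ a = (∑ a, φ a) * φ b := by
      conv_lhs => rw [← Equiv.sum_comp (Equiv.mulRight b) φ]
      rw [Finset.sum_mul]
      exact Finset.sum_congr rfl fun a _ => h a b hb
    have h2 : (∑ a, φ a) * (φ b - 1) = 0 := by rw [mul_sub, mul_one, ← h1, sub_self]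
    rcases mul_eq_zero.1 h2 with h3 | h3
    · simp [h3]
    · exact absurd (sub_eq_zero.1 h3) hb1

theorem re_sum_fiber_ge {G Y : Type*} [Group G] [Fintype G] (φ : G → ℂ)
    (h : ∀ a b, φ b ≠ 0 → φ (a * b) = φ a * φ b) (hφ : ∀ a, ‖φ a‖ ≤ 1) (B : Finset Y)
    (Fr : Y → G) {R C : ℝ} (hR : 0 ≤ R)
    (hcount : ∀ τ, |(Fintype.card G * (B.filter fun y => Fr y = τ).card : ℝ) - R| ≤ C) :
    -C ≤ (∑ y ∈ B, φ (Fr y)).re := by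
  have hG : (0 : ℝ) < Fintype.card G := by exact_mod_cast Fintype.card_pos
  have h1 : ∑ y ∈ B, φ (Fr y) = ∑ τ : G, ((B.filter fun y => Fr y = τ).card : ℂ) * φ τ := by
    rw [← Finset.sum_fiberwise B Fr]
    refine Finset.sum_congr rfl fun τ _ => ?_
    rw [Finset.sum_congr rfl (g := fun _ => φ τ) fun y hy => by rw [(Finset.mem_filter.1 hy).2],
      Finset.sum_const, nsmul_eq_mul]
  have h2 : (Fintype.card G : ℝ) * (∑ y ∈ B, φ (Fr y)).re = R * (∑ τ, φ τ).re +
      ∑ τ : G, ((Fintype.card G * (B.filter fun y => Fr y = τ).card : ℝ) - R) * (φ τ).re := by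
    rw [h1, Complex.re_sum, Complex.re_sum, Finset.mul_sum, Finset.mul_sum,
      ← Finset.sum_add_distrib]
    refine Finset.sum_congr rfl fun τ _ => ?_
    rw [← Complex.ofReal_natCast, Complex.re_ofReal_mul]
    ring
  have h3 : -(Fintype.card G * C) ≤
      ∑ τ : G, ((Fintype.card G * (B.filter fun y => Fr y = τ).card : ℝ) - R) * (φ τ).re := by
    refine neg_le_of_abs_le ((Finset.abs_sum_le_sum_abs _ _).trans ?_)
    rw [← nsmul_eq_mul, ← Finset.card_univ]
    refine Finset.sum_le_card_nsmul _ _ _ fun τ _ => ?_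
    rw [abs_mul]
    have h4 := (Complex.abs_re_le_norm (φ τ)).trans (hφ τ)
    calc _ ≤ C * 1 := mul_le_mul (hcount τ) h4 (abs_nonneg _) ((abs_nonneg _).trans (hcount τ))
      _ = C := mul_one C
  have h5 := mul_nonneg hR (sum_re_nonneg φ h)
  nlinarith

end

end LaurentBound

namespace LaurentBound

open scoped TensorProduct

universe u

section

variable {F : Type u} [Field F] [Fintype F] {A : Type*} [CommRing A] [Algebra F A]
  [Module.Finite F A]

theorem isUnit_tmul_one {S : Type*} [Field S] [Algebra F S] {a : S} (ha : a ≠ 0) :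
    IsUnit (a ⊗ₜ[F] (1 : A)) := by
  refine IsUnit.of_mul_eq_one (a⁻¹ ⊗ₜ 1) ?_
  rw [Algebra.TensorProduct.tmul_mul_tmul, mul_inv_cancel₀ ha, one_mul]
  rfl

theorem frobT_iterate_tmul {S : Type*} [CommRing S] [Algebra F S] (m : ℕ) (s : S) (a : A) :
    (frobT (F := F) (A := A) S)^[m] (s ⊗ₜ a) = (s ^ Fintype.card F ^ m) ⊗ₜ a := by
  induction m with
  | zero => simp
  | succ m ih =>
    rw [Function.iterate_succ_apply', ih, Algebra.TensorProduct.map_tmul,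
      pow_succ (Fintype.card F), pow_mul]
    rfl

theorem aeval_pow_card_pow {S : Type*} [CommRing S] [Algebra F S] (y : S) (f : F[X]) (m : ℕ) :
    aeval (y ^ Fintype.card F ^ m) f = aeval y f ^ Fintype.card F ^ m := by
  induction m with
  | zero => simp
  | succ m ih =>
    have h := aeval_algHom_apply (FiniteField.frobeniusAlgHom F S) (y ^ Fintype.card F ^ m) f
    rw [ih] at h
    rw [pow_succ, pow_mul, pow_mul]
    exact h

theorem smul_frobT_iterate_eq {S K : Type*} [CommRing S] [Algebra F S] [Field K] [Algebra F K]
    (j : S →ₐ[F] K) (hj : Function.Injective j) {g : A[X]} {y s : S} {T : S ⊗[F] A} {V : K ⊗[F] A}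
    (hT : mapLeft j T = (j s ⊗ₜ[F] 1) * V) (hfrob : frobT K V = tev (j y) g * V) (m : ℕ) :
    (s ⊗ₜ 1) * (frobT S)^[m] T =
      (s ^ Fintype.card F ^ m) ⊗ₜ 1 * (tnorm g m y * T) := by
  apply mapLeft_injective j hj
  rw [map_mul, map_mul, map_mul, mapLeft_frobT_iterate, mapLeft_tnorm, hT, iterate_map_mul,
    frobT_iterate_eq hfrob, frobT_iterate_tmul, Algebra.TensorProduct.map_tmul,
    Algebra.TensorProduct.map_tmul, map_pow, map_one]
  ring

theorem tnorm_eq_of_specialization {S K Ω : Type*} [CommRing S] [Algebra F S] [Field K]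
    [Algebra F K] [Field Ω] [Algebra F Ω] (j : S →ₐ[F] K) (hj : Function.Injective j)
    (ξ : S →ₐ[F] Ω) {g : A[X]} {y s s' : S} {T T' : S ⊗[F] A} {V V' : K ⊗[F] A}
    (hV : V * V' = 1) (hT : mapLeft j T = (j s ⊗ₜ[F] 1) * V) (hT' : mapLeft j T' = (j s' ⊗ₜ[F] 1) * V')
    (hfrob : frobT K V = tev (j y) g * V) {c : A} (σ : K →ₐ[F] K)
    (hσ : mapLeft σ V = V * (1 ⊗ₜ[F] c)) (hσs : σ (j s) = j s) (m : ℕ) (δ : S → S)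
    (hδ : ∀ f, j (δ f) = σ (j f)) (hξ : ∀ f, ξ f ^ Fintype.card F ^ m = ξ (δ f))
    (hs : ξ s ≠ 0) (hs' : ξ s' ≠ 0) (hsQ : ξ s ^ Fintype.card F ^ m = ξ s) :
    tnorm g m (ξ y) = 1 ⊗ₜ[F] c := by
  have hTT : T * T' = (s * s') ⊗ₜ 1 := mapLeft_injective j hj <| by
    rw [map_mul, hT, hT', Algebra.TensorProduct.map_tmul, map_one,
      mul_mul_mul_comm, hV, mul_one, Algebra.TensorProduct.tmul_mul_tmul, map_mul, one_mul]
  have hWu : IsUnit (mapLeft ξ T) := by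
    have h1 := congrArg (mapLeft ξ) hTT
    rw [map_mul, Algebra.TensorProduct.map_tmul, map_one, map_mul] at h1
    exact isUnit_of_mul_isUnit_left (h1 ▸ isUnit_tmul_one (mul_ne_zero hs hs'))
  have hE2 := congrArg (mapLeft ξ) (smul_frobT_iterate_eq j hj hT hfrob m)
  rw [map_mul, map_mul, map_mul, mapLeft_frobT_iterate, mapLeft_tnorm,
    Algebra.TensorProduct.map_tmul, Algebra.TensorProduct.map_tmul, map_pow, map_one, hsQ] at hE2
  replace hE2 := (isUnit_tmul_one hs).mul_left_cancel hE2
  have hE3 : (frobT Ω)^[m] (mapLeft ξ T) = mapLeft ξ T * 1 ⊗ₜ[F] c := by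
    refine coord_ext fun i => ?_
    have h1 := coord_mapLeft ξ (T * 1 ⊗ₜ[F] c) i
    rw [map_mul, Algebra.TensorProduct.map_tmul, map_one] at h1
    refine Eq.trans ?_ h1.symm
    rw [coord_frobT_iterate, coord_mapLeft]
    refine (hξ _).trans (congrArg ξ (hj ?_))
    have h2 := coord_mapLeft j (T * 1 ⊗ₜ[F] c) i
    rw [map_mul, Algebra.TensorProduct.map_tmul, map_one, hT, mul_assoc] at h2
    refine Eq.trans ?_ h2
    have h3 := congrArg (mapLeft σ) hT
    rw [map_mul, hσ, Algebra.TensorProduct.map_tmul, map_one, hσs] at h3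
    refine Eq.trans ?_ (congrArg (fun z => coord z i) h3)
    rw [hδ, ← coord_mapLeft j T i]
    exact (coord_mapLeft σ _ i).symm
  rw [hE3, mul_comm] at hE2
  exact (hWu.mul_right_cancel hE2).symm

/-- One-sided bound for character sums of the norm-type products of a monic `g`. -/
theorem tnorm_sum_ge {g : A[X]} (hg : g.Monic) (hdeg : g.natDegree = Fintype.card F - 1)
    (Ω : Type*) [Field Ω] [IsAlgClosed Ω] [Algebra F Ω] (ψ : A → ℂ) (hψ1 : ∀ a, ‖ψ a‖ ≤ 1)
    (hψ : ∀ a b, ψ b ≠ 0 → ψ (a * b) = ψ a * ψ b) :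
    ∃ C n₀ : ℕ, ∀ n ≥ n₀, ∀ Y : Finset Ω, (∀ y, y ∈ Y ↔ y ^ (Fintype.card F ^ (2 * n)) = y) →
      ∀ ν : Ω → A, (∀ y ∈ Y, tnorm g (2 * n) y = 1 ⊗ₜ[F] ν y) →
        -(C * (Fintype.card F : ℝ) ^ n) ≤ (∑ y ∈ Y, ψ (ν y)).re := by
  obtain ⟨K, hfin, hgal, hcomm, V, hV, hfrob, hgen⟩ := exists_galois_torsor hg hdeg
  have hfrob' : frobT K V = mapLeft (incl F (FractionRing F[X]) K)
      (tev (algebraMap F[X] (FractionRing F[X]) X) g) * V := by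
    rw [hfrob, mapLeft_tev, IsScalarTower.algebraMap_apply F[X] (FractionRing F[X]) K]
    rfl
  -- the homomorphism from the Galois group to `A`
  choose c hc using exists_mapLeft_aut_eq hV hfrob'
  have hinj : Function.Injective fun a : A => (1 : K) ⊗ₜ[F] a :=
    Algebra.TensorProduct.includeRight_injective (algebraMap F K).injective
  have hcmul : ∀ σ τ, c (σ * τ) = c σ * c τ := fun σ τ => hinj <| by
    have h1 := mapLeft_mul_aut (hc σ) (hc τ)
    rw [hc] at h1
    exact hV.mul_left_cancel h1
  -- denominators
  obtain ⟨V', hV'⟩ := hV.exists_right_inv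
  let O := integralClosure F[X] K
  have hden : ∀ Z : K ⊗[F] A, ∃ s : F[X], s ≠ 0 ∧ ∃ T : O ⊗[F] A,
      mapLeft (O.val.restrictScalars F) T = (algebraMap F[X] K s ⊗ₜ 1) * Z := by
    intro Z
    have halg : ∀ i, IsAlgebraic F[X] (coord Z i) := fun i =>
      (IsFractionRing.isAlgebraic_iff F[X] (FractionRing F[X]) K).2
        (Algebra.IsAlgebraic.isAlgebraic _)
    choose d hd hdi using fun i => (halg i).exists_integral_multiple
    have hintg : ∀ i, IsIntegral F[X] ((∏ j, d j) • coord Z i) := fun i => by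
      rw [← Finset.prod_erase_mul _ _ (Finset.mem_univ i), mul_smul]
      exact (hdi i).smul _
    refine ⟨∏ i, d i, Finset.prod_ne_zero_iff.2 fun i _ => hd i,
      ∑ i, (⟨_, hintg i⟩ : O) ⊗ₜ cbasis F A i, ?_⟩
    conv_rhs => rw [← sum_coord Z, Finset.mul_sum]
    rw [map_sum]
    refine Finset.sum_congr rfl fun i _ => ?_
    rw [Algebra.TensorProduct.tmul_mul_tmul, one_mul, Algebra.TensorProduct.map_tmul,
      ← Algebra.smul_def]
    rfl
  obtain ⟨s, hs, T, hT⟩ := hden V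
  obtain ⟨s', hs', T', hT'⟩ := hden V'
  obtain ⟨C, n₀, Δ, hΔ, hdvd, H⟩ := galois_equidistribution (F := F) (k := FractionRing F[X])
    (K := K) K.val.toRingHom (fun f => by
      rw [IsScalarTower.algebraMap_apply F[X] (FractionRing F[X]) K]
      exact (IsScalarTower.algebraMap_apply F[X] (FractionRing F[X]) (Inf F) f).symm) hcomm Ω (mul_ne_zero hs hs')
  refine ⟨C + Δ.natDegree, n₀ + 1, fun n hn Y hY ν hν => ?_⟩
  obtain ⟨B, Fr, hB, hx, hcard, hcount⟩ := H n (by omega)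
  have hBY : B ⊆ Y := fun y hy => (hY y).2 ((hB y).1 hy).1
  have hκ : ∀ y ∈ B, ν y = c (Fr y) := by
    intro y hy
    obtain ⟨x, hx1, hx2⟩ := hx y hy
    obtain ⟨hyQ, hyΔ⟩ := (hB y).1 hy
    set ξ : O →ₐ[F] Ω := ⟨x, fun a => by
      have h1 : algebraMap F O a = algebraMap F[X] O (algebraMap F F[X] a) :=
        Subtype.ext (IsScalarTower.algebraMap_apply F F[X] K a)
      have h2 := hx1 (algebraMap F F[X] a)
      rw [← h1, Polynomial.algebraMap_eq, aeval_C] at h2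
      exact h2⟩ with hξ
    have hξ1 : ∀ f, ξ (algebraMap F[X] O f) = aeval y f := hx1
    have hyE : aeval y (s * s') ≠ 0 := fun h0 => hyΔ <| by
      obtain ⟨e, rfl⟩ := hdvd
      rw [map_mul, h0, zero_mul]
    rw [map_mul] at hyE
    have hσs : (Fr y : K →ₐ[FractionRing F[X]] K) (algebraMap F[X] K s) = algebraMap F[X] K s := by
      rw [IsScalarTower.algebraMap_apply F[X] (FractionRing F[X]) K]
      exact (Fr y).commutes _
    have key := tnorm_eq_of_specialization (S := O) (O.val.restrictScalars F)
      Subtype.val_injective ξ (y := algebraMap F[X] O X) (s := algebraMap F[X] O s)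
      (s' := algebraMap F[X] O s') hV' hT hT' hfrob
      ((Fr y : K →ₐ[FractionRing F[X]] K).restrictScalars F) (hc (Fr y)) hσs (2 * n)
      (fun f => Fr y • f) (fun f => rfl) hx2 (by rw [hξ1]; exact left_ne_zero_of_mul hyE)
      (by rw [hξ1]; exact right_ne_zero_of_mul hyE)
      (by rw [hξ1, ← aeval_pow_card_pow, hyQ])
    rw [hξ1, aeval_X] at key
    have hinjΩ : Function.Injective fun a : A => (1 : Ω) ⊗ₜ[F] a :=
      Algebra.TensorProduct.includeRight_injective (algebraMap F Ω).injective
    exact hinjΩ ((hν y (hBY hy)).symm.trans key)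
  have hmain : -(C * (Fintype.card F : ℝ) ^ n) ≤ (∑ y ∈ B, ψ (ν y)).re := by
    rw [Finset.sum_congr rfl fun y hy => by rw [hκ y hy]]
    exact re_sum_fiber_ge (fun τ => ψ (c τ)) (fun a b hb => by rw [hcmul, hψ _ _ hb])
      (fun a => hψ1 _) B Fr (by positivity) hcount
  have hrest : -(Δ.natDegree : ℝ) ≤ (∑ y ∈ Y \ B, ψ (ν y)).re := by
    have hYcard : Y.card ≤ Fintype.card F ^ (2 * n) := by
      have hQ : 1 < Fintype.card F ^ (2 * n) := by
        exact Nat.one_lt_pow (by omega) Fintype.one_lt_card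
      have h1 : Y ⊆ (X ^ Fintype.card F ^ (2 * n) - X : Polynomial Ω).roots.toFinset := by
        intro y hy
        rw [Multiset.mem_toFinset, mem_roots (FiniteField.X_pow_card_sub_X_ne_zero Ω hQ)]
        simp [(hY y).1 hy]
      calc _ ≤ _ := Finset.card_le_card h1
        _ ≤ _ := Multiset.toFinset_card_le _
        _ ≤ _ := card_roots' _
        _ = _ := FiniteField.X_pow_card_sub_X_natDegree_eq Ω hQ
    have h2 : (Y \ B).card ≤ Δ.natDegree := by
      rw [Finset.card_sdiff_of_subset hBY]
      omega
    refine neg_le_of_abs_le ((Complex.abs_re_le_norm _).trans ((norm_sum_le _ _).trans ?_))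
    calc _ ≤ ∑ y ∈ Y \ B, (1 : ℝ) := Finset.sum_le_sum fun _ _ => hψ1 _
      _ ≤ _ := by
        rw [Finset.sum_const, nsmul_eq_mul, mul_one]
        exact_mod_cast h2
  have hq : (1 : ℝ) ≤ (Fintype.card F : ℝ) ^ n :=
    one_le_pow₀ (by exact_mod_cast Fintype.card_pos)
  rw [← Finset.sum_sdiff hBY, Complex.add_re]
  push_cast
  nlinarith [Nat.cast_nonneg (α := ℝ) Δ.natDegree]

end

end LaurentBound

namespace LaurentBound

open scoped TensorProduct

section

variable {k : Type*} [Field k] [Fintype k] {A : Type*} [CommRing A] [Algebra k A]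
  [Module.Finite k A] {Ω : Type*} [Field Ω] [Algebra k Ω]

/-- The factor `a - x b` of the norm form. -/
def lfac (a b : A) (x : Ω) : Ω ⊗[k] A := 1 ⊗ₜ a - x ⊗ₜ b

theorem mapLeft_lfac {S : Type*} [Field S] [Algebra k S] (f : Ω →ₐ[k] S) (a b : A) (x : Ω) :
    mapLeft f (lfac (k := k) a b x) = lfac a b (f x) := by
  simp [lfac, Algebra.TensorProduct.map_tmul]

/-- The norm form `∏_{i<m} (a - x^(q^i) b)`. -/
def lnorm (a b : A) (m : ℕ) (x : Ω) : Ω ⊗[k] A :=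
  ∏ i ∈ Finset.range m, lfac a b (x ^ Fintype.card k ^ i)

theorem pow_card_pow_period {r : ℕ} {x : Ω} (hx : x ^ Fintype.card k ^ r = x) (n i : ℕ) :
    x ^ Fintype.card k ^ (r * n + i) = x ^ Fintype.card k ^ i := by
  induction n with
  | zero => simp
  | succ n ih =>
    rw [show r * (n + 1) + i = r + (r * n + i) by ring, pow_add, pow_mul, hx, ih]

theorem lnorm_mul {a b : A} {r : ℕ} {x : Ω} (hx : x ^ Fintype.card k ^ r = x) (n : ℕ) :
    lnorm (k := k) a b (r * n) x = lnorm a b r x ^ n := by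
  induction n with
  | zero => simp [lnorm]
  | succ n ih =>
    rw [pow_succ, ← ih, Nat.mul_succ, lnorm, Finset.prod_range_add]
    congr 1
    exact Finset.prod_congr rfl fun i _ => by rw [pow_card_pow_period hx]

theorem frobT_lnorm {a b : A} {r : ℕ} {x : Ω} (hx : x ^ Fintype.card k ^ r = x) :
    frobT Ω (lnorm (k := k) a b r x) = lnorm a b r x := by
  have h0 : frobT Ω (lnorm (k := k) a b r x) = lnorm a b r (x ^ Fintype.card k) := by
    rw [lnorm, map_prod]
    refine Finset.prod_congr rfl fun i _ => ?_
    rw [frobT, mapLeft_lfac]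
    congr 1
    change (x ^ _) ^ _ = _
    rw [← pow_mul, ← pow_mul, mul_comm]
  rw [h0]
  cases r with
  | zero => simp [lnorm]
  | succ r =>
    rw [lnorm, lnorm, Finset.prod_range_succ, Finset.prod_range_succ']
    congr 1
    · exact Finset.prod_congr rfl fun i _ => by rw [pow_succ' (Fintype.card k), pow_mul]
    · rw [← pow_mul, ← pow_succ', hx, pow_zero, pow_one]

theorem isUnit_lnorm {a b : A} {r : ℕ} {x : Ω} (h : IsUnit (lfac (k := k) a b x)) :
    IsUnit (lnorm (k := k) a b r x) := by
  rw [lnorm]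
  refine Finset.prod_induction _ IsUnit (fun _ _ => IsUnit.mul) isUnit_one fun i hi => ?_
  clear hi
  induction i with
  | zero => simpa using h
  | succ i ih =>
    have h1 := ih.map (mapLeft (A := A) (FiniteField.frobeniusAlgHom k Ω))
    rw [mapLeft_lfac] at h1
    rw [pow_succ (Fintype.card k), pow_mul]
    exact h1

theorem exists_pow_card_pow_eq [Algebra.IsAlgebraic k Ω] (x : Ω) :
    ∃ r, 0 < r ∧ x ^ Fintype.card k ^ r = x := by
  have hx : IsIntegral k x := Algebra.IsIntegral.isIntegral x
  have : FiniteDimensional k (IntermediateField.adjoin k {x}) :=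
    IntermediateField.adjoin.finiteDimensional hx
  have : Finite (IntermediateField.adjoin k {x}) := Module.finite_of_finite k
  have := Fintype.ofFinite (IntermediateField.adjoin k {x})
  refine ⟨Module.finrank k (IntermediateField.adjoin k {x}), Module.finrank_pos, ?_⟩
  have h := FiniteField.pow_card (IntermediateField.AdjoinSimple.gen k x)
  rw [Module.card_eq_pow_finrank (K := k)] at h
  have := congrArg Subtype.val h
  simpa using this

theorem exists_lnorm_eq_one [IsAlgClosed Ω] [Algebra.IsAlgebraic k Ω] (a b : A)
    {w : A[X]} {d : k[X]} (hd : d ≠ 0) (hw : (C a - C b * X) * w = d.map (algebraMap k A)) :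
    ∃ (x : Ω) (J : ℕ), 0 < J ∧ x ^ Fintype.card k ^ J = x ∧ lnorm (k := k) a b J x = 1 := by
  obtain ⟨x, hx⟩ : ∃ x : Ω, aeval x d ≠ 0 := by
    by_contra! h
    have h1 : d.map (algebraMap k Ω) = 0 := Polynomial.funext fun x => by
      rw [eval_map_algebraMap, h, eval_zero]
    exact hd ((Polynomial.map_eq_zero _).1 h1)
  have hu : IsUnit (lfac (k := k) a b x) := by
    have h1 := congrArg (tev (F := k) x) hw
    have h2 : tev (F := k) x (d.map (algebraMap k A)) = aeval x d ⊗ₜ 1 := by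
      have h3 := aeval_algHom_apply
        (Algebra.TensorProduct.includeLeft : Ω →ₐ[k] Ω ⊗[k] A) x d
      refine Eq.trans ?_ h3
      rw [tev, coe_eval₂RingHom, eval₂_map, aeval_def]
      congr 1
      exact (Algebra.TensorProduct.includeRight : A →ₐ[k] Ω ⊗[k] A).comp_algebraMap
    rw [map_mul, map_sub, map_mul, tev_C, tev_C, tev_X, Algebra.TensorProduct.tmul_mul_tmul,
      one_mul, mul_one, h2] at h1
    exact isUnit_of_mul_isUnit_left (h1 ▸ isUnit_tmul_one hx)
  obtain ⟨r, hr, hxr⟩ := exists_pow_card_pow_eq (k := k) x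
  obtain ⟨a₀, ha₀⟩ := exists_of_frobT_eq _ (frobT_lnorm (a := a) (b := b) hxr)
  have hN := isUnit_lnorm (r := r) hu
  have : Finite A := Module.finite_of_finite k
  obtain ⟨m, n, hmn, he⟩ : ∃ m n : ℕ, m < n ∧ a₀ ^ m = a₀ ^ n := by
    obtain ⟨m, n, hne, he⟩ := Finite.exists_ne_map_eq_of_infinite fun n : ℕ => a₀ ^ n
    rcases lt_or_gt_of_ne hne with h | h
    · exact ⟨m, n, h, he⟩
    · exact ⟨n, m, h, he.symm⟩
  have h3 : lnorm (k := k) a b r x ^ (n - m) = 1 := by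
    refine (hN.pow m).mul_left_cancel ?_
    rw [← pow_add, Nat.add_sub_cancel' hmn.le, mul_one, ha₀, Algebra.TensorProduct.tmul_pow,
      Algebra.TensorProduct.tmul_pow, he, one_pow, one_pow]
  refine ⟨x, r * (n - m), Nat.mul_pos hr (Nat.sub_pos_of_lt hmn), ?_, ?_⟩
  · simpa using pow_card_pow_period hxr (n - m) 0
  · rw [lnorm_mul hxr, h3]

end

end LaurentBound

namespace LaurentBound

open scoped TensorProduct

section

variable (k : Type*) [Field k] [Fintype k] (Ω : Type*) [Field Ω] [Algebra k Ω]

/-- The field of solutions of `x^(q^J) = x`. -/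
def fixedFrob (J : ℕ) : IntermediateField k Ω :=
  { RingHom.eqLocusField ((FiniteField.frobeniusAlgHom k Ω ^ J : Ω →ₐ[k] Ω) : Ω →+* Ω)
      (RingHom.id Ω) with
    algebraMap_mem' := fun a => (FiniteField.frobeniusAlgHom k Ω ^ J).commutes a }

variable {k Ω}

theorem mem_fixedFrob {J : ℕ} {x : Ω} : x ∈ fixedFrob k Ω J ↔ x ^ Fintype.card k ^ J = x := by
  rw [← frobenius_pow_apply k J x]
  rfl

theorem card_fixedFrob [IsAlgClosed Ω] {J : ℕ} (hJ : 0 < J) :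
    Nat.card (fixedFrob k Ω J) = Fintype.card k ^ J := by
  have hq : 1 < Fintype.card k ^ J := Nat.one_lt_pow hJ.ne' Fintype.one_lt_card
  set f : Polynomial Ω := X ^ Fintype.card k ^ J - X with hf
  have hsep : f.Separable := by
    obtain ⟨p, hp⟩ := CharP.exists k
    obtain ⟨m, hpp, hm⟩ := FiniteField.card k p
    have : CharP Ω p := charP_of_injective_algebraMap (algebraMap k Ω).injective p
    refine galois_poly_separable p _ ?_
    rw [hm, ← pow_mul]
    exact dvd_pow_self _ (Nat.mul_ne_zero m.ne_zero hJ.ne')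
  have h1 := card_rootSet_eq_natDegree (K := Ω) hsep (IsAlgClosed.splits _)
  rw [FiniteField.X_pow_card_sub_X_natDegree_eq Ω hq] at h1
  rw [← h1, ← Nat.card_eq_fintype_card]
  refine Nat.card_congr (Equiv.subtypeEquivRight fun x => ?_)
  rw [mem_fixedFrob, mem_rootSet_of_ne (FiniteField.X_pow_card_sub_X_ne_zero Ω hq)]
  simp [sub_eq_zero]

end

end LaurentBound

namespace LaurentBound

open scoped TensorProduct

section

variable {k : Type*} [Field k] [Fintype k] {A : Type*} [CommRing A] [Algebra k A]
  [Module.Finite k A] {F : Type*} [Field F] [Algebra k F]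

/-- The polynomial `∏_{i<J} (x^(q^i) (a - c^(q^i) b) - b)`, a twist of the norm form. -/
def twistPoly (a b : A) (J : ℕ) (c : F) : (F ⊗[k] A)[X] :=
  ∏ i ∈ Finset.range J,
    (C (lfac (k := k) a b (c ^ Fintype.card k ^ i)) * X ^ Fintype.card k ^ i - C (1 ⊗ₜ[k] b))

theorem twistPoly_degree (a b : A) (J : ℕ) (c : F) :
    (twistPoly (k := k) a b J c).natDegree ≤ ∑ i ∈ Finset.range J, Fintype.card k ^ i ∧
    (twistPoly (k := k) a b J c).coeff (∑ i ∈ Finset.range J, Fintype.card k ^ i) =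
      lnorm (k := k) a b J c := by
  induction J with
  | zero => simp [twistPoly, lnorm]
  | succ J ih =>
    have h1 : ∀ j, 0 < j → ∀ u v : F ⊗[k] A, (C u * X ^ j - C v).natDegree ≤ j ∧
        (C u * X ^ j - C v).coeff j = u := by
      intro j hj u v
      refine ⟨natDegree_sub_C.le.trans (natDegree_C_mul_X_pow_le _ _), ?_⟩
      rw [coeff_sub, coeff_C_mul_X_pow, if_pos rfl, coeff_C, if_neg hj.ne', sub_zero]
    have h2 := h1 (Fintype.card k ^ J) (pow_pos Fintype.card_pos _)
      (lfac (k := k) a b (c ^ Fintype.card k ^ J)) (1 ⊗ₜ[k] b)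
    rw [twistPoly, Finset.prod_range_succ, Finset.sum_range_succ]
    refine ⟨natDegree_mul_le.trans (add_le_add ih.1 h2.1), ?_⟩
    refine (coeff_mul_add_eq_of_natDegree_le ih.1 h2.1).trans ?_
    rw [h2.2]
    exact (congrArg (· * _) ih.2).trans (Finset.prod_range_succ _ _).symm

theorem geom_sum_le_card_pow (J : ℕ) :
    ∑ i ∈ Finset.range J, Fintype.card k ^ i ≤ Fintype.card k ^ J - 1 :=
  Nat.le_sub_one_of_lt (Nat.geomSum_lt Fintype.one_lt_card fun _ hi => Finset.mem_range.1 hi)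

/-- The monic polynomial of degree `q^J - 1` attached to `twistPoly`. -/
def torsorPoly (a b : A) (J : ℕ) (c : F) : (F ⊗[k] A)[X] :=
  X ^ (Fintype.card k ^ J - 1 - ∑ i ∈ Finset.range J, Fintype.card k ^ i) * twistPoly a b J c

theorem torsorPoly_monic [Nontrivial A] {a b : A} {J : ℕ} {c : F}
    (h : lnorm (k := k) a b J c = 1) :
    (torsorPoly (k := k) a b J c).Monic ∧
      (torsorPoly (k := k) a b J c).natDegree = Fintype.card k ^ J - 1 := by
  have : Nontrivial (F ⊗[k] A) :=
    (Algebra.TensorProduct.includeRight_injective (R := k) (A := F) (B := A)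
      (algebraMap k F).injective).nontrivial
  obtain ⟨h1, h2⟩ := twistPoly_degree (k := k) a b J c
  rw [h] at h2
  have h3 := monic_of_natDegree_le_of_coeff_eq_one _ h1 h2
  have h4 : (twistPoly (k := k) a b J c).natDegree =
      ∑ i ∈ Finset.range J, Fintype.card k ^ i :=
    natDegree_eq_of_le_of_coeff_ne_zero h1 (h2 ▸ one_ne_zero)
  refine ⟨(monic_X_pow _).mul h3, ?_⟩
  rw [torsorPoly, (monic_X_pow _).natDegree_mul h3, natDegree_X_pow, h4,
    Nat.sub_add_cancel (geom_sum_le_card_pow J)]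

variable {Ω : Type*} [Field Ω] [Algebra k Ω] [Algebra F Ω] [IsScalarTower k F Ω]

theorem lfac_pow_add (a b : A) (x y : Ω) (i : ℕ) :
    lfac (k := k) a b ((x + y) ^ Fintype.card k ^ i) =
      lfac a b (x ^ Fintype.card k ^ i) - (y ^ Fintype.card k ^ i) ⊗ₜ b := by
  rw [← frobenius_pow_apply k i (x + y), map_add, frobenius_pow_apply, frobenius_pow_apply, lfac,
    lfac, TensorProduct.add_tmul]
  ring

theorem cancel_tmul (z : Ω) (u : F ⊗[k] A) :
    Algebra.TensorProduct.cancelBaseChange k F Ω Ω A (z ⊗ₜ[F] u) =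
      (z ⊗ₜ[k] 1) * mapLeft (IsScalarTower.toAlgHom k F Ω) u := by
  induction u with
  | zero => simp
  | add u v hu hv => rw [TensorProduct.tmul_add, map_add, hu, hv, map_add, mul_add]
  | tmul s a =>
    rw [Algebra.TensorProduct.cancelBaseChange_tmul, mapLeft]
    simp [Algebra.TensorProduct.map_tmul, Algebra.TensorProduct.tmul_mul_tmul, Algebra.smul_def,
      mul_comm]

theorem cancel_tev_factor (a b : A) (c : F) {z : Ω} (hz : z ≠ 0) (i : ℕ) :
    Algebra.TensorProduct.cancelBaseChange k F Ω Ω A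
      (tev z (C (lfac (k := k) a b (c ^ Fintype.card k ^ i)) * X ^ Fintype.card k ^ i -
        C (1 ⊗ₜ[k] b))) =
      (z ^ Fintype.card k ^ i) ⊗ₜ[k] 1 *
        lfac a b ((algebraMap F Ω c + z⁻¹) ^ Fintype.card k ^ i) := by
  rw [map_sub, map_mul, tev_C, tev_C, map_pow, tev_X, tmul_pow_one, mul_comm,
    Algebra.TensorProduct.tmul_mul_tmul, mul_one, one_mul, map_sub, cancel_tmul, cancel_tmul,
    mapLeft_lfac, lfac_pow_add, mul_sub, Algebra.TensorProduct.tmul_mul_tmul, ← mul_pow,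
    mul_inv_cancel₀ hz, one_pow, map_pow]
  congr 1
  simp [mapLeft, Algebra.TensorProduct.map_tmul]

theorem tmul_one_prod {ι : Type*} (s : Finset ι) (f : ι → Ω) :
    ∏ i ∈ s, (f i ⊗ₜ[k] (1 : A)) = (∏ i ∈ s, f i) ⊗ₜ[k] 1 :=
  (map_prod (Algebra.TensorProduct.includeLeft : Ω →ₐ[k] Ω ⊗[k] A) f s).symm

theorem cancel_tev_torsorPoly (a b : A) (J : ℕ) (c : F) {z : Ω} (hz : z ≠ 0) :
    Algebra.TensorProduct.cancelBaseChange k F Ω Ω A (tev z (torsorPoly (k := k) a b J c)) =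
      (z ^ (Fintype.card k ^ J - 1)) ⊗ₜ[k] 1 * lnorm a b J (algebraMap F Ω c + z⁻¹) := by
  have h1 : z ^ (Fintype.card k ^ J - 1) =
      z ^ (Fintype.card k ^ J - 1 - ∑ i ∈ Finset.range J, Fintype.card k ^ i) *
        ∏ i ∈ Finset.range J, z ^ Fintype.card k ^ i := by
    rw [Finset.prod_pow_eq_pow_sum, ← pow_add, Nat.sub_add_cancel (geom_sum_le_card_pow J)]
  rw [torsorPoly, twistPoly, map_mul, map_mul, map_pow, tev_X, tmul_pow_one, map_prod, map_prod,
    Finset.prod_congr rfl fun i _ => cancel_tev_factor a b c hz i, Finset.prod_mul_distrib,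
    tmul_one_prod, cancel_tmul, map_one, mul_one, ← mul_assoc, h1,
    Algebra.TensorProduct.tmul_mul_tmul, mul_one]
  rfl

variable [Fintype F]

theorem cancel_tnorm_torsorPoly (a b : A) {J : ℕ} (hF : Fintype.card F = Fintype.card k ^ J) (c : F)
    {z : Ω} (hz : z ≠ 0) {m : ℕ} (hm : z ^ Fintype.card F ^ m = z) :
    Algebra.TensorProduct.cancelBaseChange k F Ω Ω A (tnorm (torsorPoly (k := k) a b J c) m z) =
      lnorm a b (J * m) (algebraMap F Ω c + z⁻¹) := by
  have key : ∀ n, Algebra.TensorProduct.cancelBaseChange k F Ω Ω A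
      (tnorm (torsorPoly (k := k) a b J c) n z) =
      (z ^ (Fintype.card F ^ n - 1)) ⊗ₜ[k] 1 * lnorm a b (J * n) (algebraMap F Ω c + z⁻¹) := by
    intro n
    induction n with
    | zero => simp [tnorm, lnorm]; rfl
    | succ n ih =>
      have hc : c ^ Fintype.card F ^ n = c := FiniteField.pow_card_pow n c
      have e1 : Fintype.card F ^ n - 1 + Fintype.card F ^ n * (Fintype.card k ^ J - 1) =
          Fintype.card F ^ (n + 1) - 1 := by
        rw [← hF, Nat.mul_sub, ← pow_succ, mul_one]
        have := Nat.pow_le_pow_right (Fintype.card_pos (α := F)) (Nat.le_succ n)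
        have := pow_pos (Fintype.card_pos (α := F)) n
        simp only [Nat.succ_eq_add_one] at *
        omega
      have e2 : algebraMap F Ω c + (z ^ Fintype.card F ^ n)⁻¹ =
          (algebraMap F Ω c + z⁻¹) ^ Fintype.card k ^ (J * n) := by
        rw [pow_mul, ← hF, ← frobenius_pow_apply F n, ← frobenius_pow_apply F n, map_add, map_inv₀,
          AlgHom.commutes]
      rw [tnorm, Finset.prod_range_succ, map_mul, cancel_tev_torsorPoly a b J c (pow_ne_zero _ hz),
        ← tnorm, ih, mul_mul_mul_comm, Algebra.TensorProduct.tmul_mul_tmul, mul_one, ← pow_mul,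
        ← pow_add, e1, e2, Nat.mul_succ, lnorm, lnorm, lnorm, Finset.prod_range_add]
      simp only [← pow_mul, ← pow_add]
  rw [key]
  have : z ^ (Fintype.card F ^ m - 1) = 1 := by
    refine mul_right_cancel₀ hz ?_
    rw [← pow_succ, Nat.sub_add_cancel (pow_pos Fintype.card_pos m), hm, one_mul]
  rw [this]
  exact one_mul _

end

end LaurentBound

namespace LaurentBound

open scoped TensorProduct

section

variable {k : Type*} [Field k] [Fintype k] {A : Type*} [CommRing A] [Algebra k A]
  [Module.Finite k A]

/-- Extension by zero of a character of `A` to `F ⊗ A`. -/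
def extChar (F : Type*) [Field F] [Algebra k F] (χ : MulChar A ℂ) (t : F ⊗[k] A) : ℂ :=
  if h : ∃ a : A, t = 1 ⊗ₜ a then χ h.choose else 0

section

variable {F : Type*} [Field F] [Algebra k F] (χ : MulChar A ℂ)

theorem one_tmul_injective : Function.Injective fun a : A => (1 : F) ⊗ₜ[k] a :=
  Algebra.TensorProduct.includeRight_injective (R := k) (A := F) (B := A) (algebraMap k F).injective

theorem extChar_one_tmul (a : A) : extChar (k := k) F χ (1 ⊗ₜ a) = χ a := by
  have h : ∃ a' : A, (1 : F) ⊗ₜ[k] a = 1 ⊗ₜ a' := ⟨a, rfl⟩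
  rw [extChar, dif_pos h, ← one_tmul_injective h.choose_spec]

theorem norm_extChar_le (hχ : ∀ a, ‖χ a‖ ≤ 1) (t : F ⊗[k] A) : ‖extChar F χ t‖ ≤ 1 := by
  rw [extChar]
  split_ifs
  · exact hχ _
  · simp

theorem extChar_mul (s t : F ⊗[k] A) (ht : extChar F χ t ≠ 0) :
    extChar F χ (s * t) = extChar F χ s * extChar F χ t := by
  by_cases h : ∃ a : A, t = 1 ⊗ₜ a
  swap
  · exact absurd (dif_neg h) ht
  obtain ⟨b, rfl⟩ := h
  rw [extChar_one_tmul] at ht ⊢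
  by_cases hs : ∃ a : A, s = 1 ⊗ₜ a
  · obtain ⟨a, rfl⟩ := hs
    rw [Algebra.TensorProduct.tmul_mul_tmul, one_mul, extChar_one_tmul, extChar_one_tmul, map_mul]
  · have hb : IsUnit b := by
      by_contra hb
      exact ht (χ.map_nonunit hb)
    obtain ⟨u, rfl⟩ := hb
    have : ¬ ∃ a : A, s * 1 ⊗ₜ (u : A) = 1 ⊗ₜ a := by
      rintro ⟨a, ha⟩
      refine hs ⟨a * ↑u⁻¹, ?_⟩
      have h2 := congrArg (· * (1 : F) ⊗ₜ[k] (↑u⁻¹ : A)) ha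
      simp only [mul_assoc, Algebra.TensorProduct.tmul_mul_tmul, one_mul, Units.mul_inv] at h2
      rw [← h2, ← Algebra.TensorProduct.one_def, mul_one]
    rw [extChar, dif_neg this, extChar, dif_neg hs, zero_mul]

end

/-- One-sided bound for the character sums of the norm form, in suitable extensions. -/
theorem lnorm_sum_ge [Nontrivial A] (Ω : Type*) [Field Ω] [Algebra k Ω] [IsAlgClosed Ω]
    [Algebra.IsAlgebraic k Ω] (a b : A) {w : A[X]} {d : k[X]} (hd : d ≠ 0)
    (hw : (C a - C b * X) * w = d.map (algebraMap k A)) (χ : MulChar A ℂ) (hχ : ∀ a, ‖χ a‖ ≤ 1) :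
    ∃ J C n₀ : ℕ, 0 < J ∧ ∀ n ≥ n₀, ∀ Y : Finset Ω,
      (∀ y, y ∈ Y ↔ y ^ (Fintype.card k ^ (J * (2 * n))) = y) →
      ∀ ν : Ω → A, (∀ y ∈ Y, lnorm a b (J * (2 * n)) y = 1 ⊗ₜ[k] ν y) →
        -(C * (Fintype.card k : ℝ) ^ (J * n)) ≤ (∑ y ∈ Y, χ (ν y)).re := by
  obtain ⟨c₀, J, hJ, hcJ, hc₀⟩ := exists_lnorm_eq_one (k := k) (Ω := Ω) a b hd hw
  set F := fixedFrob k Ω J with hF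
  have hcard := card_fixedFrob (k := k) (Ω := Ω) hJ
  have : Finite F := (Nat.card_pos_iff.1 (hcard ▸ pow_pos Fintype.card_pos J)).2
  have : Fintype F := Fintype.ofFinite F
  have hcard' : Fintype.card F = Fintype.card k ^ J := by rw [← hcard, Nat.card_eq_fintype_card]
  set c : F := ⟨c₀, mem_fixedFrob.2 hcJ⟩ with hcdef
  have hcc : algebraMap F Ω c = c₀ := rfl
  have hc : lnorm (k := k) a b J c = 1 := by
    refine mapLeft_injective (IsScalarTower.toAlgHom k F Ω) (algebraMap F Ω).injective ?_
    rw [map_one, lnorm, map_prod, ← hc₀, lnorm]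
    refine Finset.prod_congr rfl fun i _ => ?_
    rw [mapLeft_lfac, map_pow]
    rfl
  obtain ⟨hg, hdeg⟩ := torsorPoly_monic hc
  rw [← hcard'] at hdeg
  obtain ⟨C, n₀, h⟩ := tnorm_sum_ge hg hdeg Ω (extChar (k := k) F χ) (norm_extChar_le χ hχ)
    (fun s t => extChar_mul χ s t)
  refine ⟨J, C + 2, n₀, hJ, fun n hn Y hY ν hν => ?_⟩
  have hQ : Fintype.card F ^ (2 * n) = Fintype.card k ^ (J * (2 * n)) := by rw [hcard', ← pow_mul]
  have hY' : ∀ y, y ∈ Y ↔ y ^ (Fintype.card F ^ (2 * n)) = y := fun y => by rw [hY, hQ]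
  have h0Y : (0 : Ω) ∈ Y := by
    rw [hY, zero_pow (pow_pos Fintype.card_pos _).ne']
  have hcY : c₀ ∈ Y := by
    rw [hY]
    simpa using pow_card_pow_period hcJ (2 * n) 0
  have hadd : ∀ x ∈ Y, ∀ y ∈ Y, x + y ∈ Y := fun x hx y hy => by
    rw [hY, ← frobenius_pow_apply k, map_add, frobenius_pow_apply, frobenius_pow_apply,
      (hY x).1 hx, (hY y).1 hy]
  have hsub : ∀ x ∈ Y, ∀ y ∈ Y, x - y ∈ Y := fun x hx y hy => by
    rw [hY, ← frobenius_pow_apply k, map_sub, frobenius_pow_apply, frobenius_pow_apply,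
      (hY x).1 hx, (hY y).1 hy]
  have hinv : ∀ x ∈ Y, x⁻¹ ∈ Y := fun x hx => by
    rw [hY, inv_pow, (hY x).1 hx]
  have h1 := h n hn Y hY'
    (fun y => if y = 0 then coeff (torsorPoly (k := k) a b J c) 0 ^ (2 * n) else 1 ⊗ₜ ν (c₀ + y⁻¹))
    (by
      intro y hy
      by_cases h0 : y = 0
      · rw [if_pos h0, h0, tnorm]
        have : ∀ i ∈ Finset.range (2 * n), tev ((0 : Ω) ^ Fintype.card F ^ i)
            (torsorPoly (k := k) a b J c) =
              (1 : Ω) ⊗ₜ[F] (torsorPoly (k := k) a b J c).coeff 0 := by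
          intro i _
          rw [zero_pow (pow_pos Fintype.card_pos _).ne']
          conv_lhs => rw [← divX_mul_X_add (torsorPoly (k := k) a b J c)]
          rw [map_add, map_mul, tev_X, tev_C, TensorProduct.zero_tmul, mul_zero, zero_add]
        rw [Finset.prod_congr rfl this, Finset.prod_const, Finset.card_range,
          Algebra.TensorProduct.tmul_pow, one_pow]
      · rw [if_neg h0]
        refine (Algebra.TensorProduct.cancelBaseChange k F Ω Ω A).injective ?_
        rw [cancel_tnorm_torsorPoly a b hcard' c h0 ((hY' y).1 hy), cancel_tmul, hcc,
          hν _ (hadd _ hcY _ (hinv y hy))]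
        simp [mapLeft, Algebra.TensorProduct.map_tmul, ← Algebra.TensorProduct.one_def])
  rw [← Finset.add_sum_erase _ _ h0Y, if_pos rfl] at h1
  have h2 : ∑ y ∈ Y.erase 0, extChar (k := k) F χ
      (if y = 0 then coeff (torsorPoly (k := k) a b J c) 0 ^ (2 * n) else 1 ⊗ₜ ν (c₀ + y⁻¹)) =
      ∑ y ∈ Y.erase c₀, χ (ν y) := by
    refine Finset.sum_bij' (fun y _ => c₀ + y⁻¹) (fun y _ => (y - c₀)⁻¹) ?_ ?_ ?_ ?_ ?_
    · intro y hy
      rw [Finset.mem_erase] at hy ⊢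
      exact ⟨by simpa using hy.1, hadd _ hcY _ (hinv _ hy.2)⟩
    · intro y hy
      rw [Finset.mem_erase] at hy ⊢
      exact ⟨inv_ne_zero (sub_ne_zero.2 hy.1), hinv _ (hsub _ hy.2 _ hcY)⟩
    · intro y _
      simp
    · intro y _
      simp
    · intro y hy
      rw [if_neg (Finset.mem_erase.1 hy).1, extChar_one_tmul]
  rw [h2] at h1
  rw [← Finset.add_sum_erase _ _ hcY, Complex.add_re]
  rw [Complex.add_re, hcard'] at h1
  have h3 := (Complex.abs_re_le_norm _).trans
    (norm_extChar_le (k := k) (F := F) χ hχ (coeff (torsorPoly (k := k) a b J c) 0 ^ (2 * n)))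
  have h4 := (Complex.abs_re_le_norm _).trans (hχ (ν c₀))
  have h5 : (1 : ℝ) ≤ (Fintype.card k : ℝ) ^ (J * n) :=
    one_le_pow₀ (by exact_mod_cast Fintype.card_pos)
  push_cast at h1 ⊢
  rw [← pow_mul] at h1
  have h6 := abs_le.1 h3
  have h7 := abs_le.1 h4
  nlinarith [h6.1, h6.2, h7.1, h7.2]

end

end LaurentBound

namespace LaurentBound

section Monics

variable (k : Type*) [Field k] [Fintype k]

theorem finite_degree_lt (n : ℕ) : {f : k[X] | f.degree < n}.Finite := by
  have : Finite (degreeLT k n) := Finite.of_equiv _ (degreeLTEquiv k n).toEquiv.symm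
  convert Set.toFinite (degreeLT k n : Set k[X]) using 1
  ext f
  simp [mem_degreeLT]

/-- The polynomials of degree `< n`. -/
def lowDeg (n : ℕ) : Finset k[X] := (finite_degree_lt k n).toFinset

variable {k} in
theorem mem_lowDeg {n : ℕ} {f : k[X]} : f ∈ lowDeg k n ↔ f.degree < n := by simp [lowDeg]

theorem card_lowDeg (n : ℕ) : (lowDeg k n).card = Fintype.card k ^ n := by
  have h : (degreeLT k n : Set k[X]) = lowDeg k n := by
    ext f
    simp [mem_degreeLT, mem_lowDeg]
  rw [← Set.ncard_coe_finset, ← h, ← Nat.card_coe_set_eq,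
    SetLike.coe_sort_coe, Nat.card_congr (degreeLTEquiv k n).toEquiv, Nat.card_fun,
    Nat.card_eq_fintype_card, Nat.card_eq_fintype_card, Fintype.card_fin]

/-- The monic polynomials of degree `n`. -/
def monics (n : ℕ) : Finset k[X] := (lowDeg k (n + 1)).filter fun f => f.Monic ∧ f.natDegree = n

variable {k} in
theorem mem_monics {n : ℕ} {f : k[X]} : f ∈ monics k n ↔ f.Monic ∧ f.natDegree = n := by
  rw [monics, Finset.mem_filter, mem_lowDeg]
  refine ⟨fun h => h.2, fun h => ⟨?_, h⟩⟩
  rw [degree_eq_natDegree h.1.ne_zero, h.2]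
  exact_mod_cast Nat.lt_succ_self n

theorem card_monics (n : ℕ) : (monics k n).card = Fintype.card k ^ n := by
  rw [← card_lowDeg]
  refine Finset.card_bij' (fun f _ => f - X ^ n) (fun f _ => X ^ n + f) ?_ ?_ ?_ ?_
  · intro f hf
    rw [mem_monics] at hf
    rw [mem_lowDeg]
    have h1 : f.degree = (X ^ n : k[X]).degree := by
      rw [degree_eq_natDegree hf.1.ne_zero, hf.2, degree_X_pow]
    have h2 := degree_sub_lt_left h1 hf.1.ne_zero
      (by rw [hf.1.leadingCoeff, (monic_X_pow n).leadingCoeff])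
    rwa [h1, degree_X_pow] at h2
  · intro f hf
    rw [mem_lowDeg] at hf
    rw [mem_monics]
    refine ⟨monic_X_pow_add hf, ?_⟩
    rw [natDegree_add_eq_left_of_degree_lt (by rwa [degree_X_pow]), natDegree_X_pow]
  · simp
  · simp

/-- The monic irreducible polynomials of degree `n`. -/
def irreds (n : ℕ) : Finset k[X] := (monics k n).filter Irreducible

variable {k}

theorem mem_irreds {n : ℕ} {f : k[X]} :
    f ∈ irreds k n ↔ f.Monic ∧ f.natDegree = n ∧ Irreducible f := by
  rw [irreds, Finset.mem_filter, mem_monics, and_assoc]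

end Monics

section Newton

variable {k : Type*} [Field k] [Fintype k]

/-- A completely multiplicative function on monic polynomials, bounded by one. -/
structure MonicMul (l : k[X] → ℂ) : Prop where
  one : l 1 = 1
  mul : ∀ f g : k[X], f.Monic → g.Monic → l (f * g) = l f * l g
  norm_le : ∀ f, ‖l f‖ ≤ 1

theorem MonicMul.pow {l : k[X] → ℂ} (h : MonicMul l) {f : k[X]} (hf : f.Monic) (n : ℕ) :
    l (f ^ n) = l f ^ n := by
  induction n with
  | zero => simp [h.one]
  | succ n ih => rw [pow_succ, h.mul _ _ (hf.pow n) hf, ih, pow_succ]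

/-- The coefficients of the `L`-function of `l`. -/
def cSum (l : k[X] → ℂ) (n : ℕ) : ℂ := ∑ f ∈ monics k n, l f

/-- The coefficients of the logarithmic derivative of the `L`-function of `l`. -/
def sSum (l : k[X] → ℂ) (n : ℕ) : ℂ :=
  ∑ x ∈ n.divisorsAntidiagonal, ∑ P ∈ irreds k x.1, (x.1 : ℂ) * l P ^ x.2

theorem sum_dvd_monics {l : k[X] → ℂ} (h : MonicMul l) {Q : k[X]} (hQ : Q.Monic) {j n : ℕ}
    (hj : Q.natDegree = j) (hjn : j ≤ n) :
    ∑ f ∈ monics k n with Q ∣ f, l f = l Q * cSum l (n - j) := by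
  rw [cSum, Finset.mul_sum]
  symm
  refine Finset.sum_bij (fun g _ => Q * g) ?_ ?_ ?_ ?_
  · intro g hg
    rw [mem_monics] at hg
    rw [Finset.mem_filter, mem_monics, hQ.natDegree_mul hg.1, hg.2, hj]
    exact ⟨⟨hQ.mul hg.1, by omega⟩, dvd_mul_right _ _⟩
  · intro g _ g' _ hgg
    exact mul_left_cancel₀ hQ.ne_zero hgg
  · intro f hf
    rw [Finset.mem_filter, mem_monics] at hf
    obtain ⟨⟨hf1, hf2⟩, g, rfl⟩ := hf
    have hg : g.Monic := hQ.of_mul_monic_left hf1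
    rw [hQ.natDegree_mul hg, hj] at hf2
    exact ⟨g, mem_monics.2 ⟨hg, by omega⟩, rfl⟩
  · intro g hg
    exact (h.mul _ _ hQ (mem_monics.1 hg).1).symm

theorem sum_Icc_divisorsAntidiagonal (n : ℕ) (G : ℕ × ℕ → ℂ) :
    ∑ j ∈ Finset.Icc 1 n, ∑ x ∈ j.divisorsAntidiagonal, G x =
      ∑ x ∈ Finset.Icc 1 n ×ˢ Finset.Icc 1 n with x.1 * x.2 ≤ n, G x := by
  rw [← Finset.sum_fiberwise_of_maps_to (g := fun x : ℕ × ℕ => x.1 * x.2) (t := Finset.Icc 1 n)]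
  · refine Finset.sum_congr rfl fun j hj => Finset.sum_congr ?_ fun _ _ => rfl
    ext ⟨d, e⟩
    simp only [Nat.mem_divisorsAntidiagonal, Finset.mem_filter, Finset.mem_product,
      Finset.mem_Icc] at hj ⊢
    constructor
    · rintro ⟨rfl, h0⟩
      have hd : 0 < d := Nat.pos_of_ne_zero fun h => h0 (by simp [h])
      have he : 0 < e := Nat.pos_of_ne_zero fun h => h0 (by simp [h])
      have := Nat.le_mul_of_pos_right d he
      have := Nat.le_mul_of_pos_left e hd
      refine ⟨⟨⟨⟨hd, by omega⟩, he, by omega⟩, hj.2⟩, rfl⟩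
    · rintro ⟨_, rfl⟩
      exact ⟨rfl, by omega⟩
  · intro x hx
    simp only [Finset.mem_filter, Finset.mem_product, Finset.mem_Icc] at hx ⊢
    exact ⟨Nat.mul_pos hx.1.1.1 hx.1.2.1, hx.2⟩

theorem natDegree_eq_sum {f : k[X]} {n : ℕ} (hf : f ∈ monics k n) :
    n = ∑ x ∈ Finset.Icc 1 n ×ˢ Finset.Icc 1 n with x.1 * x.2 ≤ n,
      ∑ P ∈ irreds k x.1, if P ^ x.2 ∣ f then x.1 else 0 := by
  obtain ⟨hf, hn⟩ := mem_monics.1 hf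
  have hirr : ∀ P ∈ UniqueFactorizationMonoid.normalizedFactors f, P.Monic ∧ Irreducible P :=
    fun P hP => by
      have h1 := UniqueFactorizationMonoid.irreducible_of_normalized_factor P hP
      refine ⟨(normalize_eq_self_iff_monic h1.ne_zero).1 ?_, h1⟩
      exact UniqueFactorizationMonoid.normalize_normalized_factor P hP
  have hprod : (UniqueFactorizationMonoid.normalizedFactors f).prod = f := by
    rw [UniqueFactorizationMonoid.prod_normalizedFactors_eq hf.ne_zero, hf.normalize_eq_self]
  have h1 : n = ∑ P ∈ (UniqueFactorizationMonoid.normalizedFactors f).toFinset,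
      (UniqueFactorizationMonoid.normalizedFactors f).count P * P.natDegree := by
    have h2 := natDegree_multiset_prod_of_monic
      (UniqueFactorizationMonoid.normalizedFactors f) fun P hP => (hirr P hP).1
    rw [hprod, hn, Finset.sum_multiset_map_count] at h2
    simpa using h2
  have h2 : ∀ d ∈ Finset.Icc 1 n, ∀ P ∈ irreds k d,
      ∑ e ∈ Finset.Icc 1 n, (if d * e ≤ n then if P ^ e ∣ f then d else 0 else 0) =
        (UniqueFactorizationMonoid.normalizedFactors f).count P * d := by
    intro d hd P hP
    rw [mem_irreds] at hP
    have hc : ∀ e, P ^ e ∣ f ↔ e ≤ (UniqueFactorizationMonoid.normalizedFactors f).count P := by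
      intro e
      rw [pow_dvd_iff_le_emultiplicity,
        UniqueFactorizationMonoid.emultiplicity_eq_count_normalizedFactors hP.2.2 hf.ne_zero,
        hP.1.normalize_eq_self]
      exact Nat.cast_le
    have hle : ∀ e, P ^ e ∣ f → d * e ≤ n := by
      intro e he
      have := natDegree_le_of_dvd he hf.ne_zero
      rwa [hP.1.natDegree_pow, hP.2.1, hn, mul_comm] at this
    have h3 : ∀ e ∈ Finset.Icc 1 n, (if d * e ≤ n then if P ^ e ∣ f then d else 0 else 0) =
        if e ≤ (UniqueFactorizationMonoid.normalizedFactors f).count P then d else 0 := by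
      intro e _
      simp only [← hc]
      by_cases he : P ^ e ∣ f
      · rw [if_pos (hle e he)]
      · simp [he]
    rw [Finset.sum_congr rfl h3, ← Finset.sum_filter, Finset.sum_const, smul_eq_mul]
    congr 1
    have h4 : (Finset.Icc 1 n).filter
        (· ≤ (UniqueFactorizationMonoid.normalizedFactors f).count P) =
        Finset.Icc 1 ((UniqueFactorizationMonoid.normalizedFactors f).count P) := by
      ext e
      simp only [Finset.mem_filter, Finset.mem_Icc]
      refine ⟨fun h => ⟨h.1.1, h.2⟩, fun h => ⟨⟨h.1, ?_⟩, h.2⟩⟩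
      exact (Nat.le_mul_of_pos_left e (Finset.mem_Icc.1 hd).1).trans (hle e ((hc e).2 h.2))
    rw [h4, Nat.card_Icc, Nat.add_sub_cancel]
  rw [Finset.sum_filter, Finset.sum_product]
  have h3 : ∀ d ∈ Finset.Icc 1 n, ∑ e ∈ Finset.Icc 1 n,
      (if d * e ≤ n then ∑ P ∈ irreds k d, (if P ^ e ∣ f then d else 0) else 0) =
      ∑ P ∈ irreds k d, (UniqueFactorizationMonoid.normalizedFactors f).count P * d := by
    intro d hd
    rw [← Finset.sum_congr rfl (h2 d hd), Finset.sum_comm]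
    refine Finset.sum_congr rfl fun e _ => ?_
    split_ifs <;> simp
  rw [Finset.sum_congr rfl h3]
  refine h1.trans ?_
  rw [← Finset.sum_fiberwise_of_maps_to (g := natDegree) (t := Finset.Icc 1 n)]
  · refine Finset.sum_congr rfl fun d _ => ?_
    have h4 : ∀ P ∈ irreds k d, (UniqueFactorizationMonoid.normalizedFactors f).count P * d =
        (UniqueFactorizationMonoid.normalizedFactors f).count P * P.natDegree := by
      intro P hP
      rw [(mem_irreds.1 hP).2.1]
    rw [Finset.sum_congr rfl h4]
    refine Finset.sum_subset ?_ ?_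
    · intro P hP
      rw [Finset.mem_filter, Multiset.mem_toFinset] at hP
      exact mem_irreds.2 ⟨(hirr P hP.1).1, hP.2, (hirr P hP.1).2⟩
    · intro P hP hP'
      rw [Finset.mem_filter, Multiset.mem_toFinset, not_and] at hP'
      rw [Multiset.count_eq_zero.2 fun h => hP' h (mem_irreds.1 hP).2.1, zero_mul]
  · intro P hP
    rw [Multiset.mem_toFinset] at hP
    rw [Finset.mem_Icc, ← hn]
    exact ⟨(hirr P hP).2.natDegree_pos,
      natDegree_le_of_dvd (UniqueFactorizationMonoid.dvd_of_mem_normalizedFactors hP) hf.ne_zero⟩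

theorem newton_cSum {l : k[X] → ℂ} (h : MonicMul l) (n : ℕ) :
    n * cSum l n = ∑ j ∈ Finset.Icc 1 n, sSum l j * cSum l (n - j) := by
  have h1 : ∀ j ∈ Finset.Icc 1 n, sSum l j * cSum l (n - j) =
      ∑ x ∈ j.divisorsAntidiagonal, ∑ P ∈ irreds k x.1, ∑ f ∈ monics k n,
        if P ^ x.2 ∣ f then (x.1 : ℂ) * l f else 0 := by
    intro j hj
    rw [sSum, Finset.sum_mul]
    refine Finset.sum_congr rfl fun x hx => ?_
    rw [Finset.sum_mul]
    refine Finset.sum_congr rfl fun P hP => ?_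
    rw [mem_irreds] at hP
    have h2 := sum_dvd_monics h (hP.1.pow x.2) (j := j)
      (by rw [hP.1.natDegree_pow, hP.2.1, mul_comm, (Nat.mem_divisorsAntidiagonal.1 hx).1])
      (Finset.mem_Icc.1 hj).2
    rw [mul_assoc, ← h.pow hP.1, ← h2, Finset.sum_filter, Finset.mul_sum]
    exact Finset.sum_congr rfl fun f _ => by split_ifs <;> simp
  rw [Finset.sum_congr rfl h1, sum_Icc_divisorsAntidiagonal n fun x =>
    ∑ P ∈ irreds k x.1, ∑ f ∈ monics k n, if P ^ x.2 ∣ f then (x.1 : ℂ) * l f else 0]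
  simp_rw [Finset.sum_comm (t := monics k n)]
  rw [cSum, Finset.mul_sum]
  refine Finset.sum_congr rfl fun f hf => ?_
  conv_lhs => rw [natDegree_eq_sum hf]
  push_cast
  rw [Finset.sum_mul]
  refine Finset.sum_congr rfl fun x _ => ?_
  rw [Finset.sum_mul]
  refine Finset.sum_congr rfl fun P _ => ?_
  split_ifs <;> simp

end Newton

end LaurentBound

namespace LaurentBound

section PowerSums

open Filter Topology

theorem frequently_pow_near_one {ι : Type*} [Finite ι] (z : ι → Circle) :
    ∃ᶠ m : ℕ in atTop, ∀ i, ‖((z i : ℂ)) ^ m - 1‖ < 1 / 2 := by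
  have h := mapClusterPt_one_atTop_pow z
  rw [mapClusterPt_iff_frequently] at h
  have hs : {w : ι → Circle | ∀ i, ‖(w i : ℂ) - 1‖ < 1 / 2} ∈ 𝓝 (1 : ι → Circle) := by
    have : {w : ι → Circle | ∀ i, ‖(w i : ℂ) - 1‖ < 1 / 2} =
        ⋂ i, {w : ι → Circle | ‖(w i : ℂ) - 1‖ < 1 / 2} := by ext; simp
    rw [this]
    refine (isOpen_iInter_of_finite fun i => ?_).mem_nhds (by simp)
    exact isOpen_lt (by fun_prop) continuous_const
  exact (h _ hs).mono fun m hm i => by simpa using hm i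

theorem norm_le_of_sum_pow_re_le {ι : Type*} [Fintype ι] (θ : ι → ℂ) {C R : ℝ} (hR : 0 < R) (n₀ : ℕ)
    (h : ∀ m ≥ n₀, (∑ i, θ i ^ m).re ≤ C * R ^ m) (i : ι) : ‖θ i‖ ≤ R := by
  by_contra! hi
  choose z hz using fun i => show ∃ z : Circle, (‖θ i‖ : ℂ) * z = θ i from
    ⟨Circle.exp (θ i).arg, by rw [Circle.coe_exp, Complex.norm_mul_exp_arg_mul_I]⟩
  have hge : ∀ m : ℕ, (∀ i, ‖((z i : ℂ)) ^ m - 1‖ < 1 / 2) → ∀ i,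
      ‖θ i‖ ^ m / 2 ≤ (θ i ^ m).re := by
    intro m hm i
    have h1 : 1 / 2 ≤ ((z i : ℂ) ^ m).re := by
      have h2 := (Complex.abs_re_le_norm _).trans (hm i).le
      rw [Complex.sub_re, Complex.one_re] at h2
      linarith [(abs_le.1 h2).1]
    rw [← hz i, mul_pow, ← Complex.ofReal_pow, Complex.re_ofReal_mul, norm_mul]
    simp only [Complex.norm_real, norm_norm, Circle.norm_coe, mul_one]
    have := pow_nonneg (norm_nonneg (θ i)) m
    nlinarith
  have hlim : Tendsto (fun m : ℕ => (‖θ i‖ / R) ^ m) atTop atTop :=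
    tendsto_pow_atTop_atTop_of_one_lt ((one_lt_div hR).2 hi)
  obtain ⟨m, hm, hm1, hm2⟩ := ((frequently_pow_near_one z).and_eventually
    ((hlim.eventually_gt_atTop (2 * C)).and (eventually_ge_atTop n₀))).exists
  have h3 := h m hm2
  rw [div_pow, lt_div_iff₀ (pow_pos hR m)] at hm1
  rw [Complex.re_sum] at h3
  have h4 := Finset.single_le_sum (f := fun i => (θ i ^ m).re) (s := Finset.univ)
    (fun j _ => (by positivity : (0 : ℝ) ≤ ‖θ j‖ ^ m / 2).trans (hge m hm j)) (Finset.mem_univ i)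
  have h5 := hge m hm i
  linarith

end PowerSums

section Roots

theorem X_mul_derivative_prod (s : List ℂ) :
    PowerSeries.X * PowerSeries.derivative ℂ
      ((s.map fun ω => (1 - PowerSeries.C ω * PowerSeries.X : PowerSeries ℂ)).prod) =
    (s.map fun ω => (1 - PowerSeries.C ω * PowerSeries.X : PowerSeries ℂ)).prod *
      PowerSeries.mk fun n => if n = 0 then 0 else -(s.map fun ω => ω ^ n).sum := by
  induction s with
  | nil => simp [PowerSeries.ext_iff]
  | cons ω s ih =>
    have h1 : (1 - PowerSeries.C ω * PowerSeries.X : PowerSeries ℂ) *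
        PowerSeries.mk (fun n => if n = 0 then 0 else -ω ^ n) =
          -(PowerSeries.C ω * PowerSeries.X) := by
      ext n
      rw [sub_mul, one_mul, mul_assoc, map_sub, map_neg, PowerSeries.coeff_C_mul,
        PowerSeries.coeff_C_mul, PowerSeries.coeff_mk]
      rcases n with _ | n
      · simp
      · rw [PowerSeries.coeff_succ_X_mul, PowerSeries.coeff_mk, PowerSeries.coeff_X]
        rcases n with _ | n
        · simp
        · simp [pow_succ]
          ring
    have h2 : (PowerSeries.mk fun n => if n = 0 then 0 else
        -(((ω :: s).map fun ω => ω ^ n).sum) : PowerSeries ℂ) =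
        PowerSeries.mk (fun n => if n = 0 then 0 else -ω ^ n) +
        PowerSeries.mk fun n => if n = 0 then 0 else -(s.map fun ω => ω ^ n).sum := by
      ext n
      simp only [PowerSeries.coeff_mk, map_add, List.map_cons, List.sum_cons]
      split_ifs <;> ring
    rw [h2, List.map_cons, List.prod_cons, mul_add, mul_right_comm, h1, Derivation.leibniz]
    simp only [smul_eq_mul]
    rw [mul_add, mul_left_comm, ih]
    simp
    ring

theorem newton_prod (s : List ℂ) (n : ℕ) :
    n * PowerSeries.coeff n
      ((s.map fun ω => (1 - PowerSeries.C ω * PowerSeries.X : PowerSeries ℂ)).prod) =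
      ∑ j ∈ Finset.Icc 1 n, -(s.map fun ω => ω ^ j).sum * PowerSeries.coeff (n - j)
        ((s.map fun ω => (1 - PowerSeries.C ω * PowerSeries.X : PowerSeries ℂ)).prod) := by
  have h := congrArg (PowerSeries.coeff n) (X_mul_derivative_prod s)
  have h1 : PowerSeries.coeff n (PowerSeries.X * PowerSeries.derivative ℂ
      ((s.map fun ω => (1 - PowerSeries.C ω * PowerSeries.X : PowerSeries ℂ)).prod)) =
      n * PowerSeries.coeff n
      ((s.map fun ω => (1 - PowerSeries.C ω * PowerSeries.X : PowerSeries ℂ)).prod) := by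
    rcases n with _ | n
    · simp
    · rw [PowerSeries.coeff_succ_X_mul, PowerSeries.coeff_derivative]
      push_cast
      ring
  rw [← h1, h, mul_comm, PowerSeries.coeff_mul, Finset.Nat.sum_antidiagonal_eq_sum_range_succ
    (fun i j => PowerSeries.coeff i (PowerSeries.mk fun n => if n = 0 then 0 else
      -(s.map fun ω => ω ^ n).sum) * PowerSeries.coeff j
        ((s.map fun ω => (1 - PowerSeries.C ω * PowerSeries.X : PowerSeries ℂ)).prod)),
    Finset.sum_range_succ', PowerSeries.coeff_mk, if_pos rfl, zero_mul, add_zero,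
    ← Finset.sum_image (g := fun i => i + 1) (s := Finset.range n)
      (f := fun j => PowerSeries.coeff j (PowerSeries.mk fun n => if n = 0 then 0 else
      -(s.map fun ω => ω ^ n).sum) * PowerSeries.coeff (n - j)
        ((s.map fun ω => (1 - PowerSeries.C ω * PowerSeries.X : PowerSeries ℂ)).prod))
      (fun _ _ _ _ h => Nat.succ_injective h)]
  have h2 : (Finset.range n).image (fun i => i + 1) = Finset.Icc 1 n := by
    ext j
    simp only [Finset.mem_image, Finset.mem_range, Finset.mem_Icc]
    exact ⟨by rintro ⟨i, hi, rfl⟩; omega, fun hj => ⟨j - 1, by omega, by omega⟩⟩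
  rw [h2]
  refine Finset.sum_congr rfl fun j hj => ?_
  rw [PowerSeries.coeff_mk, if_neg (by have := (Finset.mem_Icc.1 hj).1; omega)]

/-- Newton's recursion determines the power sums. -/
theorem newton_unique {c S T : ℕ → ℂ} (hc : c 0 = 1)
    (hS : ∀ n : ℕ, n * c n = ∑ j ∈ Finset.Icc 1 n, S j * c (n - j))
    (hT : ∀ n : ℕ, n * c n = ∑ j ∈ Finset.Icc 1 n, T j * c (n - j)) (n : ℕ) (hn : 1 ≤ n) :
    S n = T n := by
  induction n using Nat.strong_induction_on with
  | _ n ih =>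
    have h := (hS n).symm.trans (hT n)
    obtain ⟨m, rfl⟩ := Nat.exists_eq_add_of_le' hn
    rw [← Finset.insert_Icc_right_eq_Icc_add_one (by omega), Finset.sum_insert (by simp),
      Finset.sum_insert (by simp), Nat.sub_self, hc, mul_one, mul_one,
      Finset.sum_congr rfl fun j hj => by
        rw [ih j (by have := Finset.mem_Icc.1 hj; omega) (Finset.mem_Icc.1 hj).1]] at h
    exact add_right_cancel h

theorem exists_list_prod (L : ℂ[X]) (hL : L.coeff 0 = 1) : ∃ s : List ℂ,
    s.length = L.natDegree ∧
    (L : PowerSeries ℂ) =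
      (s.map fun ω => (1 - PowerSeries.C ω * PowerSeries.X : PowerSeries ℂ)).prod := by
  have hL0 : L ≠ 0 := by
    rintro rfl
    simp at hL
  have hs := IsAlgClosed.splits L
  have h0 : (0 : ℂ) ∉ L.roots := by
    rw [mem_roots hL0, IsRoot, ← coeff_zero_eq_eval_zero, hL]
    exact one_ne_zero
  have h1 : ∀ m : Multiset ℂ, (0 : ℂ) ∉ m → (m.map fun a => X - C a).prod =
      C ((m.map fun a => -a).prod) * (m.map fun a => 1 - C a⁻¹ * X).prod := by
    intro m hm
    rw [map_multiset_prod, Multiset.map_map, ← Multiset.prod_map_mul]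
    refine congrArg _ (Multiset.map_congr rfl fun a ha => ?_)
    have ha0 : a ≠ 0 := fun h => hm (h ▸ ha)
    rw [Function.comp_apply, mul_sub, mul_one, ← mul_assoc, ← C_mul, neg_mul, mul_inv_cancel₀ ha0,
      C_neg, C_neg, C_1]
    ring
  have h2 : L = (L.roots.map fun a => 1 - C a⁻¹ * X).prod := by
    have h3 := hs.eq_prod_roots
    rw [h1 _ h0, ← mul_assoc, ← C_mul] at h3
    have h4 := congrArg (fun f => coeff f 0) h3
    simp only [coeff_C_mul, hL] at h4
    have h5 : ((L.roots.map fun a => 1 - C a⁻¹ * X).prod).coeff 0 = 1 := by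
      rw [coeff_zero_eq_eval_zero, eval_multiset_prod, Multiset.map_map]
      simp
    rw [h5, mul_one] at h4
    rwa [← h4, C_1, one_mul] at h3
  refine ⟨(L.roots.map (·⁻¹)).toList, ?_, ?_⟩
  · rw [Multiset.length_toList, Multiset.card_map, splits_iff_card_roots.1 hs]
  · conv_lhs => rw [h2]
    rw [← Multiset.prod_coe, ← Multiset.map_coe, Multiset.coe_toList, Multiset.map_map,
      ← coeToPowerSeries.ringHom_apply, map_multiset_prod, Multiset.map_map]
    refine congrArg _ (Multiset.map_congr rfl fun a _ => ?_)
    simp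

theorem exists_sSum_eq {k : Type*} [Field k] [Fintype k] {l : k[X] → ℂ} (hl : MonicMul l) {h : ℕ}
    (hh : ∀ n ≥ h, cSum l n = 0) :
    ∃ (r : ℕ) (ω : Fin r → ℂ), r ≤ h ∧ ∀ n ≥ 1, sSum l n = -∑ i, ω i ^ n := by
  have hc0 : cSum l 0 = 1 := by
    have : monics k 0 = {1} := by
      ext f
      rw [mem_monics, Finset.mem_singleton]
      exact ⟨fun h => h.1.natDegree_eq_zero.1 h.2, by rintro rfl; simp⟩
    rw [cSum, this, Finset.sum_singleton, hl.one]
  have hcoeff : ∀ n, (∑ i ∈ Finset.range h, C (cSum l i) * X ^ i : ℂ[X]).coeff n = cSum l n := by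
    intro n
    simp only [finsetSum_coeff, coeff_C_mul_X_pow, Finset.sum_ite_eq, Finset.mem_range]
    split_ifs with hn
    · rfl
    · exact (hh n (not_lt.1 hn)).symm
  obtain ⟨s, hs, hprod⟩ := exists_list_prod _ ((hcoeff 0).trans hc0)
  refine ⟨s.length, fun i => s[i.1], ?_, fun n hn => ?_⟩
  · rw [hs]
    refine natDegree_sum_le_of_forall_le _ _ fun i hi => ?_
    exact (natDegree_C_mul_X_pow_le _ _).trans (Finset.mem_range.1 hi).le
  · have h1 : sSum l n = -(s.map fun ω => ω ^ n).sum := by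
      refine newton_unique (T := fun n => -(s.map fun ω => ω ^ n).sum) hc0 (newton_cSum hl) (fun n => ?_) n hn
      have := newton_prod s n
      rw [← hprod] at this
      simpa only [Polynomial.coeff_coe, hcoeff] using this
    rw [h1, ← Fin.sum_univ_getElem, neg_inj]
    refine Fintype.sum_equiv (finCongr (by simp)) _ _ fun i => ?_
    simp

end Roots

end LaurentBound

namespace LaurentBound

open scoped TensorProduct

section HomogeneousValue

variable {k : Type*} [Field k] {A : Type*} [CommRing A] [Algebra k A]

/-- The value at `(a, b)` of the homogenization of `f`. -/
def hval (a b : A) (f : k[X]) : A := ((f.map (algebraMap k A)).scaleRoots b).eval a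

theorem hval_one (a b : A) : hval a b (1 : k[X]) = 1 := by simp [hval]

variable [Nontrivial A]

theorem hval_mul (a b : A) {f g : k[X]} (hf : f.Monic) (hg : g.Monic) :
    hval a b (f * g) = hval a b f * hval a b g := by
  rw [hval, Polynomial.map_mul, mul_scaleRoots', eval_mul]
  · rfl
  · rw [(hf.map _).leadingCoeff, (hg.map _).leadingCoeff, mul_one]
    exact one_ne_zero

theorem tmul_hval [Fintype k] [Module.Finite k A] {Ω : Type*} [Field Ω] [Algebra k Ω] (a b : A)
    {f : k[X]} (hf : f.Monic) :
    (1 : Ω) ⊗ₜ[k] hval a b f =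
      hval (1 ⊗ₜ a) (1 ⊗ₜ b : Ω ⊗[k] A) (f.map (algebraMap k Ω)) := by
  have : Nontrivial (Ω ⊗[k] A) := (one_tmul_injective (k := k) (F := Ω) (A := A)).nontrivial
  set φ : A →+* Ω ⊗[k] A := Algebra.TensorProduct.includeRight.toRingHom with hφ
  have h1 : ∀ x : A, (1 : Ω) ⊗ₜ[k] x = φ x := fun _ => rfl
  have h2 : (f.map (algebraMap k Ω)).map (algebraMap Ω (Ω ⊗[k] A)) =
      (f.map (algebraMap k A)).map φ := by
    rw [Polynomial.map_map, Polynomial.map_map]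
    congr 1
    ext c
    simp [φ, Algebra.algebraMap_eq_smul_one]
  rw [hval, hval, h2, h1, h1, h1, ← map_scaleRoots, eval_map, eval₂_hom]
  rw [(hf.map _).leadingCoeff, map_one]
  exact one_ne_zero

theorem hval_X_sub_C (a b : A) (x : k) : hval a b (X - C x : k[X]) = a - algebraMap k A x * b := by
  rw [hval, Polynomial.map_sub, map_X, map_C, X_sub_C_scaleRoots]
  simp

theorem hval_prod {ι : Type*} (a b : A) (s : Finset ι) (f : ι → k[X]) (hf : ∀ i ∈ s, (f i).Monic) :
    hval a b (∏ i ∈ s, f i) = ∏ i ∈ s, hval a b (f i) := by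
  induction s using Finset.induction_on with
  | empty => simp [hval_one]
  | insert i s hi ih =>
    rw [Finset.prod_insert hi, Finset.prod_insert hi, hval_mul, ih]
    · exact fun j hj => hf j (Finset.mem_insert_of_mem hj)
    · exact hf i (Finset.mem_insert_self i s)
    · exact monic_prod_of_monic _ _ fun j hj => hf j (Finset.mem_insert_of_mem hj)

end HomogeneousValue

section Minpoly

variable {k : Type*} [Field k] [Fintype k] {Ω : Type*} [Field Ω] [Algebra k Ω]

theorem natDegree_minpoly_dvd_iff {x : Ω} (hx : IsIntegral k x) (n : ℕ) :
    (minpoly k x).natDegree ∣ n ↔ x ^ Fintype.card k ^ n = x := by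
  rw [(minpoly.irreducible hx).natDegree_dvd_iff_dvd_X_pow_card_pow_sub_X, minpoly.dvd_iff]
  simp [sub_eq_zero]

theorem map_minpoly_eq_prod {x : Ω} (hx : IsIntegral k x) :
    (minpoly k x).map (algebraMap k Ω) =
      ∏ i ∈ Finset.range (minpoly k x).natDegree, (X - C (x ^ Fintype.card k ^ i)) := by
  set d := (minpoly k x).natDegree with hd
  have hinj : Set.InjOn (fun i => x ^ Fintype.card k ^ i) (Finset.range d : Set ℕ) := by
    have : ∀ i j, i < d → j < d → i < j → x ^ Fintype.card k ^ i ≠ x ^ Fintype.card k ^ j := by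
      intro i j hi hj hij h
      have h1 : x ^ Fintype.card k ^ (j - i) = x := by
        refine (FiniteField.frobeniusAlgHom k Ω ^ i : Ω →ₐ[k] Ω).toRingHom.injective ?_
        change (FiniteField.frobeniusAlgHom k Ω ^ i) _ = (FiniteField.frobeniusAlgHom k Ω ^ i) _
        rw [frobenius_pow_apply, frobenius_pow_apply, h, ← pow_mul, ← pow_add,
          Nat.sub_add_cancel hij.le]
      have h2 := Nat.le_of_dvd (by omega) ((natDegree_minpoly_dvd_iff hx _).2 h1)
      omega
    intro i hi j hj h
    simp only [Finset.coe_range, Set.mem_Iio] at hi hj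
    rcases lt_trichotomy i j with hij | hij | hij
    · exact absurd h (this i j hi hj hij)
    · exact hij
    · exact absurd h.symm (this j i hj hi hij)
  refine eq_of_monic_of_dvd_of_natDegree_le (monic_prod_of_monic _ _ fun i _ => monic_X_sub_C _)
    ((minpoly.monic hx).map _) ?_ ?_
  · refine Finset.prod_dvd_of_coprime ?_ ?_
    · intro i hi j hj hij
      refine pairwise_coprime_X_sub_C (s := id) Function.injective_id ?_
      exact fun h => hij (hinj hi hj h)
    · intro i _
      rw [dvd_iff_isRoot, IsRoot, eval_map_algebraMap, ← frobenius_pow_apply k, aeval_algHom_apply,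
        minpoly.aeval, map_zero]
  · rw [natDegree_prod_of_monic _ _ fun i _ => monic_X_sub_C _]
    rw [natDegree_map, Finset.sum_congr rfl fun i _ => natDegree_X_sub_C _]
    simp [hd]

variable {A : Type*} [CommRing A] [Algebra k A] [Module.Finite k A] [Nontrivial A]

theorem lnorm_eq_hval (a b : A) {x : Ω} (hx : IsIntegral k x) {n : ℕ}
    (hn : x ^ Fintype.card k ^ n = x) :
    lnorm (k := k) a b n x = 1 ⊗ₜ (hval a b (minpoly k x) ^ (n / (minpoly k x).natDegree)) := by
  have : Nontrivial (Ω ⊗[k] A) := (one_tmul_injective (k := k) (F := Ω) (A := A)).nontrivial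
  obtain ⟨e, rfl⟩ := (natDegree_minpoly_dvd_iff hx n).2 hn
  have hd := minpoly.natDegree_pos hx
  rw [Nat.mul_div_cancel_left _ hd, lnorm_mul ((natDegree_minpoly_dvd_iff hx _).1 dvd_rfl),
    ← one_pow e, ← Algebra.TensorProduct.tmul_pow, tmul_hval a b (minpoly.monic hx),
    map_minpoly_eq_prod hx, hval_prod _ _ _ _ fun i _ => monic_X_sub_C _, lnorm]
  congr 1
  refine Finset.prod_congr rfl fun i _ => ?_
  rw [hval_X_sub_C, lfac, Algebra.TensorProduct.algebraMap_apply,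
    Algebra.TensorProduct.tmul_mul_tmul]
  simp

end Minpoly

section Fibers

variable {k : Type*} [Field k] [Fintype k] {Ω : Type*} [Field Ω] [Algebra k Ω] [IsAlgClosed Ω]
  [Algebra.IsAlgebraic k Ω]

theorem card_filter_minpoly {d : ℕ} {P : k[X]} (hP : P ∈ irreds k d) (Y : Finset Ω)
    (hY : ∀ y, aeval y P = 0 → y ∈ Y) : (Y.filter fun y => minpoly k y = P).card = d := by
  obtain ⟨hP1, hP2, hP3⟩ := mem_irreds.1 hP
  have h := card_rootSet_eq_natDegree (K := Ω) (PerfectField.separable_of_irreducible hP3)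
    (IsAlgClosed.splits _)
  rw [← hP2, ← h, ← Set.toFinset_card]
  congr 1
  ext y
  rw [Finset.mem_filter, Set.mem_toFinset, mem_rootSet_of_ne hP1.ne_zero]
  refine ⟨fun h => h.2 ▸ minpoly.aeval k y, fun h => ⟨hY y h, ?_⟩⟩
  exact (minpoly.eq_of_irreducible_of_monic hP3 h hP1).symm

theorem sSum_eq_sum (l : k[X] → ℂ) {n : ℕ} (hn : 1 ≤ n) (Y : Finset Ω)
    (hY : ∀ y, y ∈ Y ↔ y ^ Fintype.card k ^ n = y) :
    sSum l n = ∑ y ∈ Y, l (minpoly k y) ^ (n / (minpoly k y).natDegree) := by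
  have hintg : ∀ y : Ω, IsIntegral k y := fun y => Algebra.IsIntegral.isIntegral y
  rw [← Finset.sum_fiberwise_of_maps_to (s := Y) (t := n.divisorsAntidiagonal)
    (g := fun y => ((minpoly k y).natDegree, n / (minpoly k y).natDegree)), sSum]
  · refine Finset.sum_congr rfl fun x hx => ?_
    rw [Nat.mem_divisorsAntidiagonal] at hx
    have hx1 : 0 < x.1 := Nat.pos_of_ne_zero fun h => hx.2 (by rw [← hx.1, h, zero_mul])
    rw [← Finset.sum_fiberwise_of_maps_to (t := irreds k x.1) (g := fun y : Ω => minpoly k y)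
      (f := fun y => l (minpoly k y) ^ (n / (minpoly k y).natDegree))]
    · refine Finset.sum_congr rfl fun P hP => ?_
      have hPP := mem_irreds.1 hP
      have h1 : (Y.filter fun y => ((minpoly k y).natDegree, n / (minpoly k y).natDegree) = x).filter
          (fun y => minpoly k y = P) = Y.filter fun y => minpoly k y = P := by
        ext y
        simp only [Finset.mem_filter, and_assoc]
        refine ⟨fun h => ⟨h.1, h.2.2⟩, fun h => ⟨h.1, ?_, h.2⟩⟩
        rw [h.2, hPP.2.1, ← hx.1, Nat.mul_div_cancel_left _ hx1]
      rw [h1, Finset.sum_congr rfl (g := fun _ : Ω => l P ^ x.2), Finset.sum_const,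
        card_filter_minpoly hP, nsmul_eq_mul]
      · intro y hy
        rw [hY, ← natDegree_minpoly_dvd_iff (hintg y),
          ← minpoly.eq_of_irreducible_of_monic hPP.2.2 hy hPP.1, hPP.2.1]
        exact ⟨_, hx.1.symm⟩
      · intro y hy
        rw [(Finset.mem_filter.1 hy).2, hPP.2.1, ← hx.1, Nat.mul_div_cancel_left _ hx1]
    · intro y hy
      rw [Finset.mem_filter] at hy
      exact mem_irreds.2 ⟨minpoly.monic (hintg y), congrArg Prod.fst hy.2,
        minpoly.irreducible (hintg y)⟩
  · intro y hy
    rw [Nat.mem_divisorsAntidiagonal]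
    exact ⟨Nat.mul_div_cancel' ((natDegree_minpoly_dvd_iff (hintg y) n).2 ((hY y).1 hy)), by omega⟩

end Fibers

end LaurentBound

namespace LaurentBound

open scoped TensorProduct

section

variable {k : Type*} [Field k] [Fintype k]

theorem sSum_one (n : ℕ) (hn : 1 ≤ n) : sSum (fun _ : k[X] => (1 : ℂ)) n = Fintype.card k ^ n := by
  have h : MonicMul fun _ : k[X] => (1 : ℂ) := ⟨rfl, fun _ _ _ _ => (one_mul 1).symm, by simp⟩
  have hc : ∀ n, cSum (fun _ : k[X] => (1 : ℂ)) n = Fintype.card k ^ n := by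
    intro n
    simp [cSum, card_monics]
  refine newton_unique (T := fun n => (Fintype.card k : ℂ) ^ n)
    (c := cSum (fun _ : k[X] => (1 : ℂ))) (by simp [hc]) (newton_cSum h) (fun n => ?_) n hn
  have : ∀ j ∈ Finset.Icc 1 n, (Fintype.card k : ℂ) ^ j *
      cSum (fun _ : k[X] => (1 : ℂ)) (n - j) = Fintype.card k ^ n := by
    intro j hj
    rw [hc, ← pow_add, Nat.add_sub_cancel' (Finset.mem_Icc.1 hj).2]
  rw [Finset.sum_congr rfl this, hc]
  simp

theorem mul_card_irreds_le (n : ℕ) : n * (irreds k n).card ≤ Fintype.card k ^ n := by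
  rcases Nat.eq_zero_or_pos n with rfl | hn
  · simp
  have h := sSum_one (k := k) n hn
  have h1 : sSum (fun _ : k[X] => (1 : ℂ)) n =
      ((∑ x ∈ n.divisorsAntidiagonal, x.1 * (irreds k x.1).card : ℕ) : ℂ) := by
    rw [sSum]
    push_cast
    refine Finset.sum_congr rfl fun x _ => ?_
    simp [mul_comm]
  rw [h1] at h
  have h2 : ∑ x ∈ n.divisorsAntidiagonal, x.1 * (irreds k x.1).card = Fintype.card k ^ n := by
    exact_mod_cast h
  rw [← h2]
  refine Finset.single_le_sum (f := fun x : ℕ × ℕ => x.1 * (irreds k x.1).card)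
    (fun _ _ => Nat.zero_le _) (a := (n, 1)) ?_
  rw [Nat.mem_divisorsAntidiagonal]
  exact ⟨mul_one n, hn.ne'⟩

theorem sqrt_card_pow_two_mul (n : ℕ) :
    √(Fintype.card k : ℝ) ^ (2 * n) = (Fintype.card k : ℝ) ^ n := by
  rw [pow_mul, Real.sq_sqrt (Nat.cast_nonneg _)]

theorem one_le_sqrt_card : 1 ≤ √(Fintype.card k : ℝ) :=
  Real.one_le_sqrt.2 (by exact_mod_cast Fintype.card_pos)

theorem norm_irreds_sub_sSum_le {l : k[X] → ℂ} (hl : MonicMul l) {n : ℕ} (hn : 1 ≤ n) :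
    ‖n * ∑ P ∈ irreds k n, l P - sSum l n‖ ≤ n * √(Fintype.card k : ℝ) ^ n := by
  have hmem : (n, 1) ∈ n.divisorsAntidiagonal := by
    rw [Nat.mem_divisorsAntidiagonal]
    exact ⟨mul_one n, by omega⟩
  rw [sSum, ← Finset.add_sum_erase _ _ hmem]
  simp only [pow_one, ← Finset.mul_sum]
  rw [sub_add_cancel_left, norm_neg]
  refine (norm_sum_le_of_le (n := fun _ => √(Fintype.card k : ℝ) ^ n) _ fun x hx => ?_).trans ?_
  · rw [Finset.mem_erase, Nat.mem_divisorsAntidiagonal] at hx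
    obtain ⟨hx1, hx2, hx3⟩ := hx
    have h1 : ‖∑ P ∈ irreds k x.1, l P ^ x.2‖ ≤ (irreds k x.1).card := by
      refine (norm_sum_le_of_le (n := fun _ => (1 : ℝ)) _ fun P _ => ?_).trans (by simp)
      rw [norm_pow]
      exact pow_le_one₀ (norm_nonneg _) (hl.norm_le P)
    rw [norm_mul, Complex.norm_natCast]
    have h2 : (x.1 : ℝ) * (irreds k x.1).card ≤ (Fintype.card k : ℝ) ^ x.1 := by
      exact_mod_cast mul_card_irreds_le (k := k) x.1
    refine (mul_le_mul_of_nonneg_left h1 (Nat.cast_nonneg _)).trans (h2.trans ?_)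
    rw [← sqrt_card_pow_two_mul]
    refine pow_le_pow_right₀ one_le_sqrt_card ?_
    have h3 : x.2 ≠ 1 := by
      intro h
      rw [h, mul_one] at hx2
      exact hx1 (Prod.ext hx2 h)
    have h4 : x.2 ≠ 0 := fun h => hx3 (by rw [← hx2, h, mul_zero])
    calc 2 * x.1 = x.1 * 2 := mul_comm _ _
      _ ≤ x.1 * x.2 := Nat.mul_le_mul_left _ (by omega)
      _ = n := hx2
  · rw [Finset.sum_const, nsmul_eq_mul]
    refine mul_le_mul_of_nonneg_right ?_ (by positivity)
    have h5 : (n.divisorsAntidiagonal.erase (n, 1)).card ≤ n.divisorsAntidiagonal.card :=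
      Finset.card_le_card (Finset.erase_subset _ _)
    have h6 : n.divisorsAntidiagonal.card ≤ n := by
      rw [← Nat.map_div_right_divisors, Finset.card_map]
      exact Nat.card_divisors_le_self n
    exact_mod_cast h5.trans h6

theorem norm_mulChar_le {A : Type*} [CommRing A] [Finite A] (χ : MulChar A ℂ) (a : A) :
    ‖χ a‖ ≤ 1 := by
  by_cases ha : IsUnit a
  · obtain ⟨u, rfl⟩ := ha
    have h : (χ u) ^ orderOf u = 1 := by
      rw [← map_pow, ← Units.val_pow_eq_pow_val, pow_orderOf_eq_one, Units.val_one, map_one]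
    have hu : orderOf u ≠ 0 := (isOfFinOrder_of_finite u).orderOf_pos.ne'
    exact (Complex.norm_eq_one_of_pow_eq_one h hu).le
  · rw [χ.map_nonunit ha, norm_zero]
    exact zero_le_one

variable {A : Type*} [CommRing A] [Algebra k A] [Module.Finite k A] [Nontrivial A]

theorem monicMul_mulChar (a b : A) (χ : MulChar A ℂ) :
    MonicMul fun f : k[X] => χ (hval a b f) :=
  have : Finite A := Module.finite_of_finite k
  ⟨by rw [hval_one, map_one], fun f g hf hg => by rw [hval_mul a b hf hg, map_mul],
    fun f => norm_mulChar_le χ _⟩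

/-- The Riemann hypothesis for the character sums of the norm form. -/
theorem norm_sSum_le (a b : A) {w : A[X]} {d : k[X]} (hd : d ≠ 0)
    (hw : (C a - C b * X) * w = d.map (algebraMap k A)) (χ : MulChar A ℂ) {h : ℕ}
    (hh : ∀ n ≥ h, cSum (fun f : k[X] => χ (hval a b f)) n = 0) {n : ℕ} (hn : 1 ≤ n) :
    ‖sSum (fun f : k[X] => χ (hval a b f)) n‖ ≤ h * √(Fintype.card k : ℝ) ^ n := by
  have : Finite A := Module.finite_of_finite k
  obtain ⟨r, ω, hr, hω⟩ := exists_sSum_eq (monicMul_mulChar (k := k) a b χ) hh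
  let Ω := AlgebraicClosure k
  obtain ⟨J, C, n₀, hJ, hlow⟩ := lnorm_sum_ge (k := k) Ω a b hd hw χ (norm_mulChar_le χ)
  have hbound : ∀ m ≥ n₀ + 1, (∑ i, (ω i ^ (2 * J)) ^ m).re ≤
      C * ((Fintype.card k : ℝ) ^ J) ^ m := by
    intro m hm
    have hm0 : 0 < J * (2 * m) := Nat.mul_pos hJ (by omega)
    have : Finite (fixedFrob k Ω (J * (2 * m))) := (Nat.card_pos_iff.1
      (card_fixedFrob (k := k) (Ω := Ω) hm0 ▸ pow_pos Fintype.card_pos _)).2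
    have hY : ∀ y, y ∈ (Set.toFinite (fixedFrob k Ω (J * (2 * m)) : Set Ω)).toFinset ↔
        y ^ Fintype.card k ^ (J * (2 * m)) = y := by
      intro y
      rw [Set.Finite.mem_toFinset, SetLike.mem_coe, mem_fixedFrob]
    have h1 := hlow m (by omega) _ hY
      (fun y => hval a b (minpoly k y) ^ (J * (2 * m) / (minpoly k y).natDegree))
      fun y hy => lnorm_eq_hval a b (Algebra.IsIntegral.isIntegral y) ((hY y).1 hy)
    simp only [map_pow] at h1
    rw [← sSum_eq_sum (fun f : k[X] => χ (hval a b f)) hm0 _ hY, hω _ hm0, Complex.neg_re] at h1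
    have h2 : ∀ i, (ω i ^ (2 * J)) ^ m = ω i ^ (J * (2 * m)) := fun i => by
      rw [← pow_mul]
      congr 1
      ring
    simp only [h2, ← pow_mul]
    linarith
  have hq : (0 : ℝ) < Fintype.card k := by exact_mod_cast Fintype.card_pos
  have hωn : ∀ i, ‖ω i‖ ≤ √(Fintype.card k : ℝ) := by
    intro i
    have h1 := norm_le_of_sum_pow_re_le _ (pow_pos hq J) _ hbound i
    rw [norm_pow, ← sqrt_card_pow_two_mul] at h1
    exact le_of_pow_le_pow_left₀ (by omega) (Real.sqrt_nonneg _) h1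
  rw [hω n hn, norm_neg]
  refine (norm_sum_le_of_le (n := fun _ => √(Fintype.card k : ℝ) ^ n) _ fun i _ => ?_).trans ?_
  · rw [norm_pow]
    exact pow_le_pow_left₀ (norm_nonneg _) (hωn i) n
  · rw [Finset.sum_const, nsmul_eq_mul, Finset.card_univ, Fintype.card_fin]
    exact mul_le_mul_of_nonneg_right (by exact_mod_cast hr) (by positivity)

theorem norm_irreds_sum_le (a b : A) {w : A[X]} {d : k[X]} (hd : d ≠ 0)
    (hw : (C a - C b * X) * w = d.map (algebraMap k A)) (χ : MulChar A ℂ) {h : ℕ}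
    (hh : ∀ n ≥ h, cSum (fun f : k[X] => χ (hval a b f)) n = 0) {n : ℕ} (hn : 1 ≤ n) :
    ‖n * ∑ P ∈ irreds k n, χ (hval a b P)‖ ≤ (n + h) * √(Fintype.card k : ℝ) ^ n := by
  have h1 := norm_irreds_sub_sSum_le (monicMul_mulChar (k := k) a b χ) hn
  have h2 := norm_sSum_le a b hd hw χ hh hn
  rw [add_mul]
  exact (norm_le_norm_sub_add _ _).trans (add_le_add h1 h2)

end

end LaurentBound

namespace LaurentBound

section

variable {A : Type*} [CommRing A] [Finite A]

theorem sum_mulChar_apply [Fintype (MulChar A ℂ)] (u : Aˣ) :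
    ∑ χ : MulChar A ℂ, χ (u : A) = if u = 1 then (Nat.card Aˣ : ℂ) else 0 := by
  split_ifs with hu
  · subst hu
    simp only [Units.val_one, map_one, Finset.sum_const, Finset.card_univ, nsmul_eq_mul, mul_one]
    rw [← Nat.card_eq_fintype_card, MulChar.card_eq_card_units_of_hasEnoughRootsOfUnity]
  · obtain ⟨χ, hχ⟩ := MulChar.exists_apply_ne_one_of_hasEnoughRootsOfUnity A ℂ
      (a := (u : A)) (by simpa using hu)
    have h : χ (u : A) * ∑ χ' : MulChar A ℂ, χ' (u : A) = ∑ χ' : MulChar A ℂ, χ' (u : A) := by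
      rw [Finset.mul_sum]
      exact Fintype.sum_equiv (Equiv.mulLeft χ) _ _ fun χ' => by simp [MulChar.mul_apply]
    have h2 : (χ (u : A) - 1) * ∑ χ' : MulChar A ℂ, χ' (u : A) = 0 := by
      rw [sub_mul, h, one_mul, sub_self]
    exact (mul_eq_zero.1 h2).resolve_left (sub_ne_zero.2 hχ)

/-- The Fourier transform on the unit group. -/
def mulFourier [Fintype Aˣ] (G : Aˣ → ℂ) (χ : MulChar A ℂ) : ℂ := ∑ u : Aˣ, G u * χ (u⁻¹ : Aˣ)

theorem sum_mulFourier_mul [Fintype Aˣ] [Fintype (MulChar A ℂ)] (G : Aˣ → ℂ) (v : Aˣ) :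
    ∑ χ : MulChar A ℂ, mulFourier G χ * χ (v : A) = Nat.card Aˣ * G v := by
  simp only [mulFourier, Finset.sum_mul, mul_assoc, ← map_mul, ← Units.val_mul]
  rw [Finset.sum_comm]
  simp only [← Finset.mul_sum, sum_mulChar_apply, inv_mul_eq_one]
  simp [mul_comm]

theorem mulFourier_one [Fintype Aˣ] (G : Aˣ → ℂ) : mulFourier G 1 = ∑ u, G u := by
  simp [mulFourier]

theorem conj_mulChar (χ : MulChar A ℂ) (u : Aˣ) :
    (starRingEnd ℂ) (χ (u⁻¹ : Aˣ)) = χ (u : A) := by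
  have h := MulChar.star_apply' χ ((u⁻¹ : Aˣ) : A)
  rw [MulChar.inv_apply, Ring.inverse_unit, inv_inv] at h
  exact h

theorem sum_norm_mulFourier_sq [Fintype Aˣ] [Fintype (MulChar A ℂ)] (G : Aˣ → ℂ) :
    ∑ χ : MulChar A ℂ, ‖mulFourier G χ‖ ^ 2 = Nat.card Aˣ * ∑ u, ‖G u‖ ^ 2 := by
  have h : ((∑ χ : MulChar A ℂ, ‖mulFourier G χ‖ ^ 2 : ℝ) : ℂ) =
      ((Nat.card Aˣ * ∑ u, ‖G u‖ ^ 2 : ℝ) : ℂ) := by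
    push_cast
    simp only [← Complex.mul_conj']
    have h1 : ∀ χ : MulChar A ℂ, mulFourier G χ * (starRingEnd ℂ) (mulFourier G χ) =
        ∑ u : Aˣ, (starRingEnd ℂ) (G u) * (mulFourier G χ * χ (u : A)) := by
      intro χ
      conv_lhs => rw [mulFourier.eq_1 G χ, map_sum, Finset.mul_sum]
      refine Finset.sum_congr rfl fun u _ => ?_
      rw [map_mul, conj_mulChar, ← mulFourier.eq_1]
      ring
    simp only [h1]
    rw [Finset.sum_comm, Finset.mul_sum]
    refine Finset.sum_congr rfl fun u _ => ?_
    rw [← Finset.mul_sum, sum_mulFourier_mul]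
    ring
  exact_mod_cast h

/-- Bounds for all character sums over a family of units give equidistribution of the family. -/
theorem norm_sum_sub_avg_le [Fintype Aˣ] {J : Type*} (s : Finset J) (y : J → Aˣ) (X : ℂ) {B : ℝ}
    (hB : ∀ χ : MulChar A ℂ, ‖∑ j ∈ s, χ (y j : A) - if χ = 1 then X else 0‖ ≤ B) (G : Aˣ → ℂ) :
    ‖∑ j ∈ s, G (y j) - X * ((∑ u, G u) / Nat.card Aˣ)‖ ≤ B * √(∑ u, ‖G u‖ ^ 2) := by
  have : Fintype (MulChar A ℂ) := Fintype.ofFinite _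
  have hc : (0 : ℝ) < Nat.card Aˣ := by exact_mod_cast Nat.card_pos
  have hc' : (Nat.card Aˣ : ℂ) ≠ 0 := by exact_mod_cast hc.ne'
  have hB0 : 0 ≤ B := (norm_nonneg _).trans (hB 1)
  have h1 : (Nat.card Aˣ : ℂ) * (∑ j ∈ s, G (y j) - X * ((∑ u, G u) / Nat.card Aˣ)) =
      ∑ χ : MulChar A ℂ, mulFourier G χ * (∑ j ∈ s, χ (y j : A) - if χ = 1 then X else 0) := by
    simp only [mul_sub, Finset.sum_sub_distrib, mul_ite, mul_zero, Finset.sum_ite_eq',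
      Finset.mem_univ, if_true, mulFourier_one]
    congr 1
    · simp only [Finset.mul_sum]
      rw [Finset.sum_comm]
      simp only [sum_mulFourier_mul]
    · field_simp
  have h2 : Nat.card Aˣ * ‖∑ j ∈ s, G (y j) - X * ((∑ u, G u) / Nat.card Aˣ)‖ ≤
      (∑ χ : MulChar A ℂ, ‖mulFourier G χ‖) * B := by
    rw [← Complex.norm_natCast, ← norm_mul, h1, Finset.sum_mul]
    refine norm_sum_le_of_le _ fun χ _ => ?_
    rw [norm_mul]
    exact mul_le_mul_of_nonneg_left (hB χ) (norm_nonneg _)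
  have h3 : ∑ χ : MulChar A ℂ, ‖mulFourier G χ‖ ≤ Nat.card Aˣ * √(∑ u, ‖G u‖ ^ 2) := by
    have h4 := sq_sum_le_card_mul_sum_sq (s := (Finset.univ : Finset (MulChar A ℂ)))
      (f := fun χ => ‖mulFourier G χ‖)
    rw [sum_norm_mulFourier_sq, Finset.card_univ, ← Nat.card_eq_fintype_card,
      MulChar.card_eq_card_units_of_hasEnoughRootsOfUnity] at h4
    refine (pow_le_pow_iff_left₀ (by positivity) (by positivity) two_ne_zero).1 (h4.trans_eq ?_)
    rw [mul_pow, Real.sq_sqrt (by positivity)]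
    ring
  refine le_of_mul_le_mul_left (h2.trans ((mul_le_mul_of_nonneg_right h3 hB0).trans_eq ?_)) hc
  ring

end

section

variable {k : Type*} [Field k] [Fintype k]
variable {A : Type*} [CommRing A] [Algebra k A] [Module.Finite k A] [Nontrivial A]

/-- Irreducible polynomials equidistribute, under `hval a b`, in the units of `A`. -/
theorem norm_irreds_sub_avg_le [Fintype Aˣ] (a b : A) {w : A[X]} {d : k[X]} (hd : d ≠ 0)
    (hw : (C a - C b * X) * w = d.map (algebraMap k A)) {h : ℕ}
    (hh : ∀ χ : MulChar A ℂ, χ ≠ 1 → (∀ c : kˣ, χ (algebraMap k A c) = 1) →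
      ∀ n ≥ h, cSum (fun f : k[X] => χ (hval a b f)) n = 0) {n : ℕ} (hn : 1 ≤ n)
    (hu : ∀ P ∈ irreds k n, IsUnit (hval a b P)) (G : A → ℂ) :
    ‖∑ P ∈ irreds k n, ∑ c : kˣ, n * G (algebraMap k A c * hval a b P) -
        ((Fintype.card k - 1) * Fintype.card k ^ n : ℂ) * ((∑ u : Aˣ, G u) / Nat.card Aˣ)‖ ≤
      (Fintype.card k - 1) * ((n + h) * √(Fintype.card k : ℝ) ^ n) * √(∑ u : Aˣ, ‖G u‖ ^ 2) := by
  have : Finite A := Module.finite_of_finite k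
  have hn0 : (n : ℂ) ≠ 0 := by exact_mod_cast (by omega : n ≠ 0)
  have hnr : (0 : ℝ) < n := by exact_mod_cast hn
  have hq1 : (0 : ℝ) ≤ Fintype.card k - 1 := by
    rw [sub_nonneg]
    exact_mod_cast Fintype.card_pos (α := k)
  have hcard : ((Fintype.card kˣ : ℕ) : ℂ) = Fintype.card k - 1 := by
    rw [Fintype.card_units, Nat.cast_sub Fintype.card_pos, Nat.cast_one]
  let y : k[X] × kˣ → Aˣ := fun z => if hz : IsUnit (algebraMap k A z.2 * hval a b z.1) then
    hz.unit else 1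
  have hy : ∀ z ∈ irreds k n ×ˢ (Finset.univ : Finset kˣ),
      (y z : A) = algebraMap k A z.2 * hval a b z.1 := by
    intro z hz
    have h1 : IsUnit (algebraMap k A z.2 * hval a b z.1) :=
      (z.2.isUnit.map (algebraMap k A)).mul (hu _ (Finset.mem_product.1 hz).1)
    simp only [y, dif_pos h1, IsUnit.unit_spec]
  have key := norm_sum_sub_avg_le (irreds k n ×ˢ (Finset.univ : Finset kˣ)) y
    (((Fintype.card k - 1) * Fintype.card k ^ n : ℂ) / n)
    (B := (Fintype.card k - 1) * ((n + h) * √(Fintype.card k : ℝ) ^ n) / n) (fun χ => ?_)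
    fun u => G u
  · have h2 : ∑ z ∈ irreds k n ×ˢ (Finset.univ : Finset kˣ), G (y z) =
        ∑ P ∈ irreds k n, ∑ c : kˣ, G (algebraMap k A c * hval a b P) := by
      rw [← Finset.sum_product']
      exact Finset.sum_congr rfl fun z hz => by rw [hy z hz]
    rw [h2] at key
    have h3 := mul_le_mul_of_nonneg_left key hnr.le
    rw [← Complex.norm_natCast, ← norm_mul, Complex.norm_natCast] at h3
    simp only [← Finset.mul_sum]
    refine (le_of_eq ?_).trans (h3.trans_eq ?_)
    · congr 1
      rw [mul_sub, ← mul_assoc, mul_div_cancel₀ _ hn0]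
    · rw [← mul_assoc, mul_div_cancel₀ _ hnr.ne']
  · have h2 : ∑ z ∈ irreds k n ×ˢ (Finset.univ : Finset kˣ), χ (y z : A) =
        (∑ c : kˣ, χ (algebraMap k A c)) * ∑ P ∈ irreds k n, χ (hval a b P) := by
      rw [Finset.sum_mul_sum, Finset.sum_comm, ← Finset.sum_product']
      exact Finset.sum_congr rfl fun z hz => by rw [hy z hz, map_mul]
    rw [h2, le_div_iff₀ hnr, mul_comm _ (n : ℝ)]
    nth_rw 1 [← Complex.norm_natCast]
    rw [← norm_mul]
    by_cases h1 : χ = 1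
    · subst h1
      have h3 : ∑ P ∈ irreds k n, (1 : MulChar A ℂ) (hval a b P) = ∑ P ∈ irreds k n, (1 : ℂ) :=
        Finset.sum_congr rfl fun P hP => MulChar.one_apply (hu P hP)
      have h4 : ∑ c : kˣ, (1 : MulChar A ℂ) (algebraMap k A c) = Fintype.card k - 1 := by
        rw [← hcard, Finset.sum_congr rfl fun c _ =>
          MulChar.one_apply (c.isUnit.map (algebraMap k A))]
        simp
      have h5 : MonicMul fun _ : k[X] => (1 : ℂ) :=
        ⟨rfl, fun _ _ _ _ => (one_mul 1).symm, by simp⟩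
      have h6 := norm_irreds_sub_sSum_le h5 hn
      rw [sSum_one n hn] at h6
      rw [h3, h4, if_pos rfl]
      have h7 : (n : ℂ) * ((Fintype.card k - 1) * ∑ P ∈ irreds k n, (1 : ℂ) -
          (Fintype.card k - 1) * Fintype.card k ^ n / n) = ((Fintype.card k - 1 : ℝ) : ℂ) *
          (n * ∑ P ∈ irreds k n, (1 : ℂ) - Fintype.card k ^ n) := by
        push_cast
        field_simp
      rw [h7, norm_mul, Complex.norm_real, Real.norm_of_nonneg hq1]
      refine mul_le_mul_of_nonneg_left (h6.trans ?_) hq1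
      exact mul_le_mul_of_nonneg_right (by simp) (by positivity)
    · rw [if_neg h1, sub_zero]
      by_cases h3 : ∀ c : kˣ, χ (algebraMap k A c) = 1
      · have h4 := norm_irreds_sum_le a b hd hw χ (hh χ h1 h3) hn
        simp only [h3]
        rw [mul_left_comm, norm_mul, Finset.sum_const, Finset.card_univ, nsmul_eq_mul, mul_one,
          Complex.norm_natCast]
        have h5 : ((Fintype.card kˣ : ℕ) : ℝ) = Fintype.card k - 1 := by
          rw [Fintype.card_units, Nat.cast_sub Fintype.card_pos, Nat.cast_one]
        rw [h5]
        exact mul_le_mul_of_nonneg_left h4 hq1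
      · push Not at h3
        obtain ⟨c, hc⟩ := h3
        have h4 : χ (algebraMap k A c) * ∑ c' : kˣ, χ (algebraMap k A c') =
            ∑ c' : kˣ, χ (algebraMap k A c') := by
          rw [Finset.mul_sum]
          exact Fintype.sum_equiv (Equiv.mulLeft c) _ _ fun c' => by simp
        have h5 : (χ (algebraMap k A c) - 1) * ∑ c' : kˣ, χ (algebraMap k A c') = 0 := by
          rw [sub_mul, h4, one_mul, sub_self]
        rw [(mul_eq_zero.1 h5).resolve_left (sub_ne_zero.2 hc), zero_mul, mul_zero, norm_zero]
        positivity

end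

end LaurentBound

namespace LaurentBound

section

variable {k : Type*} [Field k] [Fintype k]

theorem sum_lowDeg_succ (n : ℕ) (F : k[X] → ℂ) :
    ∑ f ∈ lowDeg k (n + 1), F f =
      ∑ f ∈ lowDeg k n, F f + ∑ f ∈ monics k n, ∑ c : kˣ, F (C (c : k) * f) := by
  rw [← Finset.sum_filter_add_sum_filter_not (lowDeg k (n + 1))
    (fun f : k[X] => f.degree < (n : WithBot ℕ))]
  congr 1
  · refine Finset.sum_congr ?_ fun _ _ => rfl
    ext f
    rw [Finset.mem_filter, mem_lowDeg, mem_lowDeg]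
    exact ⟨fun h => h.2, fun h => ⟨h.trans (by exact_mod_cast Nat.lt_succ_self n), h⟩⟩
  · have hdeg : ∀ f ∈ (lowDeg k (n + 1)).filter (fun f : k[X] => ¬ f.degree < (n : WithBot ℕ)),
        f ≠ 0 ∧ f.natDegree = n := by
      intro f hf
      rw [Finset.mem_filter, mem_lowDeg, not_lt] at hf
      have hf0 : f ≠ 0 := by
        rintro rfl
        simp at hf
      rw [degree_eq_natDegree hf0] at hf
      have h1 : f.natDegree < n + 1 := by exact_mod_cast hf.1
      have h2 : n ≤ f.natDegree := by exact_mod_cast hf.2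
      exact ⟨hf0, by omega⟩
    rw [← Finset.sum_product']
    symm
    refine Finset.sum_bij' (fun z _ => C (z.2 : k) * z.1)
      (fun f hf => (C f.leadingCoeff⁻¹ * f, Units.mk0 f.leadingCoeff
        (leadingCoeff_ne_zero.2 (hdeg f hf).1))) ?_ ?_ ?_ ?_ fun _ _ => rfl
    · intro z hz
      have h1 := mem_monics.1 (Finset.mem_product.1 hz).1
      have h2 : (C (z.2 : k) * z.1).degree = n := by
        rw [degree_C_mul z.2.ne_zero, degree_eq_natDegree h1.1.ne_zero, h1.2]
      rw [Finset.mem_filter, mem_lowDeg, h2]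
      exact ⟨by exact_mod_cast Nat.lt_succ_self n, lt_irrefl _⟩
    · intro f hf
      have h1 := hdeg f hf
      rw [Finset.mem_product, mem_monics]
      refine ⟨⟨?_, ?_⟩, Finset.mem_univ _⟩
      · rw [mul_comm]
        exact monic_mul_leadingCoeff_inv h1.1
      · rw [natDegree_C_mul (inv_ne_zero (leadingCoeff_ne_zero.2 h1.1)), h1.2]
    · intro z hz
      have h1 := mem_monics.1 (Finset.mem_product.1 hz).1
      have h2 : (C (z.2 : k) * z.1).leadingCoeff = z.2 := by
        rw [leadingCoeff_mul, leadingCoeff_C, h1.1.leadingCoeff, mul_one]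
      refine Prod.ext ?_ (Units.ext h2)
      change C _ * (C (z.2 : k) * z.1) = z.1
      rw [h2, ← mul_assoc, ← C_mul, inv_mul_cancel₀ z.2.ne_zero, C_1, one_mul]
    · intro f hf
      have h1 := leadingCoeff_ne_zero.2 (hdeg f hf).1
      change C (f.leadingCoeff) * (C f.leadingCoeff⁻¹ * f) = f
      rw [← mul_assoc, ← C_mul, mul_inv_cancel₀ h1, C_1, one_mul]

/-- A surjective additive map has fibres of constant size. -/
theorem card_mul_sum_comp {E A : Type*} [AddCommGroup E] [AddCommGroup A] [Fintype A]
    (L : E →+ A) (V : Finset E) (hV : ∀ f ∈ V, ∀ g ∈ V, f + g ∈ V) (hneg : ∀ f ∈ V, -f ∈ V)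
    (hL : ∀ a, ∃ g ∈ V, L g = a) (G : A → ℂ) :
    (Fintype.card A : ℂ) * ∑ f ∈ V, G (L f) = V.card * ∑ a, G a := by
  have h1 : ∀ a, ∑ f ∈ V, G (L f) = ∑ f ∈ V, G (L f + a) := by
    intro a
    obtain ⟨g, hg, rfl⟩ := hL a
    symm
    refine Finset.sum_bij' (fun f _ => f + g) (fun f _ => f - g) ?_ ?_ ?_ ?_ ?_
    · exact fun f hf => hV f hf g hg
    · exact fun f hf => by
        rw [sub_eq_add_neg]
        exact hV f hf _ (hneg g hg)
    · exact fun f _ => add_sub_cancel_right f g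
    · exact fun f _ => sub_add_cancel f g
    · exact fun f _ => by rw [map_add]
  have h2 : ∑ _a : A, ∑ f ∈ V, G (L f) = ∑ a, ∑ f ∈ V, G (L f + a) :=
    Finset.sum_congr rfl fun a _ => h1 a
  rw [Finset.sum_const, Finset.card_univ, nsmul_eq_mul, Finset.sum_comm] at h2
  rw [h2]
  have h3 : ∀ f ∈ V, ∑ a, G (L f + a) = ∑ a, G a := fun f _ =>
    Fintype.sum_equiv (Equiv.addLeft (L f)) _ _ fun a => rfl
  rw [Finset.sum_congr rfl h3, Finset.sum_const, nsmul_eq_mul]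

variable {A A' : Type*} [CommRing A] [Algebra k A] [CommRing A'] [Algebra k A']

theorem map_hval (φ : A →ₐ[k] A') (a b : A) (f : k[X]) :
    φ (hval a b f) = hval (φ a) (φ b) f := by
  by_cases hA : Nontrivial A'
  · have hA2 : Nontrivial A := φ.toRingHom.domain_nontrivial
    rw [hval, hval, eval_eq_sum_range, eval_eq_sum_range, map_sum, natDegree_scaleRoots,
      natDegree_scaleRoots, natDegree_map, natDegree_map]
    refine Finset.sum_congr rfl fun i _ => ?_
    rw [map_mul, map_pow, coeff_scaleRoots, coeff_scaleRoots, coeff_map, coeff_map, map_mul,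
      map_pow, AlgHom.commutes, natDegree_map, natDegree_map]
  · have := not_nontrivial_iff_subsingleton.1 hA
    exact Subsingleton.elim _ _

theorem hval_one_right (a : A) (f : k[X]) : hval a 1 f = aeval a f := by
  rw [hval, scaleRoots_one, eval_map_algebraMap]

theorem hval_one_left [Nontrivial A] (b : A) (f : k[X]) :
    hval 1 b f = aeval b (reflect f.natDegree f) := by
  have h : (reflect f.natDegree f).natDegree < f.natDegree + 1 :=
    Nat.lt_succ_of_le (natDegree_reflect_le.trans (max_self _).le)
  rw [hval, eval_eq_sum_range, natDegree_scaleRoots, natDegree_map,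
    aeval_eq_sum_range' h, ← Finset.sum_range_reflect]
  refine Finset.sum_congr rfl fun i hi => ?_
  have hi' : i ≤ f.natDegree := Nat.lt_succ_iff.1 (Finset.mem_range.1 hi)
  have h2 : f.natDegree + 1 - 1 - i = f.natDegree - i := by omega
  rw [h2, one_pow, mul_one, coeff_scaleRoots, coeff_map, natDegree_map, coeff_reflect,
    revAt_le hi', Algebra.smul_def]
  congr 2
  omega

theorem hval_C_mul (a b : A) {c : k} (hc : c ≠ 0) (f : k[X]) :
    hval a b (C c * f) = algebraMap k A c * hval a b f := by
  by_cases hA : Nontrivial A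
  · rw [hval, hval, eval_eq_sum_range, eval_eq_sum_range, natDegree_scaleRoots,
      natDegree_scaleRoots, natDegree_map, natDegree_map, natDegree_C_mul hc, Finset.mul_sum]
    refine Finset.sum_congr rfl fun i _ => ?_
    rw [coeff_scaleRoots, coeff_scaleRoots, coeff_map, coeff_map, natDegree_map, natDegree_map,
      natDegree_C_mul hc, coeff_C_mul, map_mul]
    ring
  · have := not_nontrivial_iff_subsingleton.1 hA
    exact Subsingleton.elim _ _

theorem isUnit_adjoinRoot_mk {f g : k[X]} :
    IsUnit (AdjoinRoot.mk f g) ↔ IsCoprime g f := by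
  constructor
  · intro h
    obtain ⟨y, hy⟩ := h.exists_right_inv
    obtain ⟨g', rfl⟩ := AdjoinRoot.mk_surjective y
    rw [← map_mul, ← map_one (AdjoinRoot.mk f), AdjoinRoot.mk_eq_mk] at hy
    obtain ⟨z, hz⟩ := hy
    exact ⟨g', -z, by linear_combination hz⟩
  · rintro ⟨x, y, h⟩
    have h2 := congrArg (AdjoinRoot.mk f) h
    rw [map_add, map_mul, map_mul, AdjoinRoot.mk_self, mul_zero, add_zero, map_one] at h2
    exact IsUnit.of_mul_eq_one_right _ h2

/-- Polynomials over a product ring may be prescribed componentwise. -/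
theorem exists_map_eq_pi {ι : Type*} [Fintype ι] {B : ι → Type*} [∀ i, CommRing (B i)]
    (w : ∀ i, (B i)[X]) : ∃ W : (∀ i, B i)[X], ∀ i, W.map (Pi.evalRingHom B i) = w i := by
  let N := Finset.univ.sup (fun i => (w i).natDegree) + 1
  refine ⟨∑ j ∈ Finset.range N, monomial j fun i => (w i).coeff j, fun i => ?_⟩
  rw [Polynomial.map_sum]
  simp only [map_monomial, Pi.evalRingHom_apply]
  exact ((w i).as_sum_range' N (Nat.lt_succ_of_le
    (Finset.le_sup (f := fun i => (w i).natDegree) (Finset.mem_univ i)))).symm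

theorem exists_map_eq_prod {B B' : Type*} [CommRing B] [CommRing B'] (w : B[X]) (w' : B'[X]) :
    ∃ W : (B × B')[X], W.map (RingHom.fst B B') = w ∧ W.map (RingHom.snd B B') = w' := by
  let N := max w.natDegree w'.natDegree + 1
  refine ⟨∑ j ∈ Finset.range N, monomial j (w.coeff j, w'.coeff j), ?_, ?_⟩
  · rw [Polynomial.map_sum]
    simp only [map_monomial, RingHom.coe_fst]
    exact (w.as_sum_range' N (by omega)).symm
  · rw [Polynomial.map_sum]
    simp only [map_monomial, RingHom.coe_snd]
    exact (w'.as_sum_range' N (by omega)).symm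

theorem exists_mul_eq_adjoinRoot {m d : k[X]} (h : m ∣ d) :
    ∃ w : (AdjoinRoot m)[X], (C (AdjoinRoot.root m) - X) * w =
      d.map (algebraMap k (AdjoinRoot m)) := by
  have h1 : (d.map (algebraMap k (AdjoinRoot m))).IsRoot (AdjoinRoot.root m) := by
    rw [IsRoot.def, eval_map_algebraMap, AdjoinRoot.aeval_eq, AdjoinRoot.mk_eq_zero]
    exact h
  obtain ⟨w, hw⟩ := dvd_iff_isRoot.2 h1
  exact ⟨-w, by rw [hw]; ring⟩

theorem exists_mul_eq_of_isNilpotent {S : A} (hS : IsNilpotent S) (d : k[X]) :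
    ∃ w : A[X], (1 - C S * X) * w = d.map (algebraMap k A) := by
  have h1 : IsNilpotent (C S * X : A[X]) :=
    Commute.isNilpotent_mul_right (Commute.all _ _) (hS.map C)
  obtain ⟨u, hu⟩ := h1.isUnit_one_sub
  exact ⟨(u⁻¹ : A[X]ˣ) * d.map (algebraMap k A), by rw [← hu, Units.mul_inv_cancel_left]⟩

end

end LaurentBound

namespace LaurentBound

section

variable {k : Type*} [Field k] [Fintype k]

/-- The reduction of a polynomial of degree at most `n` modulo each `m i`, together with its
`κ` leading coefficients. -/
def locMap {ι : Type*} (m : ι → k[X]) (κ n : ℕ) :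
    k[X] →+ (∀ i, AdjoinRoot (m i)) × AdjoinRoot (X ^ κ : k[X]) :=
  AddMonoidHom.mk' (fun f => (fun i => AdjoinRoot.mk (m i) f, AdjoinRoot.mk _ (reflect n f)))
    fun f g => by
      simp only [map_add, reflect_add]
      rfl

theorem locMap_fst {ι : Type*} (m : ι → k[X]) (κ n : ℕ) (f : k[X]) (i : ι) :
    (locMap m κ n f).1 i = AdjoinRoot.mk (m i) f := rfl

theorem locMap_snd {ι : Type*} (m : ι → k[X]) (κ n : ℕ) (f : k[X]) :
    (locMap m κ n f).2 = AdjoinRoot.mk _ (reflect n f) := rfl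

theorem reflect_mem_lowDeg {n : ℕ} {f : k[X]} (hf : f ∈ lowDeg k (n + 1)) :
    reflect n f ∈ lowDeg k (n + 1) := by
  rw [mem_lowDeg, degree_lt_iff_coeff_zero] at hf ⊢
  intro i hi
  rw [coeff_reflect, revAt_eq_self_of_lt (by omega)]
  exact hf i hi

theorem lowDeg_mono {a b : ℕ} (h : a ≤ b) {f : k[X]} (hf : f ∈ lowDeg k a) : f ∈ lowDeg k b := by
  rw [mem_lowDeg] at hf ⊢
  exact hf.trans_le (by exact_mod_cast h)

theorem X_pow_dvd_reflect {n κ : ℕ} (hκ : κ ≤ n + 1) {f : k[X]} (hf : f ∈ lowDeg k (n + 1 - κ)) :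
    X ^ κ ∣ reflect n f := by
  rw [mem_lowDeg, degree_lt_iff_coeff_zero] at hf
  rw [X_pow_dvd_iff]
  intro i hi
  rw [coeff_reflect, revAt_le (by omega)]
  exact hf _ (by omega)

theorem exists_reflect_eq {n κ : ℕ} (hκ : κ ≤ n + 1) (w : AdjoinRoot (X ^ κ : k[X])) :
    ∃ f ∈ lowDeg k (n + 1), AdjoinRoot.mk (X ^ κ : k[X]) (reflect n f) = w := by
  obtain ⟨g, rfl⟩ := AdjoinRoot.mk_surjective w
  refine ⟨reflect n (g %ₘ X ^ κ), reflect_mem_lowDeg (lowDeg_mono hκ ?_), ?_⟩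
  · rw [mem_lowDeg]
    exact (degree_modByMonic_lt g (monic_X_pow κ)).trans_eq (degree_X_pow κ)
  · rw [reflect_reflect, AdjoinRoot.mk_eq_mk, modByMonic_eq_sub_mul_div]
    exact ⟨-(g /ₘ X ^ κ), by ring⟩

theorem exists_locMap_eq {ι : Type*} [Fintype ι] {m : ι → k[X]} (hm : ∀ i, (m i).Monic)
    (hco : Pairwise fun i j => IsCoprime (m i) (m j)) {n κ : ℕ}
    (hκ : κ + (∏ i, m i).natDegree ≤ n + 1)
    (a : (∀ i, AdjoinRoot (m i)) × AdjoinRoot (X ^ κ : k[X])) :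
    ∃ f ∈ lowDeg k (n + 1), locMap m κ n f = a := by
  obtain ⟨f₀, hf₀, h0⟩ := exists_reflect_eq (n := n) (by omega) a.2
  have hI : Pairwise (Function.onFun IsCoprime fun i => Ideal.span {m i}) := fun i j hij =>
    (Ideal.isCoprime_span_singleton_iff _ _).2 (hco hij)
  obtain ⟨f₁, hf₁⟩ := Ideal.pi_quotient_surjective hI (fun i => a.1 i - AdjoinRoot.mk (m i) f₀)
  have hf₁' : ∀ i, AdjoinRoot.mk (m i) f₁ = a.1 i - AdjoinRoot.mk (m i) f₀ := hf₁
  have hM : (∏ i, m i).Monic := monic_prod_of_monic _ _ fun i _ => hm i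
  have hf₂ : f₁ %ₘ (∏ i, m i) ∈ lowDeg k (n + 1 - κ) := by
    rw [mem_lowDeg]
    refine (degree_modByMonic_lt f₁ hM).trans_le ?_
    rw [degree_eq_natDegree hM.ne_zero]
    exact_mod_cast (by omega : (∏ i, m i).natDegree ≤ n + 1 - κ)
  refine ⟨f₀ + f₁ %ₘ (∏ i, m i), ?_, ?_⟩
  · rw [mem_lowDeg] at hf₀ ⊢
    exact (degree_add_le _ _).trans_lt (max_lt hf₀ (mem_lowDeg.1 (lowDeg_mono (by omega) hf₂)))
  · refine Prod.ext (funext fun i => ?_) ?_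
    · rw [locMap_fst, map_add]
      have h1 : AdjoinRoot.mk (m i) (f₁ %ₘ ∏ i, m i) = AdjoinRoot.mk (m i) f₁ := by
        rw [AdjoinRoot.mk_eq_mk, modByMonic_eq_sub_mul_div, sub_sub_cancel_left, dvd_neg]
        exact (Finset.dvd_prod_of_mem m (Finset.mem_univ i)).mul_right _
      rw [h1, hf₁']
      ring
    · rw [locMap_snd, reflect_add, map_add, h0,
        AdjoinRoot.mk_eq_zero.2 (X_pow_dvd_reflect (by omega) hf₂), add_zero]

theorem not_isUnit_reflect {n κ : ℕ} (hκ : 1 ≤ κ) {f : k[X]} (hf : f ∈ lowDeg k n) :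
    ¬ IsUnit (AdjoinRoot.mk (X ^ κ : k[X]) (reflect n f)) := by
  rw [isUnit_adjoinRoot_mk]
  intro h
  have h1 : X ∣ reflect n f := by
    rw [X_dvd_iff, coeff_reflect, revAt_zero]
    rw [mem_lowDeg, degree_lt_iff_coeff_zero] at hf
    exact hf n le_rfl
  exact not_isUnit_X (h.isUnit_of_dvd' h1 (dvd_pow_self X (by omega)))

theorem isUnit_reflect {n κ : ℕ} {f : k[X]} (hf : f.natDegree = n) (hf0 : f ≠ 0) :
    IsUnit (AdjoinRoot.mk (X ^ κ : k[X]) (reflect n f)) := by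
  rw [isUnit_adjoinRoot_mk]
  refine IsCoprime.pow_right ?_
  rw [isCoprime_comm]
  refine (irreducible_X.coprime_iff_not_dvd).2 fun h => ?_
  rw [X_dvd_iff, coeff_reflect, revAt_zero, ← hf] at h
  exact leadingCoeff_ne_zero.2 hf0 h

section

variable {ι : Type*} [Fintype ι] (m : ι → k[X]) (κ : ℕ)

/-- The first coordinate of the point of the projective line at which norms are computed. -/
def ptA : (∀ i, AdjoinRoot (m i)) × AdjoinRoot (X ^ κ : k[X]) :=
  (fun i => AdjoinRoot.root (m i), 1)

/-- The second coordinate of the point of the projective line at which norms are computed. -/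
def ptB : (∀ i, AdjoinRoot (m i)) × AdjoinRoot (X ^ κ : k[X]) :=
  (1, AdjoinRoot.root (X ^ κ))

theorem nontrivial_adjoinRoot_X_pow (hκ : 1 ≤ κ) : Nontrivial (AdjoinRoot (X ^ κ : k[X])) :=
  AdjoinRoot.nontrivial _ (by
    rw [degree_X_pow]
    exact_mod_cast (by omega : κ ≠ 0))

theorem hval_pt (hκ : 1 ≤ κ) (f : k[X]) :
    hval (ptA m κ) (ptB m κ) f = locMap m κ f.natDegree f := by
  have := nontrivial_adjoinRoot_X_pow (k := k) κ hκ
  refine Prod.ext (funext fun i => ?_) ?_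
  · have h := map_hval (k := k) ((Pi.evalAlgHom k (fun i => AdjoinRoot (m i)) i).comp
      (AlgHom.fst k (∀ i, AdjoinRoot (m i)) (AdjoinRoot (X ^ κ : k[X])))) (ptA m κ) (ptB m κ) f
    have h2 : hval (AdjoinRoot.root (m i)) 1 f = AdjoinRoot.mk (m i) f := by
      rw [hval_one_right, AdjoinRoot.aeval_eq]
    exact h.trans h2
  · have h := map_hval (k := k) (AlgHom.snd k (∀ i, AdjoinRoot (m i)) (AdjoinRoot (X ^ κ : k[X])))
      (ptA m κ) (ptB m κ) f
    have h2 : hval 1 (AdjoinRoot.root (X ^ κ : k[X])) f =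
        AdjoinRoot.mk (X ^ κ) (reflect f.natDegree f) := by
      rw [hval_one_left, AdjoinRoot.aeval_eq]
    exact h.trans h2

theorem exists_pt_mul_eq (hκ : 1 ≤ κ) :
    ∃ w, (C (ptA m κ) - C (ptB m κ) * X) * w = (∏ i, m i).map (algebraMap k _) := by
  have := nontrivial_adjoinRoot_X_pow (k := k) κ hκ
  choose w hw using fun i =>
    exists_mul_eq_adjoinRoot (Finset.dvd_prod_of_mem m (Finset.mem_univ i))
  have hS : IsNilpotent (AdjoinRoot.root (X ^ κ : k[X])) := ⟨κ, by
    rw [← AdjoinRoot.mk_X, ← map_pow, AdjoinRoot.mk_self]⟩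
  obtain ⟨w', hw'⟩ := exists_mul_eq_of_isNilpotent (k := k) hS (∏ i, m i)
  obtain ⟨v, hv⟩ := exists_map_eq_pi w
  obtain ⟨u, hu1, hu2⟩ := exists_map_eq_prod v w'
  refine ⟨u, ?_⟩
  have hinj : ∀ F G : ((∀ i, AdjoinRoot (m i)) × AdjoinRoot (X ^ κ : k[X]))[X],
      (∀ i, (F.map (RingHom.fst _ _)).map (Pi.evalRingHom _ i) =
        (G.map (RingHom.fst _ _)).map (Pi.evalRingHom _ i)) →
      F.map (RingHom.snd _ _) = G.map (RingHom.snd _ _) → F = G := by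
    intro F G h1 h2
    ext1 j
    refine Prod.ext (funext fun i => ?_) ?_
    · have := congrArg (fun p => p.coeff j) (h1 i)
      simp only [coeff_map] at this
      exact this
    · have := congrArg (fun p => p.coeff j) h2
      simp only [coeff_map] at this
      exact this
  refine hinj _ _ (fun i => ?_) ?_
  · simp only [Polynomial.map_mul, Polynomial.map_sub, map_C, map_X, hu1, hv, Polynomial.map_map]
    have h1 : Pi.evalRingHom (fun i => AdjoinRoot (m i)) i (RingHom.fst _ _ (ptB m κ)) = 1 := rfl
    have h2 : Pi.evalRingHom (fun i => AdjoinRoot (m i)) i (RingHom.fst _ _ (ptA m κ)) =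
      AdjoinRoot.root (m i) := rfl
    rw [h1, h2, C_1, one_mul]
    exact hw i
  · simp only [Polynomial.map_mul, Polynomial.map_sub, map_C, map_X, hu2, Polynomial.map_map]
    have h1 : RingHom.snd (∀ i, AdjoinRoot (m i)) _ (ptB m κ) = AdjoinRoot.root (X ^ κ) := rfl
    have h2 : RingHom.snd (∀ i, AdjoinRoot (m i)) _ (ptA m κ) = 1 := rfl
    rw [h1, h2, C_1]
    exact hw'

theorem isUnit_loc_iff {x : (∀ i, AdjoinRoot (m i)) × AdjoinRoot (X ^ κ : k[X])} :
    IsUnit x ↔ (∀ i, IsUnit (x.1 i)) ∧ IsUnit x.2 := by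
  rw [Prod.isUnit_iff, Pi.isUnit_iff]

theorem finite_loc (hm : ∀ i, (m i).Monic) :
    Module.Finite k ((∀ i, AdjoinRoot (m i)) × AdjoinRoot (X ^ κ : k[X])) := by
  have h1 : ∀ i, Module.Finite k (AdjoinRoot (m i)) := fun i => (hm i).finite_adjoinRoot
  have h2 : Module.Finite k (AdjoinRoot (X ^ κ : k[X])) := (monic_X_pow κ).finite_adjoinRoot
  infer_instance

variable {m κ}

theorem neg_mem_lowDeg {n : ℕ} : ∀ f ∈ lowDeg k n, -f ∈ lowDeg k n := fun f hf => by
  rw [mem_lowDeg] at hf ⊢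
  rwa [degree_neg]

theorem add_mem_lowDeg {n : ℕ} : ∀ f ∈ lowDeg k n, ∀ g ∈ lowDeg k n, f + g ∈ lowDeg k n :=
  fun f hf g hg => by
    rw [mem_lowDeg] at hf hg ⊢
    exact (degree_add_le _ _).trans_lt (max_lt hf hg)

theorem cSum_hval_eq_zero (hm : ∀ i, (m i).Monic)
    (hco : Pairwise fun i j => IsCoprime (m i) (m j)) (hκ : 1 ≤ κ)
    (χ : MulChar ((∀ i, AdjoinRoot (m i)) × AdjoinRoot (X ^ κ : k[X])) ℂ) (hχ : χ ≠ 1)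
    (hc : ∀ c : kˣ, χ (algebraMap k _ c) = 1) {n : ℕ} (hn : κ + (∏ i, m i).natDegree ≤ n + 1) :
    cSum (fun f : k[X] => χ (hval (ptA m κ) (ptB m κ) f)) n = 0 := by
  have := finite_loc m κ hm
  have : Finite ((∀ i, AdjoinRoot (m i)) × AdjoinRoot (X ^ κ : k[X])) := Module.finite_of_finite k
  have : Fintype ((∀ i, AdjoinRoot (m i)) × AdjoinRoot (X ^ κ : k[X])) := Fintype.ofFinite _
  have h1 := card_mul_sum_comp (locMap m κ n) (lowDeg k (n + 1)) add_mem_lowDeg neg_mem_lowDeg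
    (exists_locMap_eq hm hco hn) χ
  rw [MulChar.sum_eq_zero_of_ne_one hχ, mul_zero, sum_lowDeg_succ] at h1
  have h2 : ∑ f ∈ lowDeg k n, χ (locMap m κ n f) = 0 := Finset.sum_eq_zero fun f hf => by
    refine χ.map_nonunit fun hu => not_isUnit_reflect hκ hf ?_
    exact ((isUnit_loc_iff m κ).1 hu).2
  have h3 : ∀ f ∈ monics k n, ∑ c : kˣ, χ (locMap m κ n (C (c : k) * f)) =
      Fintype.card kˣ * χ (hval (ptA m κ) (ptB m κ) f) := by
    intro f hf
    have h4 : ∀ c : kˣ, χ (locMap m κ n (C (c : k) * f)) = χ (hval (ptA m κ) (ptB m κ) f) := by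
      intro c
      have h5 : (C (c : k) * f).natDegree = n := by
        rw [natDegree_C_mul c.ne_zero, (mem_monics.1 hf).2]
      have h6 := hval_pt m κ hκ (C (c : k) * f)
      rw [h5] at h6
      rw [← h6, hval_C_mul _ _ c.ne_zero, map_mul, hc, one_mul]
    simp only [h4, Finset.sum_const, Finset.card_univ, nsmul_eq_mul]
  rw [h2, zero_add, Finset.sum_congr rfl h3, ← Finset.mul_sum] at h1
  have h7 := (mul_eq_zero.1 h1).resolve_left (by exact_mod_cast Fintype.card_ne_zero)
  exact (mul_eq_zero.1 h7).resolve_left (by exact_mod_cast Fintype.card_ne_zero)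

end

end

end LaurentBound

namespace LaurentBound

section

/-- The sum over the units of a finite ring. -/
def uSum {B E : Type*} [CommRing B] [Finite B] [AddCommMonoid E] (g : B → E) : E :=
  ∑ᶠ u : Bˣ, g u

theorem uSum_eq_sum_units {B E : Type*} [CommRing B] [Finite B] [AddCommMonoid E] [Fintype Bˣ]
    (g : B → E) : uSum g = ∑ u : Bˣ, g u := finsum_eq_sum_of_fintype _

theorem uSum_eq_sum_ite {B E : Type*} [CommRing B] [Fintype B] [AddCommMonoid E]
    (g : B → E) : uSum g = ∑ u : B, if IsUnit u then g u else 0 := by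
  rw [uSum_eq_sum_units, ← Finset.sum_filter]
  refine Finset.sum_bij (fun u _ => (u : B)) ?_ ?_ ?_ fun _ _ => rfl
  · intro u _
    rw [Finset.mem_filter]
    exact ⟨Finset.mem_univ _, u.isUnit⟩
  · exact fun u _ v _ h => Units.ext h
  · intro u hu
    obtain ⟨v, rfl⟩ := (Finset.mem_filter.1 hu).2
    exact ⟨v, Finset.mem_univ _, rfl⟩

theorem uSum_one {B : Type*} [CommRing B] [Finite B] : uSum (fun _ : B => (1 : ℂ)) = Nat.card Bˣ := by
  have := Fintype.ofFinite Bˣ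
  rw [uSum_eq_sum_units]
  simp

theorem uSum_prod {ι : Type*} [Fintype ι] {B : ι → Type*} [∀ i, CommRing (B i)]
    [∀ i, Finite (B i)] {B' : Type*} [CommRing B'] [Finite B'] {E : Type*} [CommSemiring E]
    (F : ∀ i, B i → E) (H : B' → E) :
    uSum (fun x : (∀ i, B i) × B' => (∏ i, F i (x.1 i)) * H x.2) = (∏ i, uSum (F i)) * uSum H := by
  have := fun i => Fintype.ofFinite (B i)
  have := Fintype.ofFinite B'
  simp only [uSum_eq_sum_ite]
  rw [Finset.prod_univ_sum, Finset.sum_mul_sum, Fintype.piFinset_univ, ← Finset.sum_product']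
  refine Finset.sum_congr rfl fun x _ => ?_
  by_cases h1 : ∀ i, IsUnit (x.1 i)
  · by_cases h2 : IsUnit x.2
    · rw [if_pos (Prod.isUnit_iff.2 ⟨Pi.isUnit_iff.2 h1, h2⟩), if_pos h2]
      congr 1
      exact Finset.prod_congr rfl fun i _ => (if_pos (h1 i)).symm
    · rw [if_neg fun h => h2 (Prod.isUnit_iff.1 h).2, if_neg h2, mul_zero]
  · rw [if_neg fun h => h1 (Pi.isUnit_iff.1 (Prod.isUnit_iff.1 h).1)]
    push Not at h1
    obtain ⟨i, hi⟩ := h1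
    rw [Finset.prod_eq_zero (Finset.mem_univ i) (if_neg hi), zero_mul]

variable {k : Type*} [Field k] [Fintype k]

theorem finite_adjoinRoot {f : k[X]} (hf : f.Monic) : Finite (AdjoinRoot f) :=
  have : Module.Finite k (AdjoinRoot f) := hf.finite_adjoinRoot
  Module.finite_of_finite k

theorem uSum_reflect {κ : ℕ} (hκ : 1 ≤ κ) [Finite (AdjoinRoot (X ^ κ : k[X]))]
    {n : ℕ} (hn : κ ≤ n + 1) (H : AdjoinRoot (X ^ κ : k[X]) → ℂ) :
    (Nat.card (AdjoinRoot (X ^ κ : k[X])) : ℂ) * ∑ f ∈ monics k n, ∑ c : kˣ,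
      H (AdjoinRoot.mk _ (reflect n (C (c : k) * f))) = Fintype.card k ^ (n + 1) * uSum H := by
  have := Fintype.ofFinite (AdjoinRoot (X ^ κ : k[X]))
  let L : k[X] →+ AdjoinRoot (X ^ κ : k[X]) :=
    AddMonoidHom.mk' (fun f => AdjoinRoot.mk _ (reflect n f)) fun f g => by
      simp only [map_add, reflect_add]
  have h1 := card_mul_sum_comp L (lowDeg k (n + 1)) add_mem_lowDeg neg_mem_lowDeg
    (exists_reflect_eq hn) fun u => if IsUnit u then H u else 0
  rw [card_lowDeg, sum_lowDeg_succ] at h1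
  have h2 : ∑ f ∈ lowDeg k n, (if IsUnit (L f) then H (L f) else 0) = 0 :=
    Finset.sum_eq_zero fun f hf => if_neg (not_isUnit_reflect hκ hf)
  have h3 : ∀ f ∈ monics k n, ∀ c : kˣ, IsUnit (L (C (c : k) * f)) := by
    intro f hf c
    refine isUnit_reflect ?_ (mul_ne_zero (C_ne_zero.2 c.ne_zero) (mem_monics.1 hf).1.ne_zero)
    rw [natDegree_C_mul c.ne_zero, (mem_monics.1 hf).2]
  rw [h2, zero_add, Finset.sum_congr rfl fun f hf => Finset.sum_congr rfl fun c _ =>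
    if_pos (h3 f hf c), ← uSum_eq_sum_ite, ← Nat.card_eq_fintype_card] at h1
  rw [← Nat.cast_pow]
  exact h1

/-- Irreducible polynomials of degree `n` equidistribute in residue classes modulo several
coprime moduli and with prescribed leading coefficients. -/
theorem norm_irreds_local_le {ι : Type*} [Fintype ι] {m : ι → k[X]} (hm : ∀ i, (m i).Monic)
    (hco : Pairwise fun i j => IsCoprime (m i) (m j)) {κ n : ℕ} (hκ : 1 ≤ κ) (hκn : κ ≤ n + 1)
    (hn : 1 ≤ n) [∀ i, Finite (AdjoinRoot (m i))] [Finite (AdjoinRoot (X ^ κ : k[X]))]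
    (hP : ∀ P ∈ irreds k n, ∀ i, IsCoprime P (m i))
    (F : ∀ i, AdjoinRoot (m i) → ℂ) (H : AdjoinRoot (X ^ κ : k[X]) → ℂ) :
    ‖∑ P ∈ irreds k n, ∑ c : kˣ, n * ((∏ i, F i (AdjoinRoot.mk (m i) (C (c : k) * P))) *
          H (AdjoinRoot.mk _ (reflect n (C (c : k) * P)))) -
        (∏ i, uSum (F i) / Nat.card (AdjoinRoot (m i))ˣ) * ∑ f ∈ monics k n, ∑ c : kˣ,
          H (AdjoinRoot.mk _ (reflect n (C (c : k) * f)))‖ ≤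
      (Fintype.card k - 1) * ((n + (κ + (∏ i, m i).natDegree : ℕ)) * √(Fintype.card k : ℝ) ^ n) *
        √((∏ i, uSum fun u => ‖F i u‖ ^ 2) * uSum fun w => ‖H w‖ ^ 2) := by
  have := finite_loc m κ hm
  have : Fintype ((∀ i, AdjoinRoot (m i)) × AdjoinRoot (X ^ κ : k[X]))ˣ := Fintype.ofFinite _
  have := nontrivial_adjoinRoot_X_pow (k := k) κ hκ
  obtain ⟨w, hw⟩ := exists_pt_mul_eq m κ hκ
  have hM : (∏ i, m i).Monic := monic_prod_of_monic _ _ fun i _ => hm i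
  have hdeg : ∀ P ∈ irreds k n, ∀ c : kˣ, (C (c : k) * P).natDegree = n := fun P hP c => by
    rw [natDegree_C_mul c.ne_zero, (mem_irreds.1 hP).2.1]
  have key := norm_irreds_sub_avg_le (ptA m κ) (ptB m κ) hM.ne_zero hw
    (h := κ + (∏ i, m i).natDegree)
    (fun χ h1 h2 l hl => cSum_hval_eq_zero hm hco hκ χ h1 h2 (by omega)) hn (fun P hPn => ?_)
    fun x => (∏ i, F i (x.1 i)) * H x.2
  · have h1 : ∀ P ∈ irreds k n, ∀ c : kˣ,
        algebraMap k ((∀ i, AdjoinRoot (m i)) × AdjoinRoot (X ^ κ : k[X])) c *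
          hval (ptA m κ) (ptB m κ) P = locMap m κ n (C (c : k) * P) := by
      intro P hP c
      rw [← hval_C_mul _ _ c.ne_zero, hval_pt m κ hκ, hdeg P hP c]
    rw [Finset.sum_congr rfl fun P hP => Finset.sum_congr rfl fun c _ => by rw [h1 P hP c]] at key
    have h2 : ((Fintype.card k - 1) * Fintype.card k ^ n : ℂ) *
        ((∑ u : ((∀ i, AdjoinRoot (m i)) × AdjoinRoot (X ^ κ : k[X]))ˣ,
          (∏ i, F i (u.val.1 i)) * H u.val.2) / Nat.card
          ((∀ i, AdjoinRoot (m i)) × AdjoinRoot (X ^ κ : k[X]))ˣ) =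
        (∏ i, uSum (F i) / Nat.card (AdjoinRoot (m i))ˣ) * ∑ f ∈ monics k n, ∑ c : kˣ,
          H (AdjoinRoot.mk _ (reflect n (C (c : k) * f))) := by
      have h3 := uSum_prod F H
      have h4 := uSum_prod (fun i (_ : AdjoinRoot (m i)) => (1 : ℂ))
        (fun _ : AdjoinRoot (X ^ κ : k[X]) => (1 : ℂ))
      simp only [Finset.prod_const_one, one_mul, uSum_one] at h4
      have h5 := uSum_reflect hκ hκn H
      have h6 := uSum_reflect (k := k) hκ hκn fun _ => 1
      rw [uSum_one] at h6
      simp only [Finset.sum_const, Finset.card_univ, card_monics, nsmul_eq_mul, mul_one,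
        Fintype.card_units] at h6
      rw [Nat.cast_sub Fintype.card_pos, Nat.cast_one] at h6
      push_cast at h6
      rw [uSum_eq_sum_units] at h3
      have hne1 : ∀ i, (Nat.card (AdjoinRoot (m i))ˣ : ℂ) ≠ 0 := fun i => by
        exact_mod_cast Nat.card_pos.ne'
      have hne2 : (Nat.card (AdjoinRoot (X ^ κ : k[X]))ˣ : ℂ) ≠ 0 := by
        exact_mod_cast Nat.card_pos.ne'
      have hne3 : (Nat.card (AdjoinRoot (X ^ κ : k[X])) : ℂ) ≠ 0 := by
        exact_mod_cast Nat.card_pos.ne'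
      have hne4 : ∏ i, (Nat.card (AdjoinRoot (m i))ˣ : ℂ) ≠ 0 :=
        Finset.prod_ne_zero_iff.2 fun i _ => hne1 i
      have hq : (Fintype.card k : ℂ) ≠ 0 := by exact_mod_cast Fintype.card_ne_zero
      rw [h3, h4, Finset.prod_div_distrib]
      have h7 : (Fintype.card k - 1) * (Fintype.card k : ℂ) ^ n * uSum H =
          Nat.card (AdjoinRoot (X ^ κ : k[X]))ˣ * ∑ f ∈ monics k n, ∑ c : kˣ,
          H (AdjoinRoot.mk _ (reflect n (C (c : k) * f))) := by
        refine mul_left_cancel₀ (mul_ne_zero hne3 (pow_ne_zero (n + 1) hq)) ?_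
        linear_combination (Fintype.card k : ℂ) ^ (n + 1) * uSum H * h6 -
          (Fintype.card k : ℂ) ^ (n + 1) * Nat.card (AdjoinRoot (X ^ κ : k[X]))ˣ * h5
      rw [← mul_div_assoc, mul_left_comm, h7]
      field_simp
    have h3 : ∑ u : ((∀ i, AdjoinRoot (m i)) × AdjoinRoot (X ^ κ : k[X]))ˣ,
        ‖(∏ i, F i (u.val.1 i)) * H u.val.2‖ ^ 2 =
        (∏ i, uSum fun u => ‖F i u‖ ^ 2) * uSum fun w => ‖H w‖ ^ 2 := by
      rw [← uSum_prod, uSum_eq_sum_units]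
      refine Finset.sum_congr rfl fun u _ => ?_
      rw [norm_mul, norm_prod, mul_pow, Finset.prod_pow]
    rw [h2, h3] at key
    exact key
  · rw [hval_pt m κ hκ, isUnit_loc_iff, (mem_irreds.1 hPn).2.1]
    refine ⟨fun i => ?_, isUnit_reflect (mem_irreds.1 hPn).2.1 (mem_irreds.1 hPn).1.ne_zero⟩
    rw [locMap_fst, isUnit_adjoinRoot_mk]
    exact hP P hPn i

end

end LaurentBound

namespace LaurentBound

section

variable {k : Type*} [Field k] [Fintype k]

theorem norm_addChar (ψ : AddChar k[X] ℂ) (f : k[X]) : ‖ψ f‖ = 1 := by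
  refine Complex.norm_eq_one_of_pow_eq_one (n := Fintype.card k) ?_ Fintype.card_ne_zero
  have h : Fintype.card k • f = 0 := by
    rw [nsmul_eq_mul, ← C_eq_natCast, FiniteField.cast_card_eq_zero, C_0, zero_mul]
  rw [← AddChar.map_nsmul_eq_pow, h, AddChar.map_zero_eq_one]

theorem sum_adjoinRoot {m : k[X]} (hm : m.Monic) [Fintype (AdjoinRoot m)] {E : Type*}
    [AddCommMonoid E] (F : AdjoinRoot m → E) :
    ∑ u, F u = ∑ f ∈ lowDeg k m.natDegree, F (AdjoinRoot.mk m f) := by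
  symm
  refine Finset.sum_bij (fun f _ => AdjoinRoot.mk m f) (fun _ _ => Finset.mem_univ _) ?_ ?_
    fun _ _ => rfl
  · intro f hf g hg h
    rw [AdjoinRoot.mk_eq_mk] at h
    rw [mem_lowDeg, ← degree_eq_natDegree hm.ne_zero] at hf hg
    have h1 := eq_zero_of_dvd_of_degree_lt h
      ((degree_sub_le _ _).trans_lt (max_lt hf hg))
    exact sub_eq_zero.1 h1
  · intro u _
    obtain ⟨f, rfl⟩ := AdjoinRoot.mk_surjective u
    refine ⟨f %ₘ m, ?_, ?_⟩
    · rw [mem_lowDeg, ← degree_eq_natDegree hm.ne_zero]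
      exact degree_modByMonic_lt f hm
    · rw [AdjoinRoot.mk_eq_mk, modByMonic_eq_sub_mul_div, sub_sub_cancel_left, dvd_neg]
      exact dvd_mul_right _ _

theorem card_adjoinRoot {m : k[X]} (hm : m.Monic) [Fintype (AdjoinRoot m)] :
    Fintype.card (AdjoinRoot m) = Fintype.card k ^ m.natDegree := by
  have h := sum_adjoinRoot hm fun _ => 1
  rwa [Finset.sum_const, Finset.sum_const, smul_eq_mul, smul_eq_mul, mul_one, mul_one,
    Finset.card_univ, card_lowDeg] at h

/-- The function on `k[X]/(m)` induced by a function on `k[X]`, through a choice of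
representatives. -/
def quotFun (m : k[X]) (G : k[X] → ℂ) (u : AdjoinRoot m) : ℂ :=
  G (Function.surjInv (AdjoinRoot.mk_surjective (g := m)) u)

theorem quotFun_mk {m : k[X]} {G : k[X] → ℂ} (hG : ∀ f g, m ∣ f - g → G f = G g) (f : k[X]) :
    quotFun m G (AdjoinRoot.mk m f) = G f := by
  refine hG _ _ ?_
  rw [← AdjoinRoot.mk_eq_mk]
  exact Function.surjInv_eq _ _

variable {r : k[X]} (hr : r.Monic) (hi : Irreducible r)
include hr hi

theorem isUnit_mk_pow {e : ℕ} (he : 1 ≤ e) {f : k[X]} :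
    IsUnit (AdjoinRoot.mk (r ^ e) f) ↔ ¬ r ∣ f := by
  rw [isUnit_adjoinRoot_mk, IsCoprime.pow_right_iff (by omega), isCoprime_comm,
    hi.coprime_iff_not_dvd]

/-- A primitive character of conductor divisible by `r ^ 2` averages to zero over units. -/
theorem uSum_quotFun_eq_zero {e : ℕ} (he : 2 ≤ e) [Finite (AdjoinRoot (r ^ e))]
    (ψ : AddChar k[X] ℂ) {h : k[X]} (hh : ψ (r ^ (e - 1) * h) ≠ 1) {G : k[X] → ℂ}
    (hG : ∀ f g, r ^ e ∣ f - g → G f = G g)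
    (hGψ : ∀ f g, G (f + r ^ (e - 1) * g) = ψ (r ^ (e - 1) * g) * G f) :
    uSum (quotFun (r ^ e) G) = 0 := by
  have := Fintype.ofFinite (AdjoinRoot (r ^ e))
  have h1 : ψ (r ^ (e - 1) * h) * uSum (quotFun (r ^ e) G) = uSum (quotFun (r ^ e) G) := by
    rw [uSum_eq_sum_ite, Finset.mul_sum]
    refine Fintype.sum_equiv (Equiv.addRight (AdjoinRoot.mk (r ^ e) (r ^ (e - 1) * h))) _ _
      fun u => ?_
    obtain ⟨f, rfl⟩ := AdjoinRoot.mk_surjective u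
    rw [Equiv.coe_addRight]
    beta_reduce
    rw [← map_add, quotFun_mk hG, quotFun_mk hG, hGψ, mul_ite, mul_zero]
    simp only [isUnit_mk_pow hr hi (by omega : 1 ≤ e),
      dvd_add_left ((dvd_pow_self r (by omega : e - 1 ≠ 0)).mul_right h)]
  have h2 : (ψ (r ^ (e - 1) * h) - 1) * uSum (quotFun (r ^ e) G) = 0 := by
    rw [sub_mul, h1, one_mul, sub_self]
  exact (mul_eq_zero.1 h2).resolve_left (sub_ne_zero.2 hh)

theorem uSum_quotFun_eq_sum {e : ℕ} (he : 1 ≤ e) [Finite (AdjoinRoot (r ^ e))] {G : k[X] → ℂ}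
    (hG : ∀ f g, r ^ e ∣ f - g → G f = G g) :
    uSum (quotFun (r ^ e) G) =
      ∑ f ∈ lowDeg k (e * r.natDegree), if ¬ r ∣ f then G f else 0 := by
  have := Fintype.ofFinite (AdjoinRoot (r ^ e))
  rw [uSum_eq_sum_ite, sum_adjoinRoot (hr.pow e), natDegree_pow]
  exact Finset.sum_congr rfl fun f _ => by
    simp only [isUnit_mk_pow hr hi he, quotFun_mk hG]

omit hr in
theorem dvd_iff_eq_zero_of_mem_lowDeg {f : k[X]} (hf : f ∈ lowDeg k r.natDegree) :
    r ∣ f ↔ f = 0 := by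
  rw [mem_lowDeg, ← degree_eq_natDegree hi.ne_zero] at hf
  exact ⟨fun h => eq_zero_of_dvd_of_degree_lt h hf, fun h => h ▸ dvd_zero r⟩

omit hr in
theorem C_mem_lowDeg (c : k) : C c ∈ lowDeg k r.natDegree := by
  rw [mem_lowDeg]
  exact degree_C_le.trans_lt (by exact_mod_cast hi.natDegree_pos)

theorem card_units_adjoinRoot [Finite (AdjoinRoot (r ^ 1))] :
    (Nat.card (AdjoinRoot (r ^ 1))ˣ : ℂ) = Fintype.card k ^ r.natDegree - 1 := by
  have := Fintype.ofFinite (AdjoinRoot (r ^ 1))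
  rw [← uSum_one, uSum_eq_sum_ite, sum_adjoinRoot (hr.pow 1), natDegree_pow, one_mul]
  have h0 : (0 : k[X]) ∈ lowDeg k r.natDegree := by simpa using C_mem_lowDeg hi 0
  rw [← Finset.add_sum_erase _ _ h0, if_neg, zero_add]
  · rw [Finset.sum_congr rfl (g := fun _ => (1 : ℂ)), Finset.sum_const,
      Finset.card_erase_of_mem h0, card_lowDeg, nsmul_eq_mul, mul_one,
      Nat.cast_sub (Nat.one_le_pow _ _ Fintype.card_pos)]
    · simp
    · intro f hf
      rw [if_pos]
      rw [isUnit_mk_pow hr hi le_rfl, dvd_iff_eq_zero_of_mem_lowDeg hi (Finset.mem_of_mem_erase hf)]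
      exact Finset.ne_of_mem_erase hf
  · rw [isUnit_mk_pow hr hi le_rfl]
    simp

/-- The average over units of a primitive character of prime conductor. -/
theorem uSum_quotFun_sub_one [Finite (AdjoinRoot (r ^ 1))] (ψ : AddChar k[X] ℂ) {h : k[X]}
    (hh : ψ h ≠ 1) (hψ : ∀ f, r ∣ f → ψ f = 1) :
    uSum (quotFun (r ^ 1) fun f => ψ (f - 1)) = -ψ (-1) := by
  have := Fintype.ofFinite (AdjoinRoot (r ^ 1))
  have hG : ∀ f g : k[X], r ^ 1 ∣ f - g → ψ (f - 1) = ψ (g - 1) := by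
    intro f g hfg
    rw [pow_one] at hfg
    have h1 : f - 1 = (f - g) + (g - 1) := by ring
    rw [h1, AddChar.map_add_eq_mul, hψ _ hfg, one_mul]
  have h1 : ψ h * ∑ u, quotFun (r ^ 1) (fun f => ψ (f - 1)) u =
      ∑ u, quotFun (r ^ 1) (fun f => ψ (f - 1)) u := by
    rw [Finset.mul_sum]
    refine Fintype.sum_equiv (Equiv.addRight (AdjoinRoot.mk (r ^ 1) h)) _ _ fun u => ?_
    obtain ⟨f, rfl⟩ := AdjoinRoot.mk_surjective u
    rw [Equiv.coe_addRight]
    beta_reduce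
    rw [← map_add, quotFun_mk hG, quotFun_mk hG, ← AddChar.map_add_eq_mul]
    congr 1
    ring
  have h2 : (ψ h - 1) * ∑ u, quotFun (r ^ 1) (fun f => ψ (f - 1)) u = 0 := by
    rw [sub_mul, h1, one_mul, sub_self]
  have h3 := (mul_eq_zero.1 h2).resolve_left (sub_ne_zero.2 hh)
  have h0 : (0 : k[X]) ∈ lowDeg k r.natDegree := by simpa using C_mem_lowDeg hi 0
  rw [sum_adjoinRoot (hr.pow 1), natDegree_pow, one_mul, ← Finset.add_sum_erase _ _ h0,
    quotFun_mk hG, zero_sub] at h3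
  rw [uSum_quotFun_eq_sum hr hi le_rfl hG, one_mul, ← Finset.add_sum_erase _ _ h0,
    if_neg (not_not.2 (dvd_zero r)), zero_add, ← sub_eq_zero, ← h3, sub_neg_eq_add, add_comm]
  congr 1
  refine Finset.sum_congr rfl fun f hf => ?_
  rw [if_pos, quotFun_mk hG]
  rw [dvd_iff_eq_zero_of_mem_lowDeg hi (Finset.mem_of_mem_erase hf)]
  exact Finset.ne_of_mem_erase hf

omit hr hi

variable (k) in
/-- The parameter of the local weights: `0` in characteristic two and `1` otherwise. -/
def sPar : ℝ := if (2 : k) = 0 then 0 else 1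

/-- The local weight at `r`, supported on `r ∣ f` and `r ∣ f - 1`. -/
def locWt (r f : k[X]) : ℝ :=
  (1 + sPar k) * (if r ∣ f then 1 else 0) - sPar k * (if r ∣ f - 1 then 1 else 0)

/-- The size of the unit group modulo an irreducible `r`. -/
def phi (r : k[X]) : ℝ := Fintype.card k ^ r.natDegree - 1

theorem locWt_congr {r f g : k[X]} (h : r ∣ f - g) : locWt r f = locWt r g := by
  have h1 : r ∣ f ↔ r ∣ g := by
    rw [← sub_add_cancel f g, dvd_add_right h]
  have h2 : r ∣ f - 1 ↔ r ∣ g - 1 := by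
    rw [show f - 1 = (f - g) + (g - 1) by ring, dvd_add_right h]
  simp only [locWt, h1, h2]

include hr hi

theorem uSum_quotFun_locWt [Finite (AdjoinRoot (r ^ 1))] (ψ : AddChar k[X] ℂ)
    (hψ : ∀ f, r ∣ f → ψ f = 1) :
    uSum (quotFun (r ^ 1) fun f => (locWt r (f - 1) : ℂ) * ψ (f - 1)) =
      (1 + sPar k) - sPar k * ψ 1 := by
  have hG : ∀ f g : k[X], r ^ 1 ∣ f - g →
      (locWt r (f - 1) : ℂ) * ψ (f - 1) = (locWt r (g - 1) : ℂ) * ψ (g - 1) := by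
    intro f g hfg
    rw [pow_one] at hfg
    have h1 : f - 1 = (f - g) + (g - 1) := by ring
    rw [locWt_congr (by rwa [sub_sub_sub_cancel_right]), h1, AddChar.map_add_eq_mul,
      hψ _ hfg, one_mul]
  rw [uSum_quotFun_eq_sum hr hi le_rfl hG, one_mul]
  have hone : (1 : k[X]) ∈ lowDeg k r.natDegree := by simpa using C_mem_lowDeg hi (1 : k)
  have htwo : (1 + 1 : k[X]) ∈ lowDeg k r.natDegree := by
    have h := C_mem_lowDeg hi (1 + 1 : k)
    rwa [C_add, C_1] at h
  have hsub : ∀ f ∈ lowDeg k r.natDegree, ∀ g ∈ lowDeg k r.natDegree, (r ∣ f - g ↔ f = g) := by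
    intro f hf g hg
    rw [dvd_iff_eq_zero_of_mem_lowDeg hi, sub_eq_zero]
    rw [sub_eq_add_neg]
    exact add_mem_lowDeg _ hf _ (neg_mem_lowDeg _ hg)
  have hnd : ¬ r ∣ 1 := by
    rw [dvd_iff_eq_zero_of_mem_lowDeg hi hone]
    exact one_ne_zero
  have h1 : ∀ f ∈ lowDeg k r.natDegree,
      (if ¬ r ∣ f then (locWt r (f - 1) : ℂ) * ψ (f - 1) else 0) =
      (if f = 1 then (1 + sPar k : ℂ) else 0) - (if f = 1 + 1 then sPar k * ψ 1 else 0) := by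
    intro f hf
    have e1 : r ∣ f - 1 ↔ f = 1 := hsub f hf 1 hone
    have e2 : r ∣ f - 1 - 1 ↔ f = 1 + 1 := by
      rw [sub_sub]
      exact hsub f hf _ htwo
    have h12 : (1 : k[X]) ≠ 1 + 1 := fun h => one_ne_zero (left_eq_add.1 h)
    simp only [locWt, e1, e2]
    by_cases ha : f = 1
    · subst ha
      rw [if_pos hnd, if_pos rfl, if_neg h12, if_pos rfl, if_neg h12]
      simp
    · by_cases hb : f = 1 + 1
      · subst hb
        by_cases hs : (2 : k) = 0
        · have hs0 : sPar k = 0 := if_pos hs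
          simp [hs0, ha]
        · have h2 : ¬ r ∣ (1 + 1 : k[X]) := by
            rw [dvd_iff_eq_zero_of_mem_lowDeg hi htwo, ← C_1, ← C_add, C_eq_zero, one_add_one_eq_two]
            exact hs
          rw [if_pos h2]
          simp [ha]
      · simp [ha, hb]
  rw [Finset.sum_congr rfl h1, Finset.sum_sub_distrib, Finset.sum_ite_eq', Finset.sum_ite_eq',
    if_pos hone, if_pos htwo]

end

end LaurentBound

namespace LaurentBound

section

variable {k : Type*} [Field k] [Fintype k]

/-- The average over units of the weight at a prime of the sieve. -/
def inAvg (e : ℕ) (ψ : AddChar k[X] ℂ) : ℂ :=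
  if e = 1 then (1 + sPar k) - sPar k * ψ 1 else 0

/-- The average over units of a primitive local character. -/
def outAvg (r : k[X]) (e : ℕ) (ψ : AddChar k[X] ℂ) : ℂ :=
  if e = 1 then -ψ (-1) / phi r else 0

theorem one_le_phi {r : k[X]} (hi : Irreducible r) : 1 ≤ phi r := by
  have h1 : (2 : ℝ) ≤ Fintype.card k := by exact_mod_cast Fintype.one_lt_card
  have h2 : (Fintype.card k : ℝ) ^ 1 ≤ (Fintype.card k : ℝ) ^ r.natDegree :=
    pow_le_pow_right₀ (by linarith) hi.natDegree_pos
  rw [pow_one] at h2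
  rw [phi]
  linarith

theorem addChar_congr {m : k[X]} {ψ : AddChar k[X] ℂ} (hψ : ∀ f, m ∣ f → ψ f = 1) {f g : k[X]}
    (h : m ∣ f - g) : ψ f = ψ g := by
  rw [← sub_add_cancel f g, AddChar.map_add_eq_mul, hψ _ h, one_mul]

variable {r : k[X]} (hr : r.Monic) (hi : Irreducible r)
include hr hi

theorem uSum_in_div {e : ℕ} (he : 1 ≤ e) [Finite (AdjoinRoot (r ^ e))] {ψ : AddChar k[X] ℂ}
    (hψ : ∀ f, r ^ e ∣ f → ψ f = 1) (hp : 2 ≤ e → ∃ h, ψ (r ^ (e - 1) * h) ≠ 1) :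
    uSum (quotFun (r ^ e) fun f => ((phi r * locWt r (f - 1) : ℝ) : ℂ) * ψ (f - 1)) /
      Nat.card (AdjoinRoot (r ^ e))ˣ = inAvg e ψ := by
  rw [inAvg]
  split_ifs with h
  · subst h
    have h1 : (quotFun (r ^ 1) fun f => ((phi r * locWt r (f - 1) : ℝ) : ℂ) * ψ (f - 1)) =
        fun u => (phi r : ℂ) * quotFun (r ^ 1) (fun f => (locWt r (f - 1) : ℂ) * ψ (f - 1)) u := by
      funext u
      simp only [quotFun]
      push_cast
      ring
    have h2 : (Nat.card (AdjoinRoot (r ^ 1))ˣ : ℂ) = phi r := by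
      rw [card_units_adjoinRoot hr hi, phi]
      push_cast
      rfl
    have h3 : (phi r : ℂ) ≠ 0 := by
      exact_mod_cast (zero_lt_one.trans_le (one_le_phi hi)).ne'
    have := Fintype.ofFinite (AdjoinRoot (r ^ 1))ˣ
    rw [h1, h2, uSum_eq_sum_units, ← Finset.mul_sum, ← uSum_eq_sum_units,
      uSum_quotFun_locWt hr hi ψ (by simpa using hψ), mul_div_cancel_left₀ _ h3]
  · obtain ⟨h, hh⟩ := hp (by omega)
    rw [uSum_quotFun_eq_zero hr hi (by omega) ψ hh, zero_div]
    · intro f g hfg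
      rw [locWt_congr (r := r) (f := f - 1) (g := g - 1), addChar_congr hψ (f := f - 1) (g := g - 1)]
      · rwa [sub_sub_sub_cancel_right]
      · rw [sub_sub_sub_cancel_right]
        exact (dvd_pow_self r (by omega)).trans hfg
    · intro f g
      rw [add_sub_right_comm, AddChar.map_add_eq_mul, locWt_congr (r := r) (g := f - 1)]
      · ring
      · rw [add_sub_cancel_left]
        exact (dvd_pow_self r (by omega)).mul_right g

theorem uSum_out_div {e : ℕ} (he : 1 ≤ e) [Finite (AdjoinRoot (r ^ e))] {ψ : AddChar k[X] ℂ}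
    (hψ : ∀ f, r ^ e ∣ f → ψ f = 1) (hp : ∃ h, ψ (r ^ (e - 1) * h) ≠ 1) :
    uSum (quotFun (r ^ e) fun f => ψ (f - 1)) / Nat.card (AdjoinRoot (r ^ e))ˣ =
      outAvg r e ψ := by
  obtain ⟨h, hh⟩ := hp
  rw [outAvg]
  split_ifs with h1
  · subst h1
    have h2 : (Nat.card (AdjoinRoot (r ^ 1))ˣ : ℂ) = phi r := by
      rw [card_units_adjoinRoot hr hi, phi]
      push_cast
      rfl
    rw [h2, uSum_quotFun_sub_one hr hi ψ (by simpa using hh) (by simpa using hψ)]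
  · rw [uSum_quotFun_eq_zero hr hi (by omega) ψ hh, zero_div]
    · intro f g hfg
      refine addChar_congr hψ ?_
      rwa [sub_sub_sub_cancel_right]
    · intro f g
      rw [add_sub_right_comm, AddChar.map_add_eq_mul, mul_comm]

omit hr hi

theorem abs_locWt_le (r f : k[X]) : |locWt r f| ≤ 3 := by
  have h : sPar k = 0 ∨ sPar k = 1 := by
    rw [sPar]
    split_ifs <;> simp
  rw [locWt]
  rcases h with h | h <;> rw [h] <;> split_ifs <;> norm_num

theorem phi_le (r : k[X]) : phi r ≤ (Fintype.card k : ℝ) ^ r.natDegree := by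
  rw [phi]
  linarith

theorem uSum_sq_le {m : k[X]} (hm : m.Monic) [Finite (AdjoinRoot m)] (F : AdjoinRoot m → ℂ)
    {B : ℝ} (hB : 0 ≤ B) (hF : ∀ u, ‖F u‖ ^ 2 ≤ B) :
    uSum (fun u => ‖F u‖ ^ 2) ≤ B * (Fintype.card k : ℝ) ^ m.natDegree := by
  have := Fintype.ofFinite (AdjoinRoot m)
  rw [uSum_eq_sum_ite]
  refine (Finset.sum_le_card_nsmul _ _ B fun u _ => ?_).trans_eq ?_
  · split_ifs
    exacts [hF u, hB]
  · rw [Finset.card_univ, card_adjoinRoot hm, nsmul_eq_mul, mul_comm]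
    push_cast
    rfl

/-- Local additive characters at finitely many primes, primitive of conductor `r ^ e r`. -/
structure ArcData (T : Finset k[X]) (e : k[X] → ℕ) (loc : k[X] → AddChar k[X] ℂ) : Prop where
  monic : ∀ r ∈ T, r.Monic
  irr : ∀ r ∈ T, Irreducible r
  pos : ∀ r ∈ T, 1 ≤ e r
  periodic : ∀ r ∈ T, ∀ f, r ^ e r ∣ f → loc r f = 1
  primitive : ∀ r ∈ T, ∃ h, loc r (r ^ (e r - 1) * h) ≠ 1
  exp_off : ∀ r ∉ T, e r = 1
  loc_off : ∀ r ∉ T, loc r = 1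

theorem reflect_reflect_mod_sub_mem {n κ : ℕ} (hκn : κ ≤ n + 1) {f : k[X]}
    (hf : f ∈ lowDeg k (n + 1)) :
    f - reflect n (reflect n f %ₘ X ^ κ) ∈ lowDeg k (n + 1 - κ) := by
  have hm : reflect n f %ₘ X ^ κ ∈ lowDeg k κ := by
    rw [mem_lowDeg]
    exact (degree_modByMonic_lt _ (monic_X_pow κ)).trans_eq (degree_X_pow κ)
  have h1 : reflect n f - reflect n f %ₘ X ^ κ ∈ lowDeg k (n + 1) := by
    rw [sub_eq_add_neg]
    exact add_mem_lowDeg _ (reflect_mem_lowDeg hf) _ (neg_mem_lowDeg _ (lowDeg_mono hκn hm))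
  have h2 : X ^ κ ∣ reflect n f - reflect n f %ₘ X ^ κ := by
    rw [modByMonic_eq_sub_mul_div, sub_sub_cancel]
    exact dvd_mul_right _ _
  have h3 : f - reflect n (reflect n f %ₘ X ^ κ) =
      reflect n (reflect n f - reflect n f %ₘ X ^ κ) := by
    rw [reflect_sub, reflect_reflect]
  rw [h3, mem_lowDeg, degree_lt_iff_coeff_zero]
  rw [X_pow_dvd_iff] at h2
  intro i hin
  rw [coeff_reflect]
  by_cases hi : i ≤ n
  · rw [revAt_le hi]
    exact h2 _ (by omega)
  · rw [revAt_eq_self_of_lt (by omega)]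
    rw [mem_lowDeg, degree_lt_iff_coeff_zero] at h1
    exact h1 _ (by omega)

end

end LaurentBound

namespace LaurentBound

section

variable {k : Type*} [Field k] [Fintype k]

/-- The function on `k[X]/(X^κ)` through which a character trivial in low degrees factors. -/
def infFun (n κ : ℕ) (ψ : AddChar k[X] ℂ) : AdjoinRoot (X ^ κ : k[X]) → ℂ :=
  quotFun (X ^ κ) fun g => ψ (reflect n (g %ₘ X ^ κ))

theorem infFun_mk {n κ : ℕ} (hκn : κ ≤ n + 1) {ψ : AddChar k[X] ℂ}
    (hψ : ∀ f ∈ lowDeg k (n + 1 - κ), ψ f = 1) {f : k[X]} (hf : f ∈ lowDeg k (n + 1)) :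
    infFun n κ ψ (AdjoinRoot.mk _ (reflect n f)) = ψ f := by
  rw [infFun, quotFun_mk]
  · have h := hψ _ (reflect_reflect_mod_sub_mem hκn hf)
    conv_rhs => rw [← sub_add_cancel f (reflect n (reflect n f %ₘ X ^ κ)), AddChar.map_add_eq_mul,
      h, one_mul]
  · intro f g h
    have h1 : (f - g) %ₘ X ^ κ = 0 := (modByMonic_eq_zero_iff_dvd (monic_X_pow κ)).2 h
    rw [sub_modByMonic, sub_eq_zero] at h1
    rw [h1]

theorem norm_infFun (n κ : ℕ) (ψ : AddChar k[X] ℂ) (u : AdjoinRoot (X ^ κ : k[X])) :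
    ‖infFun n κ ψ u‖ = 1 := norm_addChar _ _

variable {T₀ S : Finset k[X]} {e : k[X] → ℕ} {loc : k[X] → AddChar k[X] ℂ}

/-- The local factor at `r` of the sieve weight times the character. -/
def locFun (S : Finset k[X]) (loc : k[X] → AddChar k[X] ℂ) (r f : k[X]) : ℂ :=
  (if r ∈ S then ((phi r * locWt r (f - 1) : ℝ) : ℂ) else 1) * loc r (f - 1)

theorem ArcData.norm_irreds_le (hA : ArcData T₀ e loc) (hS : ∀ r ∈ S, r.Monic ∧ Irreducible r)
    {ψ ψ₂ : AddChar k[X] ℂ} {L n : ℕ} (hL : 1 ≤ L) (hn : 1 ≤ n)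
    (hψ₂ : ∀ f ∈ lowDeg k L, ψ₂ f = 1) (hψ : ∀ f, ψ f = ψ₂ f * ∏ r ∈ T₀, loc r f)
    (hdeg : ∀ r ∈ T₀ ∪ S, r.natDegree < n) :
    ‖∑ P ∈ irreds k n, ∑ c : kˣ, n * (((∏ r ∈ S, phi r * locWt r (C (c : k) * P - 1) : ℝ) : ℂ) *
          ψ (C (c : k) * P - 1)) -
        (∏ r ∈ T₀, if r ∈ S then inAvg (e r) (loc r) else outAvg r (e r) (loc r)) *
          ∑ f ∈ monics k n, ∑ c : kˣ, ψ₂ (C (c : k) * f)‖ ≤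
      (Fintype.card k - 1) * ((n + ((n + 1 - L + 1) +
          (∏ r ∈ T₀ ∪ S, r ^ e r).natDegree : ℕ)) * √(Fintype.card k : ℝ) ^ n) *
        √(9 ^ S.card * (Fintype.card k : ℝ) ^ (2 * (∏ r ∈ S, r).natDegree +
          (∏ r ∈ T₀ ∪ S, r ^ e r).natDegree + (n + 1 - L + 1))) := by
  set κ := n + 1 - L + 1 with hκ
  have hT : ∀ r ∈ T₀ ∪ S, r.Monic ∧ Irreducible r := fun r hr => by
    rcases Finset.mem_union.1 hr with h | h
    exacts [⟨hA.monic r h, hA.irr r h⟩, hS r h]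
  have hpos : ∀ r, 1 ≤ e r := fun r => by
    by_cases h : r ∈ T₀
    exacts [hA.pos r h, (hA.exp_off r h).ge]
  have hper : ∀ r f, r ^ e r ∣ f → loc r f = 1 := fun r f hf => by
    by_cases h : r ∈ T₀
    · exact hA.periodic r h f hf
    · rw [hA.loc_off r h, AddChar.one_apply]
  have hm : ∀ i : ↥(T₀ ∪ S), ((i : k[X]) ^ e i).Monic := fun i => (hT i i.2).1.pow _
  have hco : Pairwise fun i j : ↥(T₀ ∪ S) => IsCoprime ((i : k[X]) ^ e i) ((j : k[X]) ^ e j) := by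
    intro i j hij
    refine IsCoprime.pow (((hT i i.2).2.coprime_iff_not_dvd).2 fun h => hij ?_)
    have h1 := (hT i i.2).2.associated_of_dvd (hT j j.2).2 h
    exact Subtype.ext (eq_of_monic_of_associated (hT i i.2).1 (hT j j.2).1 h1)
  have hfin : ∀ i : ↥(T₀ ∪ S), Finite (AdjoinRoot ((i : k[X]) ^ e i)) := fun i =>
    finite_adjoinRoot (hm i)
  have hfinX : Finite (AdjoinRoot (X ^ κ : k[X])) := finite_adjoinRoot (monic_X_pow κ)
  have hP : ∀ P ∈ irreds k n, ∀ i : ↥(T₀ ∪ S), IsCoprime P ((i : k[X]) ^ e i) := by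
    intro P hP i
    rw [mem_irreds] at hP
    refine IsCoprime.pow_right ((hP.2.2.coprime_iff_not_dvd).2 fun h => ?_)
    have h1 := natDegree_le_of_dvd h (hT i i.2).1.ne_zero
    have h2 := hdeg i i.2
    omega
  have hκn : κ ≤ n + 1 := by omega
  have hG : ∀ (r f g : k[X]), r ^ e r ∣ f - g → locFun S loc r f = locFun S loc r g := by
    intro r f g hfg
    rw [locFun, locFun, locWt_congr (r := r) (f := f - 1) (g := g - 1),
      addChar_congr (hper r) (f := f - 1) (g := g - 1)]
    · rwa [sub_sub_sub_cancel_right]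
    · rw [sub_sub_sub_cancel_right]
      exact (dvd_pow_self r (by have := hpos r; omega)).trans hfg
  have key := norm_irreds_local_le hm hco (κ := κ) (by omega) hκn hn hP
    (fun i => quotFun _ (locFun S loc i)) (infFun n κ ψ₂)
  have hψ₂' : ∀ f ∈ lowDeg k (n + 1 - κ), ψ₂ f = 1 := fun f hf =>
    hψ₂ f (lowDeg_mono (by omega) hf)
  have hψ₂1 : ∀ f, ψ₂ (f - 1) = ψ₂ f := fun f => by
    have h1 : ψ₂ (-1) = 1 := hψ₂ _ (neg_mem_lowDeg _ (by
      rw [mem_lowDeg, degree_one]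
      exact_mod_cast hL))
    rw [sub_eq_add_neg, AddChar.map_add_eq_mul, h1, mul_one]
  have hmem : ∀ f ∈ monics k n, ∀ c : kˣ, C (c : k) * f ∈ lowDeg k (n + 1) := by
    intro f hf c
    rw [mem_monics] at hf
    rw [mem_lowDeg, degree_eq_natDegree (mul_ne_zero (C_ne_zero.2 c.ne_zero) hf.1.ne_zero),
      natDegree_C_mul c.ne_zero, hf.2]
    exact_mod_cast Nat.lt_succ_self n
  have hLHS : ∀ P ∈ irreds k n, ∀ c : kˣ,
      (n : ℂ) * ((∏ i : ↥(T₀ ∪ S), quotFun _ (locFun S loc i)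
          (AdjoinRoot.mk ((i : k[X]) ^ e i) (C (c : k) * P))) *
        infFun n κ ψ₂ (AdjoinRoot.mk _ (reflect n (C (c : k) * P)))) =
      n * (((∏ r ∈ S, phi r * locWt r (C (c : k) * P - 1) : ℝ) : ℂ) *
          ψ (C (c : k) * P - 1)) := by
    intro P hP c
    have hPm : P ∈ monics k n := by
      rw [mem_irreds] at hP
      exact mem_monics.2 ⟨hP.1, hP.2.1⟩
    rw [infFun_mk hκn hψ₂' (hmem P hPm c), hψ, hψ₂1]
    simp_rw [quotFun_mk (hG _)]
    rw [Finset.prod_coe_sort (T₀ ∪ S) fun r => locFun S loc r (C (c : k) * P)]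
    simp only [locFun]
    rw [Finset.prod_mul_distrib, Finset.prod_ite_mem, Finset.inter_eq_right.2
      Finset.subset_union_right, ← Finset.prod_subset (Finset.subset_union_left (s₂ := S))
        (f := fun r => loc r (C (c : k) * P - 1))]
    · push_cast
      ring
    · intro r _ hr
      rw [hA.loc_off r hr, AddChar.one_apply]
  have hM : (∏ i : ↥(T₀ ∪ S), uSum (quotFun ((i : k[X]) ^ e i) (locFun S loc i)) /
      (Nat.card (AdjoinRoot ((i : k[X]) ^ e i))ˣ : ℂ)) =
      ∏ r ∈ T₀, if r ∈ S then inAvg (e r) (loc r) else outAvg r (e r) (loc r) := by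
    have h1 : ∀ i : ↥(T₀ ∪ S), uSum (quotFun ((i : k[X]) ^ e i) (locFun S loc i)) /
        (Nat.card (AdjoinRoot ((i : k[X]) ^ e i))ˣ : ℂ) =
        if (i : k[X]) ∈ S then inAvg (e i) (loc i) else outAvg i (e i) (loc i) := by
      rintro ⟨r, hr⟩
      have := hfin ⟨r, hr⟩
      change Finite (AdjoinRoot (r ^ e r)) at this
      change uSum (quotFun (r ^ e r) (locFun S loc r)) / (Nat.card (AdjoinRoot (r ^ e r))ˣ : ℂ) =
        if r ∈ S then inAvg (e r) (loc r) else outAvg r (e r) (loc r)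
      by_cases h : r ∈ S
      · have hl : locFun S loc r = fun f => ((phi r * locWt r (f - 1) : ℝ) : ℂ) * loc r (f - 1) :=
          funext fun f => by rw [locFun, if_pos h]
        rw [hl, if_pos h]
        refine uSum_in_div (hT r hr).1 (hT r hr).2 (hpos r) (hper r) fun h2 => ?_
        by_cases h3 : r ∈ T₀
        · exact hA.primitive r h3
        · rw [hA.exp_off r h3] at h2
          omega
      · have hl : locFun S loc r = fun f => loc r (f - 1) :=
          funext fun f => by rw [locFun, if_neg h, one_mul]
        rw [hl, if_neg h]
        refine uSum_out_div (hT r hr).1 (hT r hr).2 (hpos r) (hper r) (hA.primitive r ?_)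
        exact (Finset.mem_union.1 hr).resolve_right h
    rw [Finset.prod_congr rfl fun i _ => h1 i, Finset.prod_coe_sort (T₀ ∪ S) fun r =>
      if r ∈ S then inAvg (e r) (loc r) else outAvg r (e r) (loc r)]
    refine (Finset.prod_subset Finset.subset_union_left fun r hr hr0 => ?_).symm
    rw [if_pos ((Finset.mem_union.1 hr).resolve_left hr0), inAvg, hA.exp_off r hr0,
      hA.loc_off r hr0, if_pos rfl, AddChar.one_apply]
    ring
  rw [Finset.sum_congr rfl fun P hP => Finset.sum_congr rfl fun c _ => hLHS P hP c, hM,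
    Finset.sum_congr rfl fun f hf => Finset.sum_congr rfl fun c _ =>
      infFun_mk hκn hψ₂' (hmem f hf c)] at key
  have hprod : (∏ i : ↥(T₀ ∪ S), (i : k[X]) ^ e i) = ∏ r ∈ T₀ ∪ S, r ^ e r :=
    Finset.prod_coe_sort (T₀ ∪ S) fun r => r ^ e r
  rw [hprod] at key
  refine key.trans (mul_le_mul_of_nonneg_left (Real.sqrt_le_sqrt ?_) ?_)
  · have hX : uSum (fun w => ‖infFun n κ ψ₂ w‖ ^ 2) ≤ (Fintype.card k : ℝ) ^ κ := by
      have h := uSum_sq_le (monic_X_pow κ) (infFun n κ ψ₂) zero_le_one fun u => by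
        rw [norm_infFun, one_pow]
      rwa [one_mul, natDegree_X_pow] at h
    have hF : ∀ i : ↥(T₀ ∪ S), uSum (fun u => ‖quotFun ((i : k[X]) ^ e i) (locFun S loc i) u‖ ^ 2) ≤
        (if (i : k[X]) ∈ S then 9 * (Fintype.card k : ℝ) ^ (2 * (i : k[X]).natDegree) else 1) *
          (Fintype.card k : ℝ) ^ ((i : k[X]) ^ e i).natDegree := by
      intro i
      have h0 : (0 : ℝ) ≤ if (i : k[X]) ∈ S then
          9 * (Fintype.card k : ℝ) ^ (2 * (i : k[X]).natDegree) else 1 := by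
        split_ifs <;> positivity
      refine uSum_sq_le (hm i) _ h0 fun u => ?_
      rw [quotFun, locFun, norm_mul, norm_addChar, mul_one]
      split_ifs
      · rw [Complex.norm_real, Real.norm_eq_abs, sq_abs, mul_pow]
        have h1 := one_le_phi (hT i i.2).2
        have h2 := phi_le (i : k[X])
        have h3 := abs_locWt_le (i : k[X])
          (Function.surjInv (AdjoinRoot.mk_surjective (g := (i : k[X]) ^ e i)) u - 1)
        rw [mul_comm 2, pow_mul, mul_comm]
        refine mul_le_mul ?_ (pow_le_pow_left₀ (by linarith) h2 2) (sq_nonneg _) (by norm_num)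
        rw [← sq_abs]
        nlinarith [abs_nonneg (locWt (i : k[X])
          (Function.surjInv (AdjoinRoot.mk_surjective (g := (i : k[X]) ^ e i)) u - 1))]
      · simp
    have hU : ∀ {B : Type _} [CommRing B] [Finite B] (F : B → ℂ),
        0 ≤ uSum fun u => ‖F u‖ ^ 2 := fun F => by
      rw [uSum]
      exact finsum_nonneg fun _ => sq_nonneg _
    refine (mul_le_mul (Finset.prod_le_prod (fun i _ => hU _) fun i _ => hF i) hX (hU _)
      (Finset.prod_nonneg fun i _ => by split_ifs <;> positivity)).trans_eq ?_
    rw [Finset.prod_mul_distrib, Finset.prod_coe_sort (T₀ ∪ S) fun r =>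
        if r ∈ S then 9 * (Fintype.card k : ℝ) ^ (2 * r.natDegree) else 1,
      Finset.prod_ite_mem, Finset.inter_eq_right.2 Finset.subset_union_right,
      Finset.prod_mul_distrib, Finset.prod_const, Finset.prod_pow_eq_pow_sum,
      Finset.prod_pow_eq_pow_sum, ← natDegree_prod_of_monic _ _ fun i _ => hm i, hprod,
      ← Finset.mul_sum, natDegree_prod_of_monic _ _ fun r hr => (hS r hr).1]
    ring
  · have h1 : (1 : ℝ) ≤ Fintype.card k := by exact_mod_cast Fintype.card_pos
    have h2 : (0 : ℝ) ≤ Fintype.card k - 1 := by linarith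
    positivity

end

end LaurentBound

namespace LaurentBound

section

variable {k : Type*} [Field k] [Fintype k]

/-- The monic irreducible factors of `ν`. -/
def monicFactors (ν : k[X]) : Finset k[X] :=
  (lowDeg k (ν.natDegree + 1)).filter fun r => r.Monic ∧ Irreducible r ∧ r ∣ ν

theorem mem_monicFactors {ν r : k[X]} (hν : ν ≠ 0) :
    r ∈ monicFactors ν ↔ r.Monic ∧ Irreducible r ∧ r ∣ ν := by
  rw [monicFactors, Finset.mem_filter, mem_lowDeg, and_iff_right_iff_imp]
  rintro ⟨hr, -, h⟩
  rw [degree_eq_natDegree hr.ne_zero]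
  exact_mod_cast Nat.lt_succ_of_le (natDegree_le_of_dvd h hν)

theorem prod_monicFactors_dvd {ν : k[X]} (hν : ν ≠ 0) : ∏ r ∈ monicFactors ν, r ∣ ν := by
  refine Finset.prod_dvd_of_coprime ?_ fun r hr => ((mem_monicFactors hν).1 hr).2.2
  intro r hr r' hr' h
  rw [Finset.mem_coe, mem_monicFactors hν] at hr hr'
  refine (hr.2.1.coprime_iff_not_dvd).2 fun h1 => h ?_
  exact eq_of_monic_of_associated hr.1 hr'.1 (hr.2.1.associated_of_dvd hr'.2.1 h1)

theorem sum_natDegree_monicFactors_le {ν : k[X]} (hν : ν ≠ 0) :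
    ∑ r ∈ monicFactors ν, r.natDegree ≤ ν.natDegree := by
  rw [← natDegree_prod_of_monic _ _ fun r hr => ((mem_monicFactors hν).1 hr).1]
  exact natDegree_le_of_dvd (prod_monicFactors_dvd hν) hν

/-- A sub-polynomial bound for the number of prime factors. -/
theorem exists_pow_card_monicFactors_le {A ε : ℝ} (hA : 1 ≤ A) (hε : 0 < ε) :
    ∃ C : ℝ, 1 ≤ C ∧ ∀ ν : k[X], ν ≠ 0 → A ^ (monicFactors ν).card ≤
      C * (Fintype.card k : ℝ) ^ (ε * ν.natDegree) := by
  have hq : (1 : ℝ) < Fintype.card k := by exact_mod_cast Fintype.one_lt_card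
  have hq0 : (0 : ℝ) < Fintype.card k := by linarith
  obtain ⟨j, hj⟩ := pow_unbounded_of_one_lt A (Real.one_lt_rpow hq hε)
  refine ⟨A ^ (lowDeg k j).card, one_le_pow₀ hA, fun ν hν => ?_⟩
  have h1 : (monicFactors ν).card ≤ (lowDeg k j).card +
      ((monicFactors ν).filter fun r => j ≤ r.natDegree).card := by
    rw [← Finset.card_filter_add_card_filter_not (s := monicFactors ν) (fun r => j ≤ r.natDegree),
      add_comm]
    gcongr
    intro r hr
    rw [Finset.mem_filter, mem_monicFactors hν] at hr
    rw [mem_lowDeg, degree_eq_natDegree hr.1.1.ne_zero]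
    exact_mod_cast not_le.1 hr.2
  set c := ((monicFactors ν).filter fun r => j ≤ r.natDegree).card with hc
  have h2 : c * j ≤ ν.natDegree := by
    refine le_trans ?_ (sum_natDegree_monicFactors_le hν)
    refine le_trans ?_ (Finset.sum_le_sum_of_subset (Finset.filter_subset (fun r => j ≤ r.natDegree) _))
    rw [hc, ← smul_eq_mul]
    exact Finset.card_nsmul_le_sum _ _ _ fun r hr => (Finset.mem_filter.1 hr).2
  calc A ^ (monicFactors ν).card ≤ A ^ ((lowDeg k j).card + c) := pow_le_pow_right₀ hA h1
    _ = A ^ (lowDeg k j).card * A ^ c := pow_add _ _ _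
    _ ≤ A ^ (lowDeg k j).card * (Fintype.card k : ℝ) ^ (ε * ν.natDegree) := by
      gcongr
      refine (pow_le_pow_left₀ (by linarith) hj.le c).trans ?_
      rw [← pow_mul, ← Real.rpow_natCast, ← Real.rpow_mul hq0.le]
      refine Real.rpow_le_rpow_of_exponent_le hq.le (mul_le_mul_of_nonneg_left ?_ hε.le)
      exact_mod_cast (by rw [mul_comm]; exact h2 : j * c ≤ ν.natDegree)

theorem card_filter_dvd_monics {g : k[X]} (hg : g.Monic) (D : ℕ) :
    ((monics k D).filter fun ν => g ∣ ν).card =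
      if g.natDegree ≤ D then Fintype.card k ^ (D - g.natDegree) else 0 := by
  split_ifs with h
  · rw [← card_monics]
    symm
    refine Finset.card_bij (fun f _ => g * f) ?_ ?_ ?_
    · intro f hf
      rw [mem_monics] at hf
      rw [Finset.mem_filter, mem_monics]
      refine ⟨⟨hg.mul hf.1, ?_⟩, dvd_mul_right _ _⟩
      rw [hg.natDegree_mul hf.1, hf.2]
      omega
    · intro f _ f' _ hff
      exact mul_left_cancel₀ hg.ne_zero hff
    · intro ν hν
      rw [Finset.mem_filter, mem_monics] at hν
      obtain ⟨⟨h1, h2⟩, f, rfl⟩ := hν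
      have hf : f.Monic := hg.of_mul_monic_left h1
      rw [hg.natDegree_mul hf] at h2
      exact ⟨f, mem_monics.2 ⟨hf, by omega⟩, rfl⟩
  · rw [Finset.card_eq_zero, Finset.filter_eq_empty_iff]
    intro ν hν hd
    rw [mem_monics] at hν
    have := natDegree_le_of_dvd hd hν.1.ne_zero
    omega

variable {E : Type*} [Field E] [CharZero E]

/-- Averages of products of indicator functions of divisibility over monic polynomials. -/
theorem sum_monics_prod_ite {T : Finset k[X]} (hT : ∀ r ∈ T, r.Monic ∧ Irreducible r)
    (a b : k[X] → E) (D : ℕ) :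
    ∑ ν ∈ monics k D, ∏ r ∈ T, (a r * (if r ∣ ν then 1 else 0) + b r) =
      ∑ U ∈ T.powerset, (∏ r ∈ U, a r) * (∏ r ∈ T \ U, b r) *
        (if (∏ r ∈ U, r).natDegree ≤ D then
          (Fintype.card k : E) ^ (D - (∏ r ∈ U, r).natDegree) else 0) := by
  simp_rw [Finset.prod_add]
  rw [Finset.sum_comm]
  refine Finset.sum_congr rfl fun U hU => ?_
  rw [Finset.mem_powerset] at hU
  have h1 : ∀ ν : k[X], (∏ r ∈ U, if r ∣ ν then (1 : E) else 0) =
      if ∏ r ∈ U, r ∣ ν then 1 else 0 := by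
    intro ν
    rw [Finset.prod_ite_zero, Finset.prod_const_one]
    have h2 : (∀ r ∈ U, r ∣ ν) ↔ ∏ r ∈ U, r ∣ ν := by
      refine ⟨fun h => Finset.prod_dvd_of_coprime ?_ h, fun h r hr =>
        (Finset.dvd_prod_of_mem _ hr).trans h⟩
      intro r hr r' hr' hne
      have hr := hT r (hU hr)
      have hr' := hT r' (hU hr')
      refine (hr.2.coprime_iff_not_dvd).2 fun h1 => hne ?_
      exact eq_of_monic_of_associated hr.1 hr'.1 (hr.2.associated_of_dvd hr'.2 h1)
    simp only [h2]
  have h3 : (∑ ν ∈ monics k D, if ∏ r ∈ U, r ∣ ν then (1 : E) else 0) =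
      if (∏ r ∈ U, r).natDegree ≤ D then
          (Fintype.card k : E) ^ (D - (∏ r ∈ U, r).natDegree) else 0 := by
    rw [Finset.sum_boole, card_filter_dvd_monics (monic_prod_of_monic _ _ fun r hr => (hT r (hU hr)).1)]
    push_cast
    rfl
  rw [← h3, Finset.mul_sum]
  refine Finset.sum_congr rfl fun ν _ => ?_
  rw [Finset.prod_mul_distrib, h1]
  ring

theorem avg_monics_prod_ite {T : Finset k[X]} (hT : ∀ r ∈ T, r.Monic ∧ Irreducible r)
    (a b : k[X] → E) {D : ℕ} (hD : (∏ r ∈ T, r).natDegree ≤ D) :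
    ((Fintype.card k : E) ^ D)⁻¹ *
        ∑ ν ∈ monics k D, ∏ r ∈ T, (a r * (if r ∣ ν then 1 else 0) + b r) =
      ∏ r ∈ T, (a r / (Fintype.card k : E) ^ r.natDegree + b r) := by
  have hq : (Fintype.card k : E) ≠ 0 := Nat.cast_ne_zero.2 Fintype.card_ne_zero
  rw [sum_monics_prod_ite hT, Finset.prod_add, Finset.mul_sum]
  refine Finset.sum_congr rfl fun U hU => ?_
  rw [Finset.mem_powerset] at hU
  have hU' : ∀ r ∈ U, r.Monic := fun r hr => (hT r (hU hr)).1
  have h1 : (∏ r ∈ U, r).natDegree ≤ D :=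
    (natDegree_le_of_dvd (Finset.prod_dvd_prod_of_subset _ _ _ hU)
      (monic_prod_of_monic _ _ fun r hr => (hT r hr).1).ne_zero).trans hD
  rw [if_pos h1, Finset.prod_div_distrib, Finset.prod_pow_eq_pow_sum,
    ← natDegree_prod_of_monic _ _ hU', pow_sub₀ _ hq h1]
  field_simp

theorem avg_monics_prod_ite_le {T : Finset k[X]} (hT : ∀ r ∈ T, r.Monic ∧ Irreducible r)
    {a b : k[X] → ℝ} (ha : ∀ r, 0 ≤ a r) (hb : ∀ r, 0 ≤ b r) (D : ℕ) :
    ((Fintype.card k : ℝ) ^ D)⁻¹ *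
        ∑ ν ∈ monics k D, ∏ r ∈ T, (a r * (if r ∣ ν then 1 else 0) + b r) ≤
      ∏ r ∈ T, (a r / (Fintype.card k : ℝ) ^ r.natDegree + b r) := by
  have hq : (0 : ℝ) < Fintype.card k := by exact_mod_cast Fintype.card_pos
  rw [sum_monics_prod_ite hT, Finset.prod_add, Finset.mul_sum]
  refine Finset.sum_le_sum fun U hU => ?_
  rw [Finset.mem_powerset] at hU
  have hU' : ∀ r ∈ U, r.Monic := fun r hr => (hT r (hU hr)).1
  have h2 : 0 ≤ (∏ r ∈ U, a r) * ∏ r ∈ T \ U, b r :=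
    mul_nonneg (Finset.prod_nonneg fun r _ => ha r) (Finset.prod_nonneg fun r _ => hb r)
  rw [Finset.prod_div_distrib, Finset.prod_pow_eq_pow_sum, ← natDegree_prod_of_monic _ _ hU']
  split_ifs with h1
  · rw [pow_sub₀ _ hq.ne' h1]
    exact le_of_eq (by field_simp)
  · rw [mul_zero, mul_zero, div_mul_eq_mul_div]
    positivity

end

end LaurentBound

namespace LaurentBound

open scoped ComplexConjugate

section

variable {k : Type*} [Field k] [Fintype k]

theorem map_neg_addChar (ψ : AddChar k[X] ℂ) (f : k[X]) : ψ (-f) = conj (ψ f) := by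
  rw [AddChar.map_neg_eq_inv, Complex.inv_eq_conj (norm_addChar ψ f)]

theorem sPar_cases : sPar k = 0 ∧ (2 : k) = 0 ∨ sPar k = 1 := by
  rw [sPar]
  split_ifs with h
  exacts [Or.inl ⟨rfl, h⟩, Or.inr rfl]

theorem sPar_mul_add_conj (ψ : AddChar k[X] ℂ) :
    sPar k * ψ 1 + ψ (-1) = (((1 + sPar k) * (ψ 1).re : ℝ) : ℂ) := by
  rcases sPar_cases (k := k) with ⟨h, h2⟩ | h
  · have h3 : (-1 : k[X]) = 1 := by
      rw [neg_eq_iff_add_eq_zero, ← C_1, ← C_add, one_add_one_eq_two, h2, C_0]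
    have h4 : conj (ψ 1) = ψ 1 := by rw [← map_neg_addChar, h3]
    rw [h, h3, add_zero, one_mul, Complex.ofReal_zero, zero_mul, zero_add]
    exact (Complex.conj_eq_iff_re.1 h4).symm
  · rw [h, map_neg_addChar, Complex.ofReal_one, one_mul, Complex.add_conj]
    norm_num

theorem two_le_card_pow {r : k[X]} (hi : Irreducible r) :
    (2 : ℝ) ≤ (Fintype.card k : ℝ) ^ r.natDegree := by
  have := one_le_phi hi
  rw [phi] at this
  linarith

theorem in_sub_out_div_add (r : k[X]) (hi : Irreducible r) (e : ℕ) (ψ : AddChar k[X] ℂ) :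
    ∃ x : ℝ, 0 ≤ x ∧ (inAvg e ψ - outAvg r e ψ) / (Fintype.card k : ℂ) ^ r.natDegree +
      outAvg r e ψ = x := by
  by_cases he : e = 1
  · refine ⟨(1 + sPar k) * (1 - (ψ 1).re) / (Fintype.card k : ℝ) ^ r.natDegree, ?_, ?_⟩
    · have h1 : 0 ≤ sPar k := by
        rcases sPar_cases (k := k) with ⟨h, -⟩ | h <;> rw [h]
        exact zero_le_one
      have h2 : (ψ 1).re ≤ 1 := (Complex.re_le_norm _).trans_eq (norm_addChar ψ 1)
      have h3 : 0 ≤ 1 - (ψ 1).re := by linarith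
      positivity
    · have h1 : (phi r : ℂ) = (Fintype.card k : ℂ) ^ r.natDegree - 1 := by
        rw [phi]
        push_cast
        rfl
      have h2 : (phi r : ℂ) ≠ 0 := by
        exact_mod_cast (zero_lt_one.trans_le (one_le_phi hi)).ne'
      have h3 : (Fintype.card k : ℂ) ^ r.natDegree ≠ 0 :=
        pow_ne_zero _ (Nat.cast_ne_zero.2 Fintype.card_ne_zero)
      rw [inAvg, outAvg, if_pos he, if_pos he]
      have h4 := sPar_mul_add_conj ψ
      push_cast at h4 ⊢
      rw [mul_sub, mul_one, ← h4]
      have h5 : (Fintype.card k : ℂ) ^ r.natDegree = phi r + 1 := by rw [h1, sub_add_cancel]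
      rw [h5] at h3 ⊢
      field_simp
      ring
  · exact ⟨0, le_rfl, by simp [inAvg, outAvg, he]⟩

theorem norm_inAvg_le (e : ℕ) (ψ : AddChar k[X] ℂ) : ‖inAvg e ψ‖ ≤ 3 := by
  rw [inAvg]
  split_ifs
  · rcases sPar_cases (k := k) with ⟨h, -⟩ | h
    · rw [h]
      norm_num
    · rw [h]
      refine (norm_sub_le _ _).trans ?_
      rw [norm_mul, norm_addChar]
      norm_num
  · norm_num

theorem norm_outAvg_le {r : k[X]} (hi : Irreducible r) (e : ℕ) (ψ : AddChar k[X] ℂ) :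
    ‖outAvg r e ψ‖ ≤ 2 / (Fintype.card k : ℝ) ^ r.natDegree := by
  have h1 := two_le_card_pow hi
  have h2 := one_le_phi hi
  rw [outAvg]
  split_ifs
  · rw [norm_div, norm_neg, norm_addChar, Complex.norm_real, Real.norm_eq_abs,
      abs_of_pos (by linarith), div_le_div_iff₀ (by linarith) (by linarith), phi]
    linarith
  · rw [norm_zero]
    positivity

/-- The average over the sieve of the products of the local averages. -/
def arcAvg (D : ℕ) (T : Finset k[X]) (e : k[X] → ℕ) (loc : k[X] → AddChar k[X] ℂ) : ℂ :=
  ((Fintype.card k : ℂ) ^ D)⁻¹ * ∑ ν ∈ monics k D, ∏ r ∈ T,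
    if r ∈ monicFactors ν then inAvg (e r) (loc r) else outAvg r (e r) (loc r)

variable {T : Finset k[X]} {e : k[X] → ℕ} {loc : k[X] → AddChar k[X] ℂ}

theorem arcAvg_empty (D : ℕ) : arcAvg D ∅ e loc = 1 := by
  have hq : (Fintype.card k : ℂ) ≠ 0 := Nat.cast_ne_zero.2 Fintype.card_ne_zero
  simp [arcAvg, card_monics, hq]

theorem ArcData.mem_monicFactors_iff (hA : ArcData T e loc) {D : ℕ} {ν r : k[X]}
    (hν : ν ∈ monics k D) (hr : r ∈ T) : r ∈ monicFactors ν ↔ r ∣ ν := by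
  rw [mem_monicFactors (mem_monics.1 hν).1.ne_zero]
  exact ⟨fun h => h.2.2, fun h => ⟨hA.monic r hr, hA.irr r hr, h⟩⟩

theorem ArcData.arcAvg_nonneg (hA : ArcData T e loc) {D : ℕ}
    (hD : (∏ r ∈ T, r ^ e r).natDegree ≤ D) : ∃ x : ℝ, 0 ≤ x ∧ arcAvg D T e loc = x := by
  have hD' : (∏ r ∈ T, r).natDegree ≤ D := by
    refine le_trans (natDegree_le_of_dvd ?_ ?_) hD
    · exact Finset.prod_dvd_prod_of_dvd _ _ fun r hr =>
        dvd_pow_self r (Nat.one_le_iff_ne_zero.1 (hA.pos r hr))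
    · exact (monic_prod_of_monic _ _ fun r hr => (hA.monic r hr).pow _).ne_zero
  have h1 : arcAvg D T e loc = ∏ r ∈ T, ((inAvg (e r) (loc r) - outAvg r (e r) (loc r)) /
      (Fintype.card k : ℂ) ^ r.natDegree + outAvg r (e r) (loc r)) := by
    rw [← avg_monics_prod_ite (fun r hr => ⟨hA.monic r hr, hA.irr r hr⟩) _ _ hD', arcAvg]
    congr 1
    refine Finset.sum_congr rfl fun ν hν => Finset.prod_congr rfl fun r hr => ?_
    simp only [hA.mem_monicFactors_iff hν hr]
    split_ifs <;> ring
  choose! x hx using fun r (hr : r ∈ T) => in_sub_out_div_add r (hA.irr r hr) (e r) (loc r)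
  refine ⟨∏ r ∈ T, x r, Finset.prod_nonneg fun r hr => (hx r hr).1, ?_⟩
  rw [h1, Complex.ofReal_prod]
  exact Finset.prod_congr rfl fun r hr => (hx r hr).2

theorem ArcData.norm_arcAvg_le (hA : ArcData T e loc) (D : ℕ) :
    ‖arcAvg D T e loc‖ ≤ 5 ^ T.card / (Fintype.card k : ℝ) ^ (∏ r ∈ T, r ^ e r).natDegree := by
  have hq : (0 : ℝ) < Fintype.card k := by exact_mod_cast Fintype.card_pos
  by_cases he : ∀ r ∈ T, e r = 1
  · have h0 : (∏ r ∈ T, r ^ e r) = ∏ r ∈ T, r :=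
      Finset.prod_congr rfl fun r hr => by rw [he r hr, pow_one]
    have h1 : ‖arcAvg D T e loc‖ ≤ ((Fintype.card k : ℝ) ^ D)⁻¹ * ∑ ν ∈ monics k D, ∏ r ∈ T,
        (3 * (if r ∣ ν then 1 else 0) + 2 / (Fintype.card k : ℝ) ^ r.natDegree) := by
      rw [arcAvg, norm_mul, norm_inv, norm_pow, Complex.norm_natCast]
      gcongr
      refine (norm_sum_le _ _).trans (Finset.sum_le_sum fun ν hν => ?_)
      rw [norm_prod]
      refine Finset.prod_le_prod (fun _ _ => norm_nonneg _) fun r hr => ?_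
      simp only [hA.mem_monicFactors_iff hν hr]
      have h3 : (0 : ℝ) ≤ 2 / (Fintype.card k : ℝ) ^ r.natDegree := by positivity
      split_ifs
      · have := norm_inAvg_le (e r) (loc r)
        linarith
      · rw [mul_zero, zero_add]
        exact norm_outAvg_le (hA.irr r hr) _ _
    refine h1.trans ((avg_monics_prod_ite_le (fun r hr => ⟨hA.monic r hr, hA.irr r hr⟩)
      (a := fun _ => 3) (b := fun r => 2 / (Fintype.card k : ℝ) ^ r.natDegree)
      (fun _ => by norm_num) (fun _ => by positivity) D).trans_eq ?_)
    rw [h0, natDegree_prod_of_monic _ _ hA.monic, ← Finset.prod_pow_eq_pow_sum,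
      ← Finset.prod_const, ← Finset.prod_div_distrib]
    refine Finset.prod_congr rfl fun r _ => ?_
    rw [← add_div]
    norm_num
  · push Not at he
    obtain ⟨r, hr, hre⟩ := he
    rw [arcAvg, Finset.sum_eq_zero, mul_zero, norm_zero]
    · positivity
    · intro ν _
      refine Finset.prod_eq_zero hr ?_
      simp [inAvg, outAvg, hre]

end

end LaurentBound

namespace LaurentBound

open scoped ComplexConjugate

section

variable {k : Type*} [Field k] [Fintype k]

/-- The sieve weight: an average over monic `ν` of degree `D` of products of local weights. -/
def sieveWt (D : ℕ) (f : k[X]) : ℝ :=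
  ((Fintype.card k : ℝ) ^ D)⁻¹ * ∑ ν ∈ monics k D, ∏ r ∈ monicFactors ν, phi r * locWt r f

variable {T : Finset k[X]} {e : k[X] → ℕ} {loc : k[X] → AddChar k[X] ℂ}

theorem ArcData.natDegree_prod_union_le (hA : ArcData T e loc) {ν : k[X]} (hν : ν ≠ 0) :
    (∏ r ∈ T ∪ monicFactors ν, r ^ e r).natDegree ≤
      (∏ r ∈ T, r ^ e r).natDegree + ν.natDegree := by
  rw [← Finset.union_sdiff_self_eq_union, Finset.prod_union Finset.disjoint_sdiff]
  refine natDegree_mul_le.trans (Nat.add_le_add_left ?_ _)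
  have h1 : ∏ r ∈ monicFactors ν \ T, r ^ e r = ∏ r ∈ monicFactors ν \ T, r :=
    Finset.prod_congr rfl fun r hr => by
      rw [hA.exp_off r (Finset.mem_sdiff.1 hr).2, pow_one]
  rw [h1]
  exact natDegree_le_of_dvd ((Finset.prod_dvd_prod_of_subset _ _ _ Finset.sdiff_subset).trans
    (prod_monicFactors_dvd hν)) hν

theorem ArcData.norm_sieve_irreds_le (hA : ArcData T e loc) {ψ ψ₂ : AddChar k[X] ℂ}
    {L n N D K : ℕ} (hL : 1 ≤ L) (hn : 1 ≤ n) (hnN : n ≤ N)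
    (hψ₂ : ∀ f ∈ lowDeg k L, ψ₂ f = 1) (hψ : ∀ f, ψ f = ψ₂ f * ∏ r ∈ T, loc r f)
    (hdm : (∏ r ∈ T, r ^ e r).natDegree < n) (hD : D < n)
    (hK : (∏ r ∈ T, r ^ e r).natDegree + (n + 1 - L + 1) ≤ K) {B : ℝ}
    (hB : ∀ ν ∈ monics k D, 9 ^ (monicFactors ν).card ≤ B) :
    ‖∑ P ∈ irreds k n, ∑ c : kˣ, n * ((sieveWt D (C (c : k) * P - 1) : ℂ) *
          ψ (C (c : k) * P - 1)) -
        arcAvg D T e loc * ∑ f ∈ monics k n, ∑ c : kˣ, ψ₂ (C (c : k) * f)‖ ≤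
      (Fintype.card k - 1) * ((N + (K + D : ℕ)) * √(Fintype.card k : ℝ) ^ N) *
        √(B * (Fintype.card k : ℝ) ^ (3 * D + K)) := by
  set q := (Fintype.card k : ℝ) with hqdef
  have hq1 : (1 : ℝ) ≤ q := by
    rw [hqdef]
    exact_mod_cast Fintype.card_pos (α := k)
  have hq0 : (0 : ℝ) < q := by linarith
  set Err := (q - 1) * ((N + (K + D : ℕ)) * √q ^ N) * √(B * q ^ (3 * D + K)) with hErr
  have hone : ∀ ν ∈ monics k D,
      ‖∑ P ∈ irreds k n, ∑ c : kˣ, n * (((∏ r ∈ monicFactors ν,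
          phi r * locWt r (C (c : k) * P - 1) : ℝ) : ℂ) * ψ (C (c : k) * P - 1)) -
        (∏ r ∈ T, if r ∈ monicFactors ν then inAvg (e r) (loc r) else outAvg r (e r) (loc r)) *
          ∑ f ∈ monics k n, ∑ c : kˣ, ψ₂ (C (c : k) * f)‖ ≤ Err := by
    intro ν hν
    have hν' := mem_monics.1 hν
    have hν0 : ν ≠ 0 := hν'.1.ne_zero
    have hS : ∀ r ∈ monicFactors ν, r.Monic ∧ Irreducible r := fun r hr => by
      rw [mem_monicFactors hν0] at hr
      exact ⟨hr.1, hr.2.1⟩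
    have hdeg : ∀ r ∈ T ∪ monicFactors ν, r.natDegree < n := by
      intro r hr
      rcases Finset.mem_union.1 hr with h | h
      · refine lt_of_le_of_lt (natDegree_le_of_dvd ?_ ?_) hdm
        · exact (dvd_pow_self r (Nat.one_le_iff_ne_zero.1 (hA.pos r h))).trans
            (Finset.dvd_prod_of_mem (fun r => r ^ e r) h)
        · exact (monic_prod_of_monic _ _ fun r hr => (hA.monic r hr).pow _).ne_zero
      · refine lt_of_le_of_lt (natDegree_le_of_dvd ((mem_monicFactors hν0).1 h).2.2 hν0) ?_
        rwa [hν'.2]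
    refine (hA.norm_irreds_le hS hL hn hψ₂ hψ hdeg).trans ?_
    have h1 := hA.natDegree_prod_union_le hν0
    rw [hν'.2] at h1
    have h2 : (∏ r ∈ monicFactors ν, r).natDegree ≤ D := by
      rw [← hν'.2]
      exact natDegree_le_of_dvd (prod_monicFactors_dvd hν0) hν0
    rw [← hqdef, hErr]
    have hq2 : 0 ≤ q - 1 := by linarith
    have h3 : (9 : ℝ) ^ (monicFactors ν).card ≤ B := hB ν hν
    have h4 : (n + 1 - L + 1) + (∏ r ∈ T ∪ monicFactors ν, r ^ e r).natDegree ≤ K + D := by omega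
    have h5 : 2 * (∏ r ∈ monicFactors ν, r).natDegree +
        (∏ r ∈ T ∪ monicFactors ν, r ^ e r).natDegree + (n + 1 - L + 1) ≤ 3 * D + K := by omega
    have h6 : 1 ≤ √q := one_le_sqrt_card
    have h7 : (0 : ℝ) ≤ B := le_trans (by positivity) h3
    have h8 : (n : ℝ) ≤ N := by exact_mod_cast hnN
    have h9 : (((n + 1 - L + 1) + (∏ r ∈ T ∪ monicFactors ν, r ^ e r).natDegree : ℕ) : ℝ) ≤
        (K + D : ℕ) := by exact_mod_cast h4
    gcongr
  have hcard : ((monics k D).card : ℝ) = q ^ D := by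
    rw [card_monics]
    push_cast
    rfl
  have hsplit : ∑ P ∈ irreds k n, ∑ c : kˣ, (n : ℂ) * ((sieveWt D (C (c : k) * P - 1) : ℂ) *
          ψ (C (c : k) * P - 1)) -
        arcAvg D T e loc * ∑ f ∈ monics k n, ∑ c : kˣ, ψ₂ (C (c : k) * f) =
      ((Fintype.card k : ℂ) ^ D)⁻¹ * ∑ ν ∈ monics k D,
        (∑ P ∈ irreds k n, ∑ c : kˣ, n * (((∏ r ∈ monicFactors ν,
          phi r * locWt r (C (c : k) * P - 1) : ℝ) : ℂ) * ψ (C (c : k) * P - 1)) -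
        (∏ r ∈ T, if r ∈ monicFactors ν then inAvg (e r) (loc r) else outAvg r (e r) (loc r)) *
          ∑ f ∈ monics k n, ∑ c : kˣ, ψ₂ (C (c : k) * f)) := by
    rw [Finset.sum_sub_distrib, mul_sub, ← Finset.sum_mul, ← mul_assoc, arcAvg]
    congr 1
    rw [Finset.sum_comm (s := monics k D), Finset.mul_sum]
    refine Finset.sum_congr rfl fun P _ => ?_
    rw [Finset.sum_comm (s := monics k D), Finset.mul_sum]
    refine Finset.sum_congr rfl fun c _ => ?_
    rw [sieveWt]
    push_cast
    rw [Finset.mul_sum, Finset.mul_sum, Finset.sum_mul, Finset.mul_sum]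
    refine Finset.sum_congr rfl fun ν _ => ?_
    ring
  rw [hsplit, norm_mul, norm_inv, norm_pow, Complex.norm_natCast, ← hqdef,
    inv_mul_le_iff₀ (by positivity), ← hcard, ← nsmul_eq_mul]
  exact (norm_sum_le _ _).trans (Finset.sum_le_card_nsmul _ _ _ hone)

theorem sum_Ioc_monics (F : k[X] → ℂ) {M N : ℕ} (h : M ≤ N) :
    ∑ n ∈ Finset.Ioc M N, ∑ f ∈ monics k n, ∑ c : kˣ, F (C (c : k) * f) =
      ∑ f ∈ lowDeg k (N + 1), F f - ∑ f ∈ lowDeg k (M + 1), F f := by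
  induction N, h using Nat.le_induction with
  | base => simp
  | succ n hn ih =>
    rw [Finset.sum_Ioc_succ_top (by omega), ih, sum_lowDeg_succ (n + 1)]
    ring

/-- A character sum over the polynomials of bounded degree is either full or zero. -/
theorem sum_lowDeg_addChar (ψ : AddChar k[X] ℂ) (n : ℕ) :
    ∑ f ∈ lowDeg k n, ψ f = (Fintype.card k : ℂ) ^ n ∨ ∑ f ∈ lowDeg k n, ψ f = 0 := by
  by_cases h : ∀ f ∈ lowDeg k n, ψ f = 1
  · left
    rw [Finset.sum_congr rfl h, Finset.sum_const, card_lowDeg, nsmul_eq_mul, mul_one]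
    push_cast
    rfl
  · right
    push Not at h
    obtain ⟨g, hg, hg1⟩ := h
    have h1 : ψ g * ∑ f ∈ lowDeg k n, ψ f = ∑ f ∈ lowDeg k n, ψ f := by
      rw [Finset.mul_sum]
      refine Finset.sum_bij' (fun f _ => g + f) (fun f _ => -g + f) ?_ ?_ ?_ ?_ ?_
      · exact fun f hf => add_mem_lowDeg _ hg _ hf
      · exact fun f hf => add_mem_lowDeg _ (neg_mem_lowDeg _ hg) _ hf
      · intro f _
        ring
      · intro f _
        ring
      · intro f _
        rw [AddChar.map_add_eq_mul]
    have h2 : (ψ g - 1) * ∑ f ∈ lowDeg k n, ψ f = 0 := by rw [sub_mul, h1, one_mul, sub_self]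
    exact (mul_eq_zero.1 h2).resolve_left (sub_ne_zero.2 hg1)

theorem ArcData.norm_sieve_sum_le (hA : ArcData T e loc) {ψ ψ₂ : AddChar k[X] ℂ}
    {L M N D K : ℕ} (hL : 1 ≤ L) (hMN : M ≤ N)
    (hψ₂ : ∀ f ∈ lowDeg k L, ψ₂ f = 1) (hψ : ∀ f, ψ f = ψ₂ f * ∏ r ∈ T, loc r f)
    (hdm : (∏ r ∈ T, r ^ e r).natDegree ≤ M) (hD : D ≤ M)
    (hK : (∏ r ∈ T, r ^ e r).natDegree + (N + 1 - L + 1) ≤ K) {B : ℝ}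
    (hB : ∀ ν ∈ monics k D, 9 ^ (monicFactors ν).card ≤ B) :
    ‖∑ n ∈ Finset.Ioc M N, ∑ P ∈ irreds k n, ∑ c : kˣ, n *
          ((sieveWt D (C (c : k) * P - 1) : ℂ) * ψ (C (c : k) * P - 1)) -
        arcAvg D T e loc * (∑ f ∈ lowDeg k (N + 1), ψ₂ f - ∑ f ∈ lowDeg k (M + 1), ψ₂ f)‖ ≤
      N * ((Fintype.card k - 1) * ((N + (K + D : ℕ)) * √(Fintype.card k : ℝ) ^ N) *
        √(B * (Fintype.card k : ℝ) ^ (3 * D + K))) := by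
  rw [← sum_Ioc_monics (fun f => ψ₂ f) hMN, Finset.mul_sum, ← Finset.sum_sub_distrib]
  have hq1 : (1 : ℝ) ≤ Fintype.card k := by exact_mod_cast Fintype.card_pos
  have hq2 : (0 : ℝ) ≤ Fintype.card k - 1 := by linarith
  refine (norm_sum_le _ _).trans ((Finset.sum_le_card_nsmul _ _
    ((Fintype.card k - 1) * ((N + (K + D : ℕ)) * √(Fintype.card k : ℝ) ^ N) *
        √(B * (Fintype.card k : ℝ) ^ (3 * D + K))) fun n hn => ?_).trans ?_)
  · rw [Finset.mem_Ioc] at hn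
    exact hA.norm_sieve_irreds_le hL (by omega) hn.2 hψ₂ hψ (by omega) (by omega) (by omega) hB
  · rw [nsmul_eq_mul, Nat.card_Ioc]
    gcongr
    omega

/-- The lower bound for the sieved exponential sum. -/
theorem ArcData.le_re_sieve_sum (hA : ArcData T e loc) {ψ ψ₂ : AddChar k[X] ℂ}
    {L M N D K : ℕ} (hL : 1 ≤ L) (hMN : M ≤ N)
    (hψ₂ : ∀ f ∈ lowDeg k L, ψ₂ f = 1) (hψ : ∀ f, ψ f = ψ₂ f * ∏ r ∈ T, loc r f)
    (hdm : (∏ r ∈ T, r ^ e r).natDegree ≤ M) (hD : D ≤ M)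
    (hK : (∏ r ∈ T, r ^ e r).natDegree + (N + 1 - L + 1) ≤ K) {B : ℝ}
    (hB : ∀ ν ∈ monics k D, 9 ^ (monicFactors ν).card ≤ B) (hT : 5 ^ T.card ≤ B) :
    -(N * ((Fintype.card k - 1) * ((N + (K + D : ℕ)) * √(Fintype.card k : ℝ) ^ N) *
        √(B * (Fintype.card k : ℝ) ^ (3 * D + K))) +
      B * ((Fintype.card k : ℝ) ^ (M + 1) + (Fintype.card k : ℝ) ^ (N + 1 - D))) ≤
    (∑ n ∈ Finset.Ioc M N, ∑ P ∈ irreds k n, ∑ c : kˣ, n *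
          ((sieveWt D (C (c : k) * P - 1) : ℂ) * ψ (C (c : k) * P - 1))).re := by
  have key := hA.norm_sieve_sum_le hL hMN hψ₂ hψ hdm hD hK hB
  have hq1 : (1 : ℝ) ≤ Fintype.card k := by exact_mod_cast Fintype.card_pos
  have hq0 : (0 : ℝ) < Fintype.card k := by linarith
  have hB0 : 0 ≤ B := le_trans (by positivity) hT
  have h1 := (Complex.abs_re_le_norm _).trans key
  rw [Complex.sub_re, mul_sub, Complex.sub_re] at h1
  have h2 := (abs_le.1 h1).1
  have hE := hA.norm_arcAvg_le D
  have hE1 : ‖arcAvg D T e loc‖ ≤ B := by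
    refine hE.trans ((div_le_self (by positivity) (one_le_pow₀ hq1)).trans hT)
  have hY : (arcAvg D T e loc * ∑ f ∈ lowDeg k (M + 1), ψ₂ f).re ≤
      B * (Fintype.card k : ℝ) ^ (M + 1) := by
    refine (Complex.re_le_norm _).trans ?_
    rw [norm_mul]
    refine mul_le_mul hE1 ?_ (norm_nonneg _) hB0
    refine (norm_sum_le _ _).trans_eq ?_
    simp_rw [norm_addChar]
    rw [Finset.sum_const, card_lowDeg, nsmul_eq_mul, mul_one]
    push_cast
    rfl
  have hX : -(B * (Fintype.card k : ℝ) ^ (N + 1 - D)) ≤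
      (arcAvg D T e loc * ∑ f ∈ lowDeg k (N + 1), ψ₂ f).re := by
    have hneg : -(B * (Fintype.card k : ℝ) ^ (N + 1 - D)) ≤ 0 :=
      neg_nonpos.2 (by positivity)
    rcases sum_lowDeg_addChar ψ₂ (N + 1) with h | h
    · rw [h]
      by_cases hdD : (∏ r ∈ T, r ^ e r).natDegree ≤ D
      · obtain ⟨x, hx, hxE⟩ := hA.arcAvg_nonneg hdD
        refine hneg.trans ?_
        rw [hxE, ← Complex.ofReal_natCast, ← Complex.ofReal_pow, ← Complex.ofReal_mul,
          Complex.ofReal_re]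
        positivity
      · refine neg_le_of_abs_le ((Complex.abs_re_le_norm _).trans ?_)
        rw [norm_mul, norm_pow, Complex.norm_natCast]
        refine (mul_le_mul_of_nonneg_right hE (by positivity)).trans ?_
        rw [div_mul_eq_mul_div, div_le_iff₀ (by positivity), mul_assoc, ← pow_add]
        exact mul_le_mul hT (pow_le_pow_right₀ hq1 (by omega)) (by positivity) hB0
    · rw [h, mul_zero, Complex.zero_re]
      exact hneg
  linarith

end

end LaurentBound

namespace LaurentBound

open scoped ComplexConjugate

section

variable {k : Type*} [Field k]

theorem exists_prime_factorization {m : k[X]} (hm : m.Monic) :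
    ∃ (T : Finset k[X]) (e : k[X] → ℕ), (∀ r ∈ T, r.Monic ∧ Irreducible r ∧ 1 ≤ e r) ∧
      ∏ r ∈ T, r ^ e r = m := by
  refine ⟨(UniqueFactorizationMonoid.normalizedFactors m).toFinset,
    fun r => (UniqueFactorizationMonoid.normalizedFactors m).count r, fun r hr => ?_, ?_⟩
  · rw [Multiset.mem_toFinset] at hr
    refine ⟨?_, UniqueFactorizationMonoid.irreducible_of_normalized_factor r hr,
      Multiset.one_le_count_iff_mem.2 hr⟩
    rw [← UniqueFactorizationMonoid.normalize_normalized_factor r hr]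
    exact monic_normalize (UniqueFactorizationMonoid.irreducible_of_normalized_factor r hr).ne_zero
  · rw [← Finset.prod_multiset_count,
      UniqueFactorizationMonoid.prod_normalizedFactors_eq hm.ne_zero, hm.normalize_eq_self]

theorem isCoprime_pow_of_ne {r s : k[X]} (hr : r.Monic ∧ Irreducible r)
    (hs : s.Monic ∧ Irreducible s) (h : r ≠ s) (a b : ℕ) : IsCoprime (r ^ a) (s ^ b) :=
  IsCoprime.pow ((hr.2.coprime_iff_not_dvd).2 fun h1 => h
    (eq_of_monic_of_associated hr.1 hs.1 (hr.2.associated_of_dvd hs.2 h1)))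

/-- Orthogonal idempotents for a factorization into prime powers. -/
theorem exists_idempotents {T : Finset k[X]} {e : k[X] → ℕ}
    (hT : ∀ r ∈ T, r.Monic ∧ Irreducible r) :
    ∃ ε : k[X] → k[X], (∀ r ∈ T, r ^ e r ∣ ε r - 1 ∧ ∏ s ∈ T.erase r, s ^ e s ∣ ε r) ∧
      ∏ r ∈ T, r ^ e r ∣ ∑ r ∈ T, ε r - 1 := by
  have h1 : ∀ r ∈ T, ∃ ε : k[X], r ^ e r ∣ ε - 1 ∧ ∏ s ∈ T.erase r, s ^ e s ∣ ε := by
    intro r hr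
    have hco : IsCoprime (r ^ e r) (∏ s ∈ T.erase r, s ^ e s) :=
      IsCoprime.prod_right fun s hs => isCoprime_pow_of_ne (hT r hr)
        (hT s (Finset.mem_of_mem_erase hs)) (Finset.ne_of_mem_erase hs).symm _ _
    obtain ⟨a, b, hab⟩ := hco
    refine ⟨b * ∏ s ∈ T.erase r, s ^ e s, ?_, dvd_mul_left _ _⟩
    rw [← hab, sub_add_cancel_right, dvd_neg]
    exact dvd_mul_left _ _
  choose! ε hε using h1
  refine ⟨ε, hε, Finset.prod_dvd_of_coprime (fun r hr s hs h =>
    isCoprime_pow_of_ne (hT r hr) (hT s hs) h _ _) fun s hs => ?_⟩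
  rw [← Finset.add_sum_erase T ε hs, add_sub_right_comm]
  refine dvd_add (hε s hs).1 (Finset.dvd_sum fun r hr => ?_)
  refine dvd_trans ?_ (hε r (Finset.mem_of_mem_erase hr)).2
  exact Finset.dvd_prod_of_mem (fun s => s ^ e s)
    (Finset.mem_erase.2 ⟨(Finset.ne_of_mem_erase hr).symm, hs⟩)

theorem addChar_sum_eq_prod {ι : Type*} (T : Finset ι) (ψ : AddChar k[X] ℂ) (f : ι → k[X]) :
    ψ (∑ i ∈ T, f i) = ∏ i ∈ T, ψ (f i) := by
  induction T using Finset.induction_on with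
  | empty => simp
  | insert a s ha ih => rw [Finset.sum_insert ha, Finset.prod_insert ha, AddChar.map_add_eq_mul, ih]

variable [Fintype k]

/-- Every character periodic modulo `m` splits into primitive local characters at the primes of a
divisor of `m`. -/
theorem exists_arcData {m : k[X]} (hm : m.Monic) {ψ : AddChar k[X] ℂ}
    (hψ : ∀ f, m ∣ f → ψ f = 1) :
    ∃ (T : Finset k[X]) (e : k[X] → ℕ) (loc : k[X] → AddChar k[X] ℂ), ArcData T e loc ∧
      (∏ r ∈ T, r ^ e r).natDegree ≤ m.natDegree ∧ ∀ f, ψ f = ∏ r ∈ T, loc r f := by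
  have hex : ∃ d, ∃ m' : k[X], m'.Monic ∧ (∀ f, m' ∣ f → ψ f = 1) ∧ m'.natDegree = d :=
    ⟨_, m, hm, hψ, rfl⟩
  obtain ⟨m', hm', hper, hd⟩ := Nat.find_spec hex
  have hmin : ∀ m'' : k[X], m''.Monic → (∀ f, m'' ∣ f → ψ f = 1) →
      m'.natDegree ≤ m''.natDegree := fun m'' h1 h2 => by
    rw [hd]
    exact Nat.find_min' hex ⟨m'', h1, h2, rfl⟩
  obtain ⟨T, e₀, hT, hprod⟩ := exists_prime_factorization hm'
  set e : k[X] → ℕ := fun r => if r ∈ T then e₀ r else 1 with he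
  have heT : ∀ r ∈ T, e r = e₀ r := fun r hr => if_pos hr
  have hprod' : ∏ r ∈ T, r ^ e r = m' := by
    rw [← hprod]
    exact Finset.prod_congr rfl fun r hr => by rw [heT r hr]
  have hT' : ∀ r ∈ T, r.Monic ∧ Irreducible r := fun r hr => ⟨(hT r hr).1, (hT r hr).2.1⟩
  obtain ⟨ε, hε, hsum⟩ := exists_idempotents (e := e) hT'
  rw [hprod'] at hsum
  have hsplit : ∀ r ∈ T, r ^ e r * ∏ s ∈ T.erase r, s ^ e s = m' := fun r hr => by
    rw [← hprod', Finset.mul_prod_erase T (fun s => s ^ e s) hr]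
  refine ⟨T, e, fun r => if r ∈ T then ψ.compAddMonoidHom (AddMonoidHom.mulLeft (ε r)) else 1,
    ⟨fun r hr => (hT r hr).1, fun r hr => (hT r hr).2.1, fun r hr => ?_, fun r hr f hf => ?_,
      fun r hr => ?_, fun r hr => if_neg hr, fun r hr => if_neg hr⟩, ?_, fun f => ?_⟩
  · rw [heT r hr]
    exact (hT r hr).2.2
  · rw [if_pos hr]
    change ψ (ε r * f) = 1
    refine hper _ ?_
    rw [← hsplit r hr, mul_comm (r ^ e r)]
    exact mul_dvd_mul (hε r hr).2 hf
  · rw [if_pos hr]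
    by_contra! hcon
    have hcon' : ∀ h, ψ (ε r * (r ^ (e r - 1) * h)) = 1 := hcon
    have he1 : r ^ e r = r * r ^ (e r - 1) := by
      have := (hT r hr).2.2
      rw [← heT r hr] at this
      rw [← pow_succ', Nat.sub_add_cancel this]
    have hc : (∏ s ∈ T.erase r, s ^ e s).Monic :=
      monic_prod_of_monic _ _ fun s hs => (hT s (Finset.mem_of_mem_erase hs)).1.pow _
    have hlt := hmin (r ^ (e r - 1) * ∏ s ∈ T.erase r, s ^ e s)
      (((hT r hr).1.pow _).mul hc) ?_
    · rw [← hsplit r hr, he1, mul_assoc,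
        (hT r hr).1.natDegree_mul (((hT r hr).1.pow _).mul hc)] at hlt
      have := (hT r hr).2.1.natDegree_pos
      omega
    · rintro _ ⟨g, rfl⟩
      have h1 : r ^ (e r - 1) * (∏ s ∈ T.erase r, s ^ e s) * g =
          ε r * (r ^ (e r - 1) * ((∏ s ∈ T.erase r, s ^ e s) * g)) -
            (ε r - 1) * ((r ^ (e r - 1) * ∏ s ∈ T.erase r, s ^ e s) * g) := by ring
      rw [h1, sub_eq_add_neg, AddChar.map_add_eq_mul, hcon', one_mul]
      refine hper _ ((dvd_neg).2 ?_)
      rw [← hsplit r hr]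
      refine mul_dvd_mul (hε r hr).1 ?_
      rw [mul_assoc]
      exact (dvd_mul_right _ g).mul_left _
  · rw [hprod']
    exact hmin m hm hψ
  · have h1 : ∏ r ∈ T, (if r ∈ T then ψ.compAddMonoidHom (AddMonoidHom.mulLeft (ε r)) else 1) f =
        ψ ((∑ r ∈ T, ε r) * f) := by
      rw [Finset.sum_mul, addChar_sum_eq_prod]
      refine Finset.prod_congr rfl fun r hr => ?_
      rw [if_pos hr]
      rfl
    rw [h1]
    have h2 : (∑ r ∈ T, ε r) * f = f + (∑ r ∈ T, ε r - 1) * f := by ring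
    rw [h2, AddChar.map_add_eq_mul, hper _ (hsum.mul_right f), mul_one]

/-- A Hankel-matrix form of Dirichlet's approximation theorem. -/
theorem exists_monic_annihilator (l : k[X] →ₗ[k] k) (M : ℕ) :
    ∃ m : k[X], m.Monic ∧ m.natDegree ≤ M ∧ ∀ g ∈ lowDeg k M, l (m * g) = 0 := by
  let Φ : (Fin (M + 1) → k) →ₗ[k] (Fin M → k) := LinearMap.pi fun j =>
    l ∘ₗ (LinearMap.mulRight k (X ^ (j : ℕ) : k[X])) ∘ₗ (degreeLT k (M + 1)).subtype ∘ₗ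
      (degreeLTEquiv k (M + 1)).symm.toLinearMap
  have hker : LinearMap.ker Φ ≠ ⊥ := LinearMap.ker_ne_bot_of_finrank_lt (by simp)
  obtain ⟨v, hv, hv0⟩ := Submodule.exists_mem_ne_zero_of_ne_bot hker
  set f : k[X] := ((degreeLTEquiv k (M + 1)).symm v : k[X]) with hf
  have hf0 : f ≠ 0 := by
    rw [hf]
    intro h
    exact hv0 ((LinearEquiv.map_eq_zero_iff _).1 (Subtype.ext h))
  have hfd : f.natDegree ≤ M := by
    have h := mem_degreeLT.1 ((degreeLTEquiv k (M + 1)).symm v).2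
    rw [← hf, degree_eq_natDegree hf0] at h
    exact Nat.lt_succ_iff.1 (by exact_mod_cast h)
  have hfl : ∀ j < M, l (f * X ^ j) = 0 := fun j hj => by
    have h := congrFun (LinearMap.mem_ker.1 hv) ⟨j, hj⟩
    exact h
  have hlc : f.leadingCoeff⁻¹ ≠ 0 := inv_ne_zero (leadingCoeff_ne_zero.2 hf0)
  refine ⟨f * C f.leadingCoeff⁻¹, monic_mul_leadingCoeff_inv hf0, ?_, fun g hg => ?_⟩
  · rwa [natDegree_mul_C hlc]
  · rw [mem_lowDeg, degree_lt_iff_coeff_zero] at hg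
    rw [g.as_sum_range' (M + g.natDegree + 1) (by omega), Finset.mul_sum, map_sum]
    refine Finset.sum_eq_zero fun j _ => ?_
    by_cases hj : j < M
    · have h1 : f * C f.leadingCoeff⁻¹ * monomial j (g.coeff j) =
          (f.leadingCoeff⁻¹ * g.coeff j) • (f * X ^ j) := by
        rw [← C_mul_X_pow_eq_monomial, smul_eq_C_mul, C_mul]
        ring
      rw [h1, map_smul, hfl j hj, smul_zero]
    · rw [hg j (not_lt.1 hj), monomial_zero_right, mul_zero, map_zero]

theorem exists_arcData_of_linear (χ : AddChar k ℂ) (l : k[X] →ₗ[k] k) {ψ : AddChar k[X] ℂ}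
    (hψ : ∀ f, ψ f = χ (l f)) {M : ℕ} (hM : 1 ≤ M) :
    ∃ (T : Finset k[X]) (e : k[X] → ℕ) (loc : k[X] → AddChar k[X] ℂ) (ψ₂ : AddChar k[X] ℂ)
      (L : ℕ), ArcData T e loc ∧ 1 ≤ L ∧ (∀ f ∈ lowDeg k L, ψ₂ f = 1) ∧
      (∀ f, ψ f = ψ₂ f * ∏ r ∈ T, loc r f) ∧ (∏ r ∈ T, r ^ e r).natDegree ≤ M ∧
      (∏ r ∈ T, r ^ e r).natDegree + M ≤ L := by
  obtain ⟨m, hm, hmd, hml⟩ := exists_monic_annihilator l M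
  let ψ₁ : AddChar k[X] ℂ := ψ.compAddMonoidHom (modByMonicHom m).toAddMonoidHom
  have hψ₁ : ∀ f, ψ₁ f = ψ (f %ₘ m) := fun f => rfl
  obtain ⟨T, e, loc, hA, hd, hloc⟩ := exists_arcData hm (ψ := ψ₁) fun f hf => by
    rw [hψ₁, (modByMonic_eq_zero_iff_dvd hm).2 hf, AddChar.map_zero_eq_one]
  refine ⟨T, e, loc, ψ * ψ₁⁻¹, M + m.natDegree, hA, by omega, fun f hf => ?_, fun f => ?_,
    by omega, by omega⟩
  · rw [AddChar.mul_apply, AddChar.inv_apply, hψ₁, neg_modByMonic, hψ, hψ,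
      ← AddChar.map_add_eq_mul, ← map_add, ← sub_eq_add_neg, modByMonic_eq_sub_mul_div,
      sub_sub_cancel, hml, AddChar.map_zero_eq_one]
    rw [mem_lowDeg] at hf ⊢
    by_cases h0 : f /ₘ m = 0
    · rw [h0, degree_zero]
      exact WithBot.bot_lt_coe _
    · have hlt : m.degree ≤ f.degree := by
        by_contra h
        exact h0 ((divByMonic_eq_zero_iff hm).2 (not_le.1 h))
      have h1 := degree_add_divByMonic hm hlt
      rw [← h1, degree_eq_natDegree hm.ne_zero, degree_eq_natDegree h0] at hf
      rw [degree_eq_natDegree h0]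
      have h2 : m.natDegree + (f /ₘ m).natDegree < M + m.natDegree := by exact_mod_cast hf
      exact_mod_cast (by omega : (f /ₘ m).natDegree < M)
  · rw [← hloc, AddChar.mul_apply, AddChar.inv_apply, mul_assoc, ← AddChar.map_add_eq_mul,
      neg_add_cancel, AddChar.map_zero_eq_one, mul_one]

end

end LaurentBound

namespace LaurentBound

section

variable {k : Type*} [Field k] [Fintype k]

/-- The sieve weight transported to shifted irreducibles `P - 1` with `M < deg P ≤ N`. -/
def shiftedWeight (M N D : ℕ) (f : k[X]) : ℝ :=
  if Irreducible (f + 1) ∧ M < (f + 1).natDegree ∧ (f + 1).natDegree ≤ N then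
    (f + 1).natDegree * sieveWt D f else 0

theorem irreducible_unit_mul (c : kˣ) {f : k[X]} :
    Irreducible (C (c : k) * f) ↔ Irreducible f :=
  irreducible_isUnit_mul (isUnit_C.2 c.isUnit)

theorem sum_shiftedWeight (F : k[X] → ℂ) {M N : ℕ} (D : ℕ) (h : M ≤ N) :
    ∑ᶠ f ∈ {f : k[X] | f.degree ≤ (N : ℕ)}, shiftedWeight M N D f * (F f).re =
      (∑ n ∈ Finset.Ioc M N, ∑ P ∈ irreds k n, ∑ c : kˣ, n *
          ((sieveWt D (C (c : k) * P - 1) : ℂ) * F (C (c : k) * P - 1))).re := by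
  have hset : {f : k[X] | f.degree ≤ (N : ℕ)} = (lowDeg k (N + 1) : Finset k[X]) := by
    ext f
    rw [Set.mem_ofPred_eq, Finset.mem_coe, mem_lowDeg, ← Polynomial.mem_degreeLE,
      ← Polynomial.mem_degreeLT]
    rw [Polynomial.mem_degreeLE, Polynomial.mem_degreeLT, Polynomial.degree_le_iff_coeff_zero,
      Polynomial.degree_lt_iff_coeff_zero]
    simp only [Nat.cast_lt, Nat.succ_le_iff]
  have h1 : (1 : k[X]) ∈ lowDeg k (N + 1) := by
    rw [mem_lowDeg, degree_one]
    exact_mod_cast Nat.succ_pos N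
  have hshift : ∑ f ∈ lowDeg k (N + 1), (shiftedWeight M N D f : ℂ) * F f =
      ∑ g ∈ lowDeg k (N + 1), (shiftedWeight M N D (g - 1) : ℂ) * F (g - 1) := by
    refine Finset.sum_bij' (fun f _ => f + 1) (fun g _ => g - 1)
      (fun f hf => add_mem_lowDeg _ hf _ h1)
      (fun g hg => by
        rw [sub_eq_add_neg]
        exact add_mem_lowDeg _ hg _ (neg_mem_lowDeg _ h1))
      (fun f _ => by simp) (fun g _ => by simp) (fun f _ => by simp)
  have hlow : ∑ g ∈ lowDeg k (M + 1), (shiftedWeight M N D (g - 1) : ℂ) * F (g - 1) = 0 := by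
    refine Finset.sum_eq_zero fun g hg => ?_
    rw [shiftedWeight, if_neg, Complex.ofReal_zero, zero_mul]
    rintro ⟨-, h2, -⟩
    rw [sub_add_cancel] at h2
    rw [mem_lowDeg] at hg
    have h3 : g.natDegree < M + 1 :=
      (natDegree_lt_iff_degree_lt (by rintro rfl; simp at h2)).2 (by exact_mod_cast hg)
    omega
  have hre : ∑ f ∈ lowDeg k (N + 1), shiftedWeight M N D f * (F f).re =
      (∑ f ∈ lowDeg k (N + 1), (shiftedWeight M N D f : ℂ) * F f).re := by
    rw [Complex.re_sum]
    exact Finset.sum_congr rfl fun f _ => (Complex.re_ofReal_mul _ _).symm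
  rw [hset, finsum_mem_coe_finset, hre, hshift,
    ← sub_zero (∑ g ∈ lowDeg k (N + 1), (shiftedWeight M N D (g - 1) : ℂ) * F (g - 1)), ← hlow,
    ← sum_Ioc_monics (fun g => (shiftedWeight M N D (g - 1) : ℂ) * F (g - 1)) h]
  congr 1
  refine Finset.sum_congr rfl fun n hn => ?_
  rw [Finset.mem_Ioc] at hn
  rw [irreds, Finset.sum_filter]
  refine Finset.sum_congr rfl fun P hP => ?_
  rw [mem_monics] at hP
  have hdeg (c : kˣ) : (C (c : k) * P).natDegree = n := by
    rw [natDegree_C_mul c.ne_zero, hP.2]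
  split_ifs with hirr
  · refine Finset.sum_congr rfl fun c _ => ?_
    rw [shiftedWeight, sub_add_cancel, irreducible_unit_mul, hdeg, if_pos ⟨hirr, hn.1, hn.2⟩]
    push_cast
    ring
  · refine Finset.sum_eq_zero fun c _ => ?_
    rw [shiftedWeight, sub_add_cancel, irreducible_unit_mul, if_neg (fun h => hirr h.1),
      Complex.ofReal_zero, zero_mul]

theorem five_pow_card_le {T : Finset k[X]} {e : k[X] → ℕ} {loc : k[X] → AddChar k[X] ℂ}
    (hA : ArcData T e loc) {B : ℝ}
    (hB : (9 : ℝ) ^ (monicFactors (∏ r ∈ T, r ^ e r)).card ≤ B) : (5 : ℝ) ^ T.card ≤ B := by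
  have hne : ∏ r ∈ T, r ^ e r ≠ 0 :=
    Finset.prod_ne_zero_iff.2 fun r hr => pow_ne_zero _ (hA.irr r hr).ne_zero
  have hsub : T ⊆ monicFactors (∏ r ∈ T, r ^ e r) := fun r hr =>
    (mem_monicFactors hne).2 ⟨hA.monic r hr, hA.irr r hr,
      (dvd_pow_self r (by have := hA.pos r hr; omega)).trans
        (Finset.dvd_prod_of_mem (fun r => r ^ e r) hr)⟩
  calc (5 : ℝ) ^ T.card ≤ 9 ^ T.card := by gcongr; norm_num
    _ ≤ 9 ^ (monicFactors (∏ r ∈ T, r ^ e r)).card :=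
      pow_le_pow_right₀ (by norm_num) (Finset.card_le_card hsub)
    _ ≤ B := hB

end

/-- The total error of the sieved exponential sum is eventually at most `q ^ (11 N / 12) / 2`. -/
theorem exists_error_le {q C : ℝ} (hq : 2 ≤ q) (hC : 1 ≤ C) :
    ∃ N₀ : ℕ, 10 ≤ N₀ ∧ ∀ N : ℕ, N₀ ≤ N →
      N * ((q - 1) * ((N + (N + 2 - N / 2 + N / 10 : ℕ)) * √q ^ N) *
        √(C * q ^ ((1 / 1000 : ℝ) * N) * q ^ (3 * (N / 10) + (N + 2 - N / 2)))) +
      C * q ^ ((1 / 1000 : ℝ) * N) * (q ^ (N / 2 + 1) + q ^ (N + 1 - N / 10)) ≤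
      q ^ ((N : ℝ) * (11 / 12)) / 2 := by
  have hq0 : 0 < q := by linarith
  have hq1 : 1 ≤ q := by linarith
  have hr1 : 1 < q ^ (1 / 100 : ℝ) := Real.one_lt_rpow (by linarith) (by norm_num)
  have hlim := (isLittleO_pow_const_const_pow_of_one_lt (R := ℝ) 2 hr1).bound
    (c := (8 * C * q ^ 3)⁻¹) (by positivity)
  obtain ⟨N₁, hN₁⟩ := Filter.eventually_atTop.1 hlim
  refine ⟨max 10 N₁, le_max_left _ _, fun N hN => ?_⟩
  have hN10 : 10 ≤ N := (le_max_left _ _).trans hN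
  have hmain := hN₁ N ((le_max_right _ _).trans hN)
  have hNr : (10 : ℝ) ≤ N := by exact_mod_cast hN10
  rw [Real.norm_of_nonneg (by positivity), Real.norm_of_nonneg (by positivity),
    inv_mul_eq_div, le_div_iff₀ (by positivity)] at hmain
  have hcast {a : ℕ} {b : ℝ} (h : (a : ℝ) ≤ b) : q ^ a ≤ q ^ b := by
    rw [← Real.rpow_natCast]
    exact Real.rpow_le_rpow_of_exponent_le hq1 h
  have hdiv10 : (N / 10 : ℕ) ≤ (N : ℝ) / 10 := by exact_mod_cast Nat.cast_div_le
  have hdiv10' : (N : ℝ) / 10 - 1 ≤ (N / 10 : ℕ) := by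
    have : N ≤ 10 * (N / 10) + 10 := by omega
    have : (N : ℝ) ≤ 10 * (N / 10 : ℕ) + 10 := by exact_mod_cast this
    linarith
  have hdiv2 : (N / 2 : ℕ) ≤ (N : ℝ) / 2 := by exact_mod_cast Nat.cast_div_le
  have hK : ((N + 2 - N / 2 : ℕ) : ℝ) ≤ N / 2 + 5 / 2 := by
    have : 2 * (N + 2 - N / 2) ≤ N + 5 := by omega
    have : 2 * ((N + 2 - N / 2 : ℕ) : ℝ) ≤ N + 5 := by exact_mod_cast this
    linarith
  have hlast : ((N + 1 - N / 10 : ℕ) : ℝ) ≤ 9 / 10 * N + 2 := by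
    rw [Nat.cast_sub (by omega)]
    push_cast
    linarith
  set R := q ^ ((9 / 10 + 1 / 1000 : ℝ) * N) with hR
  have hR0 : 0 < R := by positivity
  have hroot : √q ^ N = q ^ ((1 / 2 : ℝ) * N) := by
    rw [Real.sqrt_eq_rpow, ← Real.rpow_natCast, ← Real.rpow_mul hq0.le]
  have hsqrt : √(C * q ^ ((1 / 1000 : ℝ) * N) * q ^ (3 * (N / 10) + (N + 2 - N / 2))) ≤
      C * q ^ ((4 / 10 + 1 / 1000 : ℝ) * N + 2) := by
    rw [Real.sqrt_le_left (by positivity), mul_pow, ← Real.rpow_natCast (q ^ (_ : ℝ)),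
      ← Real.rpow_mul hq0.le]
    calc C * q ^ ((1 / 1000 : ℝ) * N) * q ^ (3 * (N / 10) + (N + 2 - N / 2))
        ≤ C ^ 2 * q ^ ((1 / 1000 : ℝ) * N) * q ^ ((8 / 10 : ℝ) * N + 5 / 2) := by
          gcongr
          · exact le_self_pow₀ hC two_ne_zero
          · refine hcast ?_
            push_cast
            linarith
      _ = C ^ 2 * q ^ ((1 / 1000 : ℝ) * N + ((8 / 10 : ℝ) * N + 5 / 2)) := by
          rw [Real.rpow_add hq0 ((1 / 1000 : ℝ) * N), mul_assoc]
      _ ≤ _ := by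
          gcongr
          push_cast
          linarith
  have hfirst : N * ((q - 1) * ((N + (N + 2 - N / 2 + N / 10 : ℕ)) * √q ^ N) *
      √(C * q ^ ((1 / 1000 : ℝ) * N) * q ^ (3 * (N / 10) + (N + 2 - N / 2)))) ≤
      2 * C * q ^ 3 * N ^ 2 * R := by
    calc _ ≤ N * (q * ((2 * N) * q ^ ((1 / 2 : ℝ) * N)) *
          (C * q ^ ((4 / 10 + 1 / 1000 : ℝ) * N + 2))) := by
          rw [hroot]
          gcongr
          · linarith
          · push_cast
            linarith
      _ = 2 * C * q * N ^ 2 * (q ^ ((1 / 2 : ℝ) * N) *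
            q ^ ((4 / 10 + 1 / 1000 : ℝ) * N + 2)) := by ring
      _ = 2 * C * q * N ^ 2 * (R * q ^ 2) := by
          rw [← Real.rpow_natCast q 2, hR, ← Real.rpow_add hq0, ← Real.rpow_add hq0]
          congr 2
          push_cast
          ring
      _ = _ := by ring
  have hsecond : C * q ^ ((1 / 1000 : ℝ) * N) * (q ^ (N / 2 + 1) + q ^ (N + 1 - N / 10)) ≤
      2 * C * q ^ 3 * N ^ 2 * R := by
    calc _ ≤ C * q ^ ((1 / 1000 : ℝ) * N) *
          (q ^ ((9 / 10 : ℝ) * N + 2) + q ^ ((9 / 10 : ℝ) * N + 2)) := by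
          gcongr ?_ * (?_ + ?_)
          · refine hcast ?_
            push_cast
            linarith
          · exact hcast hlast
      _ = 2 * C * (q ^ ((1 / 1000 : ℝ) * N) * q ^ ((9 / 10 : ℝ) * N + 2)) := by ring
      _ = 2 * C * (R * q ^ 2) := by
          rw [← Real.rpow_natCast q 2, hR, ← Real.rpow_add hq0, ← Real.rpow_add hq0]
          congr 2
          push_cast
          ring
      _ = 2 * C * q ^ 2 * 1 * R := by ring
      _ ≤ 2 * C * q ^ 3 * N ^ 2 * R := by
          gcongr
          · norm_num
          · nlinarith
  have hpow : (q ^ (1 / 100 : ℝ)) ^ N * R ≤ q ^ ((N : ℝ) * (11 / 12)) := by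
    rw [← Real.rpow_natCast, ← Real.rpow_mul hq0.le, hR, ← Real.rpow_add hq0]
    exact Real.rpow_le_rpow_of_exponent_le hq1 (by linarith)
  have hfin : (8 * C * q ^ 3 * N ^ 2) * R ≤ (q ^ (1 / 100 : ℝ)) ^ N * R :=
    mul_le_mul_of_nonneg_right (by linarith) hR0.le
  linarith

section

variable (k : Type*) [Field k] [Fintype k]

/-- Weights on shifted irreducibles of large total mass, whose exponential sum against any
character of the form `χ ∘ l` with `l` a linear functional is almost nonnegative. -/
theorem exists_shifted_irreducible_weight :
    ∃ N₀ : ℕ, ∀ N : ℕ, N₀ ≤ N → ∃ Ψ : k[X] → ℝ, (∀ f, Ψ f ≠ 0 → Irreducible (f + 1)) ∧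
      (∀ (χ : AddChar k ℂ) (l : k[X] →ₗ[k] k),
        -((Fintype.card k : ℝ) ^ ((N : ℝ) * (11 / 12)) / 2) ≤
          ∑ᶠ f ∈ {f : k[X] | f.degree ≤ (N : ℕ)}, Ψ f * (χ (l f)).re) ∧
      1 / 2 * (Fintype.card k : ℝ) ^ N ≤ ∑ᶠ f ∈ {f : k[X] | f.degree ≤ (N : ℕ)}, Ψ f := by
  obtain ⟨C, hC, hCbound⟩ := exists_pow_card_monicFactors_le (k := k) (A := 9) (ε := 1 / 1000)
    (by norm_num) (by norm_num)
  have hq : (2 : ℝ) ≤ Fintype.card k := by exact_mod_cast Fintype.one_lt_card (α := k)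
  obtain ⟨N₀, hN₀, herr⟩ := exists_error_le hq hC
  refine ⟨N₀, fun N hN => ⟨shiftedWeight (N / 2) N (N / 10), fun f hf => ?_, ?_, ?_⟩⟩
  · by_contra h
    exact hf (if_neg fun h1 => h h1.1)
  all_goals
    have hE := herr N hN
    set q := (Fintype.card k : ℝ) with hqdef
    have hN10 : 10 ≤ N := hN₀.trans hN
    have hB : ∀ ν : k[X], ν ≠ 0 → ν.natDegree ≤ N →
        (9 : ℝ) ^ (monicFactors ν).card ≤ C * q ^ ((1 / 1000 : ℝ) * N) := by
      intro ν hν hdeg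
      refine (hCbound ν hν).trans ?_
      gcongr
      linarith
    have hBD : ∀ ν ∈ monics k (N / 10),
        (9 : ℝ) ^ (monicFactors ν).card ≤ C * q ^ ((1 / 1000 : ℝ) * N) := fun ν hν =>
      hB ν (mem_monics.1 hν).1.ne_zero ((mem_monics.1 hν).2.trans_le (Nat.div_le_self _ _))
  · intro χ l
    have hM1 : 1 ≤ N / 2 := by omega
    obtain ⟨T, e, loc, ψ₂, L, hA, hL, hψ₂, hψ, hdm, hdL⟩ :=
      exists_arcData_of_linear χ l (ψ := χ.compAddMonoidHom l.toAddMonoidHom) (fun f => rfl) hM1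
    have hne : ∏ r ∈ T, r ^ e r ≠ 0 :=
      Finset.prod_ne_zero_iff.2 fun r hr => pow_ne_zero _ (hA.irr r hr).ne_zero
    have key := hA.le_re_sieve_sum hL (Nat.div_le_self N 2) hψ₂ hψ hdm
      (D := N / 10) (by omega) (K := N + 2 - N / 2) (by omega) hBD
      (five_pow_card_le hA (hB _ hne (by omega)))
    rw [sum_shiftedWeight (fun f => χ (l f)) (N / 10) (Nat.div_le_self N 2)]
    exact (neg_le_neg hE).trans key
  · have hA : ArcData (∅ : Finset k[X]) (fun _ => 1) (fun _ => 1) := by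
      constructor <;> simp
    have key := hA.norm_sieve_sum_le (ψ := 1) (ψ₂ := 1) (L := N + 1) (N := N) (M := N / 2)
      (D := N / 10) (K := N + 2 - N / 2) (by omega) (by omega) (by simp) (by simp) (by simp)
      (by omega) (by simp; omega) hBD
    rw [arcAvg_empty, one_mul] at key
    have hsum := sum_shiftedWeight (fun f => (1 : AddChar k[X] ℂ) f) (N / 10)
      (Nat.div_le_self N 2)
    simp only [AddChar.one_apply, Complex.one_re, mul_one] at hsum key
    rw [hsum]
    have hre := (Complex.abs_re_le_norm _).trans key
    rw [Complex.sub_re] at hre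
    have hlow := (abs_le.1 hre).1
    have hmass : (∑ f ∈ lowDeg k (N + 1), (1 : ℂ) - ∑ f ∈ lowDeg k (N / 2 + 1), (1 : ℂ)).re =
        q ^ (N + 1) - q ^ (N / 2 + 1) := by
      rw [Finset.sum_const, Finset.sum_const, card_lowDeg, card_lowDeg, nsmul_one, nsmul_one,
        Complex.sub_re, Complex.natCast_re, Complex.natCast_re]
      push_cast
      rfl
    rw [hmass] at hlow
    have hq1 : 1 ≤ q := by linarith
    have h1 : q ^ (N / 2 + 1) ≤ q ^ N := pow_le_pow_right₀ hq1 (by omega)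
    have h2 : q ^ ((N : ℝ) * (11 / 12)) ≤ q ^ N := by
      rw [← Real.rpow_natCast]
      exact Real.rpow_le_rpow_of_exponent_le hq1 (by linarith [(Nat.cast_nonneg N : (0 : ℝ) ≤ N)])
    have h3 : 2 * q ^ N ≤ q ^ (N + 1) := by
      rw [pow_succ']
      gcongr
    have h4 : 0 ≤ C * q ^ ((1 / 1000 : ℝ) * N) * (q ^ (N / 2 + 1) + q ^ (N + 1 - N / 10)) := by
      positivity
    linarith

end

end LaurentBound

namespace LaurentBound

/-- The additive character `a ↦ exp(2πi · tr(a)/ℓ)` of an extension of `ZMod ℓ`. -/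
def traceChar (ℓ : ℕ) [Fact ℓ.Prime] (k : Type*) [Field k] [Algebra (ZMod ℓ) k] : AddChar k ℂ :=
  (ZMod.stdAddChar (N := ℓ)).compAddMonoidHom (Algebra.trace (ZMod ℓ) k).toAddMonoidHom

/-- The functional `f ↦ res (f x)` on polynomials. -/
def resMul {k : Type} [Field k] (x : LaurentSeries k) : k[X] →ₗ[k] k where
  toFun f := (toK k f * x).coeff 1
  map_add' f g := by simp [toK, add_mul]
  map_smul' a f := by
    rw [toK, toK, smul_eq_C_mul, map_mul, aeval_C, algebraMap_laurent, mul_assoc,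
      HahnSeries.C_mul_eq_smul, HahnSeries.coeff_smul, RingHom.id_apply]

theorem eC_toK_mul {ℓ : ℕ} [Fact ℓ.Prime] {k : Type} [Field k] [Algebra (ZMod ℓ) k]
    (f : k[X]) (x : LaurentSeries k) :
    eC ℓ k (toK k f * x) = traceChar ℓ k (resMul x f) := by
  have h := ZMod.stdAddChar_coe (N := ℓ)
    ((Algebra.trace (ZMod ℓ) k ((toK k f * x).coeff 1)).val : ℤ)
  rw [Int.cast_natCast, ZMod.natCast_zmod_val, Int.cast_natCast] at h
  exact h.symm

end LaurentBound

/-- Normalized van der Corput property: for large `N` there is `Ψ : 𝔽_q[t] → ℝ` supported on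
shifted irreducibles `P − 1`, whose exponential sum over `deg f ≤ N` is bounded below by
`−q^(N(11/12+η))/2` everywhere, and whose total mass is `≫ q^N`. -/
theorem normalized_van_der_Corput (η : ℝ) (hη0 : 0 < η) (hη : η < 1 / 12) :
    ∃ c : ℝ, 0 < c ∧ ∃ N₀ : ℕ, ∀ N : ℕ, N₀ ≤ N →
      ∃ Ψ : Polynomial Fq → ℝ,
        (∀ f : Polynomial Fq, Ψ f ≠ 0 → Irreducible (f + 1)) ∧
        (∀ x : LaurentSeries Fq,
          -((Fintype.card Fq : ℝ) ^ ((N : ℝ) * (11 / 12 + η)) / 2) ≤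
            ∑ᶠ f ∈ {f : Polynomial Fq | f.degree ≤ (N : ℕ)},
              Ψ f * (eC p Fq (toK Fq f * x)).re) ∧
        c * (Fintype.card Fq : ℝ) ^ (N : ℕ) ≤
          ∑ᶠ f ∈ {f : Polynomial Fq | f.degree ≤ (N : ℕ)}, Ψ f := by
  obtain ⟨N₀, h⟩ := LaurentBound.exists_shifted_irreducible_weight Fq
  refine ⟨1 / 2, by norm_num, N₀, fun N hN => ?_⟩
  obtain ⟨Ψ, hirr, hchar, hmass⟩ := h N hN
  refine ⟨Ψ, hirr, fun x => ?_, hmass⟩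
  have hq : (1 : ℝ) ≤ Fintype.card Fq := by exact_mod_cast Fintype.card_pos (α := Fq)
  have hexp : (Fintype.card Fq : ℝ) ^ ((N : ℝ) * (11 / 12)) ≤
      (Fintype.card Fq : ℝ) ^ ((N : ℝ) * (11 / 12 + η)) := by
    gcongr
    linarith
  simp only [LaurentBound.eC_toK_mul]
  linarith [hchar (LaurentBound.traceChar p Fq) (LaurentBound.resMul x)]

end
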